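/- arXiv:2301.13040 — 2 statements merged into one kernel-verified Lean document; each statement's English description precedes it below -/
import Mathlib

section
/- Let k be a field and let d, n ≥ 3 be integers such that d is not a multiple of char(k) and (d, n) ≠ (3, 3). Then there exist two irreducible hypersurfaces H, H' ⊆ P^n_k of degree d that are not isomorphic as varieties but whose complements P^n_k \ H and P^n_k \ H' are isomorphic. -/
/-!
Common set-up: projective `n`-space over a field `k` as the scheme
`Proj k[x_0, …, x_n]`, complements of hypersurfaces as open subschemes,
hypersurfaces as reduced closed subschemes, and isomorphisms of varieties
over `k` as scheme isomorphisms commuting with the structure morphisms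
to `Spec k`.
-/

open AlgebraicGeometry CategoryTheory MvPolynomial

attribute [local instance] MvPolynomial.gradedAlgebra

noncomputable section

/-- The standard grading on the polynomial ring `k[x_0, …, x_n]`. -/
abbrev grading (k : Type) [Field k] (n : ℕ) := homogeneousSubmodule (Fin (n + 1)) k

/-- Projective `n`-space over `k`, as a scheme. -/
abbrev ProjSpace (k : Type) [Field k] (n : ℕ) : Scheme := Proj (grading k n)

/-- The base scheme `Spec k`. -/
abbrev SpecK (k : Type) [Field k] : Scheme := Spec (CommRingCat.of k)

/-- The structure morphism `ℙⁿ_k ⟶ Spec k`. -/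
abbrev projStruct (k : Type) [Field k] (n : ℕ) : ProjSpace k n ⟶ SpecK k :=
  Proj.toSpecZero (grading k n) ≫
    Spec.map (CommRingCat.ofHom (algebraMap k ((grading k n) 0)))

/-- The open complement `ℙⁿ_f = ℙⁿ ∖ V(f)` of the hypersurface `V(f)`, as a scheme. -/
abbrev PnF (k : Type) [Field k] (n : ℕ) (f : MvPolynomial (Fin (n + 1)) k) : Scheme :=
  (Proj.basicOpen (grading k n) f).toScheme

/-- The structure morphism `ℙⁿ_f ⟶ Spec k`. -/
abbrev PnFStruct (k : Type) [Field k] (n : ℕ) (f : MvPolynomial (Fin (n + 1)) k) :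
    PnF k n f ⟶ SpecK k :=
  (Proj.basicOpen (grading k n) f).ι ≫ projStruct k n

/-- Two schemes equipped with structure morphisms to a common base are isomorphic over
that base.  For varieties over `k` (with base `Spec k`) this is the usual notion of
isomorphism of varieties over `k`. -/
def IsoOver {X Y B : Scheme} (sX : X ⟶ B) (sY : Y ⟶ B) : Prop :=
  ∃ e : X ≅ Y, e.hom ≫ sY = sX

/-- The set of points of `ℙⁿ` where `f` vanishes. -/
def zeroLocusSet (k : Type) [Field k] (n : ℕ) (f : MvPolynomial (Fin (n + 1)) k) :
    Set (ProjSpace k n) :=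
  {x | f ∈ (x : ProjectiveSpectrum (grading k n)).asHomogeneousIdeal}

/-- `ι : H ⟶ ℙⁿ` realizes the scheme `H` as the hypersurface `V(f) ⊆ ℙⁿ`, i.e. as the
reduced closed subscheme of `ℙⁿ` whose underlying set is the zero locus of `f`. -/
structure IsHypersurface {k : Type} [Field k] {n : ℕ} (f : MvPolynomial (Fin (n + 1)) k)
    (H : Scheme) (ι : H ⟶ ProjSpace k n) : Prop where
  isClosedImmersion : IsClosedImmersion ι
  reduced : IsReduced H
  range_eq : Set.range ι.base = zeroLocusSet k n f

section HomogeneousFractions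

variable {σ k : Type*} [Field k]

/-- `u` is a fraction `a / g ^ i` that is homogeneous of degree `e`, where `deg g = d`. -/
def IsFracOfDegree (g : MvPolynomial σ k) (d : ℕ) (e : ℤ) (u : Localization.Away g) : Prop :=
  ∃ (i r : ℕ) (a : MvPolynomial σ k), a.IsHomogeneous r ∧ (r : ℤ) = e + d * i ∧
    u * algebraMap _ (Localization.Away g) g ^ i = algebraMap _ _ a

namespace IsFracOfDegree

variable {g : MvPolynomial σ k} {d : ℕ} {e e' : ℤ} {u v : Localization.Away g}

theorem of_algebraMap {a : MvPolynomial σ k} {r : ℕ} (ha : a.IsHomogeneous r) :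
    IsFracOfDegree g d r (algebraMap _ _ a) :=
  ⟨0, r, a, ha, by simp, by simp⟩

theorem mul (hu : IsFracOfDegree g d e u) (hv : IsFracOfDegree g d e' v) :
    IsFracOfDegree g d (e + e') (u * v) := by
  obtain ⟨i, r, a, ha, hr, hua⟩ := hu
  obtain ⟨j, s, b, hb, hs, hvb⟩ := hv
  refine ⟨i + j, r + s, a * b, ha.mul hb, by push_cast; rw [hr, hs]; ring, ?_⟩
  rw [map_mul, ← hua, ← hvb]; ring

theorem add (hg : g.IsHomogeneous d) (hu : IsFracOfDegree g d e u)
    (hv : IsFracOfDegree g d e v) : IsFracOfDegree g d e (u + v) := by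
  obtain ⟨i, r, a, ha, hr, hua⟩ := hu
  obtain ⟨j, s, b, hb, hs, hvb⟩ := hv
  refine ⟨i + j, r + d * j, a * g ^ j + b * g ^ i, (ha.mul (hg.pow j)).add ?_,
    by push_cast; rw [hr]; ring, ?_⟩
  · have : r + d * j = s + d * i := by zify; rw [hr, hs]; ring
    rw [this]; exact hb.mul (hg.pow i)
  · rw [map_add, map_mul, map_mul, ← hua, ← hvb, map_pow, map_pow]; ring

theorem sum (hg : g.IsHomogeneous d) {ι : Type*} (s : Finset ι) (f : ι → Localization.Away g)
    (h : ∀ i ∈ s, IsFracOfDegree g d e (f i)) (he : IsFracOfDegree g d e 0) :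
    IsFracOfDegree g d e (∑ i ∈ s, f i) := by
  classical
  induction s using Finset.induction_on with
  | empty => simpa using he
  | insert a s ha ih =>
    rw [Finset.sum_insert ha]
    exact (h a (by simp)).add hg (ih fun i hi => h i (by simp [hi]))

theorem zero (hd : 0 < d) : IsFracOfDegree g d e 0 := by
  refine ⟨e.natAbs, (e + d * e.natAbs).toNat, 0, isHomogeneous_zero _ _ _, ?_, by simp⟩
  rw [Int.toNat_of_nonneg]
  have : (e.natAbs : ℤ) ≤ d * e.natAbs := by
    have : (1 : ℤ) ≤ d := by exact_mod_cast hd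
    nlinarith [Int.natCast_nonneg e.natAbs]
  omega

theorem one : IsFracOfDegree g d 0 1 := by
  simpa using of_algebraMap (g := g) (d := d) (isHomogeneous_one σ k)

theorem pow (hu : IsFracOfDegree g d e u) (n : ℕ) : IsFracOfDegree g d (n * e) (u ^ n) := by
  induction n with
  | zero => simpa using one
  | succ n ih =>
    rw [pow_succ]; convert ih.mul hu using 1; push_cast; ring

theorem prod {ι : Type*} (s : Finset ι) (f : ι → Localization.Away g) (w : ι → ℤ)
    (h : ∀ i ∈ s, IsFracOfDegree g d (w i) (f i)) :
    IsFracOfDegree g d (∑ i ∈ s, w i) (∏ i ∈ s, f i) := by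
  classical
  induction s using Finset.induction_on with
  | empty => simpa using one
  | insert a s ha ih =>
    rw [Finset.sum_insert ha, Finset.prod_insert ha]
    exact (h a (by simp)).mul (ih fun i hi => h i (by simp [hi]))

theorem neg (hu : IsFracOfDegree g d e u) : IsFracOfDegree g d e (-u) := by
  obtain ⟨i, r, a, ha, hr, hua⟩ := hu
  exact ⟨i, r, -a, ha.neg, hr, by rw [map_neg, ← hua]; ring⟩

theorem sub (hg : g.IsHomogeneous d) (hu : IsFracOfDegree g d e u)
    (hv : IsFracOfDegree g d e v) : IsFracOfDegree g d e (u - v) := by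
  rw [sub_eq_add_neg]; exact hu.add hg hv.neg

theorem aeval (hd : 0 < d) (hg : g.IsHomogeneous d) {τ : Type*} {w : τ → ℤ}
    {v : τ → Localization.Away g} (hv : ∀ i, IsFracOfDegree g d (w i) (v i))
    {p : MvPolynomial τ k} (hp : IsWeightedHomogeneous w p e) :
    IsFracOfDegree g d e (MvPolynomial.aeval v p) := by
  rw [aeval_def, eval₂_eq]
  refine sum hg _ _ (fun s hs => ?_) (zero hd)
  rw [← hp (mem_support_iff.1 hs), Finsupp.weight_apply, Finsupp.sum, ← zero_add (∑ _ ∈ _, _)]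
  refine mul ?_ (prod _ _ _ fun i _ => ?_)
  · rw [IsScalarTower.algebraMap_apply k (MvPolynomial σ k)]
    simpa using of_algebraMap (isHomogeneous_C σ (coeff s p))
  · simpa using (hv i).pow (s i)

theorem invSelf_self : IsFracOfDegree g d (-d) (IsLocalization.Away.invSelf g) :=
  ⟨1, 0, 1, isHomogeneous_one _ _, by simp, by
    rw [pow_one, mul_comm, IsLocalization.Away.mul_invSelf, map_one]⟩

/-- Division by a power of a variable lowers the degree. -/
theorem of_X_pow_mul (hd : 0 < d) (hg0 : g ≠ 0) (hg : g.IsHomogeneous d) (i : σ) (m : ℕ)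
    (h : IsFracOfDegree g d e (algebraMap (MvPolynomial σ k) _ (X i) ^ m * u)) :
    IsFracOfDegree g d (e - m) u := by
  have hinj : Function.Injective (algebraMap (MvPolynomial σ k) (Localization.Away g)) :=
    IsLocalization.injective _ (powers_le_nonZeroDivisors_of_noZeroDivisors hg0)
  obtain ⟨c, r, a, ha, hr, hua⟩ := h
  obtain ⟨⟨b, ⟨_, l, rfl⟩⟩, hb⟩ := IsLocalization.surj (Submonoid.powers g) u
  dsimp only at hb
  have key : X i ^ m * (b * g ^ c) = a * g ^ l := by
    apply hinj
    simp only [map_mul, map_pow, ← hua, ← hb]; ring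
  have hu : u * algebraMap _ (Localization.Away g) g ^ (l + c) = algebraMap _ _ (b * g ^ c) := by
    rw [map_mul, ← hb]; simp only [map_pow]; ring
  have hbg : ∀ s, coeff s (b * g ^ c) ≠ 0 → Finsupp.weight 1 s + m = r + d * l := by
    intro s hs
    have h1 : coeff (Finsupp.single i m + s) (a * g ^ l) ≠ 0 := by
      rw [← key, X_pow_eq_monomial, coeff_monomial_mul, one_mul]; exact hs
    have := (ha.mul (hg.pow l)) h1
    rw [map_add, Finsupp.weight_single] at this
    simp at this
    omega
  by_cases hb0 : b * g ^ c = 0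
  · have : u = 0 := by
      rw [hb0, map_zero] at hu
      exact (IsLocalization.Away.algebraMap_pow_isUnit g (l + c)).mul_left_eq_zero.1 hu
    rw [this]; exact zero hd
  · obtain ⟨s, hs⟩ := ne_zero_iff.1 hb0
    refine ⟨l + c, Finsupp.weight 1 s, b * g ^ c, fun t ht => ?_, ?_, hu⟩
    · have := hbg s hs; have := hbg t ht; omega
    · have : ((Finsupp.weight 1 s : ℕ) : ℤ) + m = r + d * l := by exact_mod_cast hbg s hs
      push_cast; rw [hr] at this; linarith

end IsFracOfDegree

end HomogeneousFractions

namespace IsFracOfDegree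

variable {σ k : Type*} [Field k] {g : MvPolynomial σ k} {d : ℕ} {e : ℤ} {u : Localization.Away g}

theorem of_mul_pow (i : ℕ)
    (h : IsFracOfDegree g d (e + d * i) (u * algebraMap _ (Localization.Away g) g ^ i)) :
    IsFracOfDegree g d e u := by
  obtain ⟨l, r, a, ha, hr, h⟩ := h
  exact ⟨i + l, r, a, ha, by push_cast; rw [hr]; ring, by rw [← h]; ring⟩

end IsFracOfDegree

section ComplementIsomorphism

variable {σ k : Type*} [Field k]

theorem isWeightedHomogeneous_one_int {p : MvPolynomial σ k} {r : ℕ} (hp : p.IsHomogeneous r) :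
    IsWeightedHomogeneous (fun _ => (1 : ℤ)) p r := by
  intro s hs
  rw [← hp hs]
  simp [Finsupp.weight_apply, Finsupp.sum]

theorem algHom_eq_of_mem_supported {A : Type*} [CommSemiring A] [Algebra k A] {s : Set σ}
    {φ ψ : MvPolynomial σ k →ₐ[k] A} (h : ∀ i ∈ s, φ (X i) = ψ (X i)) {p : MvPolynomial σ k}
    (hp : p ∈ supported k s) : φ p = ψ p := by
  have : supported k s ≤ AlgHom.equalizer φ ψ := by
    rw [supported_eq_adjoin_X, Algebra.adjoin_le_iff]
    rintro _ ⟨i, hi, rfl⟩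
    exact h i hi
  exact this hp

variable [DecidableEq σ]

/-- Evaluation of polynomials in `Localization.Away g`, with the variable `z` replaced by the
fraction `x ^ j / g`. -/
def fracEval (x z : σ) (j : ℕ) (g : MvPolynomial σ k) :
    MvPolynomial σ k →ₐ[k] Localization.Away g :=
  aeval fun i => if i = z then algebraMap (MvPolynomial σ k) _ (X x) ^ j * IsLocalization.Away.invSelf g
    else algebraMap (MvPolynomial σ k) _ (X i)

variable {x z : σ} {j d : ℕ} {g : MvPolynomial σ k}

theorem fracEval_X_self : fracEval x z j g (X z) =
    algebraMap (MvPolynomial σ k) _ (X x) ^ j * IsLocalization.Away.invSelf g := by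
  simp [fracEval]

theorem fracEval_X_of_ne {i : σ} (h : i ≠ z) :
    fracEval x z j g (X i) = algebraMap (MvPolynomial σ k) _ (X i) := by
  simp [fracEval, h]

theorem fracEval_of_mem_supported {p : MvPolynomial σ k} (hp : p ∈ supported k {i | i ≠ z}) :
    fracEval x z j g p = algebraMap _ _ p :=
  algHom_eq_of_mem_supported (ψ := IsScalarTower.toAlgHom k (MvPolynomial σ k) _)
    (fun _ hi => fracEval_X_of_ne hi) hp

/-- The weights for which the variable `z` has degree `-2`. -/
def auxWeight (z : σ) (i : σ) : ℤ := if i = z then -2 else 1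

theorem isFracOfDegree_fracEval (hg : g.IsHomogeneous (j + 2)) {p : MvPolynomial σ k} {e : ℤ}
    (hp : IsWeightedHomogeneous (auxWeight z) p e) :
    IsFracOfDegree g (j + 2) e (fracEval x z j g p) := by
  refine IsFracOfDegree.aeval (by omega) hg (fun i => ?_) hp
  unfold auxWeight
  split_ifs with h
  · have := ((IsFracOfDegree.of_algebraMap (g := g) (d := j + 2) (isHomogeneous_X k x)).pow j).mul
      IsFracOfDegree.invSelf_self
    convert this using 1
    push_cast; ring
  · exact IsFracOfDegree.of_algebraMap (isHomogeneous_X k i)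

/-- An endomorphism `F` of the polynomial ring sending `f` to `g` up to a change of the
variable `z`, where `f = x ^ (j + 1) * z + q`, after the substitution `z = x ^ j / g`. -/
structure IsTransfer (x z : σ) (j : ℕ) (q g : MvPolynomial σ k)
    (F : MvPolynomial σ k →ₐ[k] MvPolynomial σ k) : Prop where
  map_x : F (X x) = X x
  map_z : F (X z) = X z
  weight : ∀ i, i ≠ z → IsWeightedHomogeneous (auxWeight z) (F (X i)) 1
  dvd : algebraMap (MvPolynomial σ k) (Localization.Away g) (X x) ^ (j + 1) ∣
    algebraMap _ _ g - fracEval x z j g (F q)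

variable {q q' f : MvPolynomial σ k} {F : MvPolynomial σ k →ₐ[k] MvPolynomial σ k}

theorem IsTransfer.exists_algHom (hF : IsTransfer x z j q g F) (hxz : x ≠ z)
    (hq : q ∈ supported k {i | i ≠ z}) (hqd : q.IsHomogeneous (j + 2))
    (hf : f = X x ^ (j + 1) * X z + q)
    (hg : g.IsHomogeneous (j + 2)) (hg0 : g ≠ 0) :
    ∃ Ψ : Localization.Away f →ₐ[k] Localization.Away g,
      (∀ p, Ψ (fracEval x z j f p) = fracEval x z j g (F p)) ∧
      Ψ (algebraMap _ _ f) = algebraMap _ _ g ∧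
      ∀ e u, IsFracOfDegree f (j + 2) e u → IsFracOfDegree g (j + 2) e (Ψ u) := by
  obtain ⟨Z, hZ⟩ := hF.dvd
  let φ : MvPolynomial σ k →ₐ[k] Localization.Away g :=
    aeval fun i => if i = z then Z else fracEval x z j g (F (X i))
  have hφX : ∀ i, i ≠ z → φ (X i) = fracEval x z j g (F (X i)) := fun i hi => by simp [φ, hi]
  have hφ : ∀ p ∈ supported k {i | i ≠ z}, φ p = fracEval x z j g (F p) := fun p hp =>
    algHom_eq_of_mem_supported (ψ := (fracEval x z j g).comp F) hφX hp
  have hφx : φ (X x) = algebraMap (MvPolynomial σ k) _ (X x) := by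
    rw [hφX _ hxz, hF.map_x, fracEval_X_of_ne hxz]
  have hφz : φ (X z) = Z := by simp [φ]
  have hφf : φ f = algebraMap _ _ g := by
    rw [hf, map_add, map_mul, map_pow, hφx, hφz, hφ q hq, ← hZ]; ring
  have hu : ∀ y : Submonoid.powers f, IsUnit (φ y) := by
    rintro ⟨_, l, rfl⟩
    simp only [map_pow, hφf]
    exact IsLocalization.Away.algebraMap_pow_isUnit g l
  let Ψ : Localization.Away f →ₐ[k] Localization.Away g := IsLocalization.liftAlgHom hu
  have hΨ : ∀ p, Ψ (algebraMap _ _ p) = φ p := fun p => IsLocalization.lift_eq _ p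
  have hZ1 : IsFracOfDegree g (j + 2) 1 Z := by
    have h : IsFracOfDegree g (j + 2) (j + 2 : ℕ)
        (algebraMap (MvPolynomial σ k) _ (X x) ^ (j + 1) * Z) := by
      rw [← hZ, ← hφ q hq]
      refine IsFracOfDegree.sub hg (.of_algebraMap hg) ?_
      rw [algHom_eq_of_mem_supported (φ := φ) (ψ := aeval fun i => if i = z then 0 else
        fracEval x z j g (F (X i))) (fun i (hi : i ≠ z) => by simp [φ, hi]) hq]
      refine IsFracOfDegree.aeval (by omega) hg (fun i => ?_) (isWeightedHomogeneous_one_int hqd)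
      split_ifs with h
      · exact .zero (by omega)
      · exact isFracOfDegree_fracEval hg (hF.weight i h)
    have := IsFracOfDegree.of_X_pow_mul (by omega) hg0 hg x _ h
    convert this using 1
    push_cast; ring
  have hinv : Ψ (IsLocalization.Away.invSelf f) = IsLocalization.Away.invSelf g := by
    have h1 := congrArg Ψ (IsLocalization.Away.mul_invSelf (S := Localization.Away f) f)
    rw [map_mul, hΨ, hφf, map_one] at h1
    have h2 := IsLocalization.Away.mul_invSelf (S := Localization.Away g) g
    exact (IsLocalization.Away.algebraMap_isUnit g).mul_left_cancel (h1.trans h2.symm)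
  refine ⟨Ψ, fun p => ?_, by rw [hΨ, hφf], ?_⟩
  · have : (Ψ.comp (fracEval x z j f)) = (fracEval x z j g).comp F := by
      ext i
      rw [AlgHom.comp_apply, AlgHom.comp_apply]
      by_cases hi : i = z
      · rw [hi, fracEval_X_self, hF.map_z, fracEval_X_self, map_mul, map_pow, hΨ, hφx, hinv]
      · rw [fracEval_X_of_ne hi, hΨ, hφX i hi]
    exact DFunLike.congr_fun this p
  · rintro e u ⟨i, r, a, ha, hr, hua⟩
    apply IsFracOfDegree.of_mul_pow i
    have h1 := congrArg Ψ hua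
    rw [map_mul, map_pow, hΨ, hΨ, hφf] at h1
    rw [h1]
    push_cast at hr ⊢
    rw [← hr]
    refine IsFracOfDegree.aeval (by omega) hg (fun i => ?_) (isWeightedHomogeneous_one_int ha)
    split_ifs with h
    · exact hZ1
    · exact isFracOfDegree_fracEval hg (hF.weight i h)

theorem exists_algEquiv_away {G : MvPolynomial σ k →ₐ[k] MvPolynomial σ k}
    (hF : IsTransfer x z j q g F) (hG : IsTransfer x z j q' f G)
    (hFG : ∀ i, F (G (X i)) = X i) (hGF : ∀ i, G (F (X i)) = X i) (hxz : x ≠ z)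
    (hq : q ∈ supported k {i | i ≠ z}) (hqd : q.IsHomogeneous (j + 2))
    (hq' : q' ∈ supported k {i | i ≠ z}) (hqd' : q'.IsHomogeneous (j + 2))
    (hf : f = X x ^ (j + 1) * X z + q) (hg : g = X x ^ (j + 1) * X z + q')
    (hfd : f.IsHomogeneous (j + 2)) (hgd : g.IsHomogeneous (j + 2)) (hf0 : f ≠ 0) (hg0 : g ≠ 0) :
    ∃ Ψ : Localization.Away f ≃ₐ[k] Localization.Away g,
      ∀ u, IsFracOfDegree f (j + 2) 0 u ↔ IsFracOfDegree g (j + 2) 0 (Ψ u) := by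
  obtain ⟨Ψ, h1, h2, h3⟩ := hF.exists_algHom hxz hq hqd hf hgd hg0
  obtain ⟨Φ, h1', h2', h3'⟩ := hG.exists_algHom hxz hq' hqd' hg hfd hf0
  have aux : ∀ {f g q : MvPolynomial σ k} {F G : MvPolynomial σ k →ₐ[k] MvPolynomial σ k}
      {Ψ : Localization.Away f →ₐ[k] Localization.Away g}
      {Φ : Localization.Away g →ₐ[k] Localization.Away f}, f ≠ 0 →
      f = X x ^ (j + 1) * X z + q → q ∈ supported k {i | i ≠ z} →
      (∀ p, Ψ (fracEval x z j f p) = fracEval x z j g (F p)) →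
      (∀ p, Φ (fracEval x z j g p) = fracEval x z j f (G p)) →
      Ψ (algebraMap _ _ f) = algebraMap _ _ g → Φ (algebraMap _ _ g) = algebraMap _ _ f →
      (∀ i, G (F (X i)) = X i) → Φ.comp Ψ = AlgHom.id k _ := by
    intro f g q F G Ψ Φ hf0 hf hq h1 h1' h2 h2' hGF
    have hX : ∀ i, i ≠ z → Φ (Ψ (algebraMap (MvPolynomial σ k) _ (X i))) = algebraMap (MvPolynomial σ k) _ (X i) := by
      intro i hi
      rw [← fracEval_X_of_ne (x := x) (j := j) hi, h1, h1', hGF]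
    have hqq : Φ (Ψ (algebraMap _ _ q)) = algebraMap _ _ q :=
      algHom_eq_of_mem_supported (φ := (Φ.comp Ψ).comp (IsScalarTower.toAlgHom k _ _))
        (ψ := IsScalarTower.toAlgHom k (MvPolynomial σ k) _) hX hq
    have hff : Φ (Ψ (algebraMap _ _ f)) = algebraMap _ _ f := by rw [h2, h2']
    have hle := powers_le_nonZeroDivisors_of_noZeroDivisors hf0
    have := IsLocalization.isDomain_of_le_nonZeroDivisors (Localization.Away f) hle
    have hz : Φ (Ψ (algebraMap (MvPolynomial σ k) _ (X z))) = algebraMap (MvPolynomial σ k) _ (X z) := by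
      have h := hff
      simp only [hf, map_add, map_mul, map_pow, hqq, hX x hxz, add_left_inj] at h
      refine mul_left_cancel₀ (pow_ne_zero _ ?_) h
      rw [Ne, IsLocalization.to_map_eq_zero_iff _ hle]
      exact X_ne_zero x
    apply IsLocalization.algHom_ext (Submonoid.powers f)
    ext i
    by_cases hi : i = z
    · subst hi; exact hz
    · exact hX i hi
  have hΦΨ := aux hf0 hf hq h1 h1' h2 h2' hGF
  have hΨΦ := aux hg0 hg hq' h1' h1 h2' h2 hFG
  refine ⟨AlgEquiv.ofAlgHom Ψ Φ hΨΦ hΦΨ, fun u => ⟨h3 0 u, fun h => ?_⟩⟩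
  have := h3' 0 _ h
  rwa [show Φ (AlgEquiv.ofAlgHom Ψ Φ hΨΦ hΦΨ u) = u from DFunLike.congr_fun hΦΨ u] at this

end ComplementIsomorphism

section ComplementScheme

variable {k : Type} [Field k] {n d : ℕ} {f g : MvPolynomial (Fin (n + 1)) k}

theorem isFracOfDegree_zero_iff (hf : f.IsHomogeneous d) (u : Localization.Away f) :
    IsFracOfDegree f d 0 u ↔
      ∃ y : HomogeneousLocalization.Away (grading k n) f, y.val = u := by
  constructor
  · rintro ⟨i, r, a, ha, hr, hu⟩
    have hr : r = i • d := by rw [smul_eq_mul, mul_comm]; zify; simpa using hr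
    subst hr
    refine ⟨HomogeneousLocalization.Away.mk (grading k n) (f := f) (d := d)
      ((mem_homogeneousSubmodule d f).2 hf) i a ((mem_homogeneousSubmodule _ a).2 ha), ?_⟩
    rw [HomogeneousLocalization.Away.val_mk, Localization.mk_eq_mk', IsLocalization.mk'_eq_iff_eq_mul,
      ← hu, map_pow]
  · rintro ⟨y, rfl⟩
    obtain ⟨i, a, ha, rfl⟩ := HomogeneousLocalization.Away.mk_surjective (grading k n) (f := f)
      (d := d) ((mem_homogeneousSubmodule d f).2 hf) y
    refine ⟨i, i • d, a, (mem_homogeneousSubmodule _ a).1 ha, by simp [mul_comm], ?_⟩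
    rw [HomogeneousLocalization.Away.val_mk, Localization.mk_eq_mk', ← map_pow]
    exact IsLocalization.mk'_spec _ a ⟨f ^ i, _⟩

theorem exists_ringEquiv_homogeneousLocalization (hf : f.IsHomogeneous d)
    (hg : g.IsHomogeneous d) (Ψ : Localization.Away f ≃ₐ[k] Localization.Away g)
    (hΨ : ∀ u, IsFracOfDegree f d 0 u ↔ IsFracOfDegree g d 0 (Ψ u)) :
    ∃ T : HomogeneousLocalization.Away (grading k n) f ≃+*
        HomogeneousLocalization.Away (grading k n) g, ∀ y, (T y).val = Ψ y.val := by
  have h1 : ∀ y : HomogeneousLocalization.Away (grading k n) f,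
      ∃ y' : HomogeneousLocalization.Away (grading k n) g, y'.val = Ψ y.val := fun y =>
    (isFracOfDegree_zero_iff hg _).1 ((hΨ _).1 ((isFracOfDegree_zero_iff hf _).2 ⟨y, rfl⟩))
  choose T hT using h1
  have hinj := HomogeneousLocalization.val_injective (𝒜 := grading k n) (Submonoid.powers g)
  let T' : HomogeneousLocalization.Away (grading k n) f →+*
        HomogeneousLocalization.Away (grading k n) g :=
    { toFun := T
      map_one' := hinj (by rw [hT]; simp [HomogeneousLocalization.val_one])
      map_zero' := hinj (by rw [hT]; simp [HomogeneousLocalization.val_zero])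
      map_mul' := fun a b => hinj (by
        simp [HomogeneousLocalization.val_mul, hT])
      map_add' := fun a b => hinj (by
        simp [HomogeneousLocalization.val_add, hT]) }
  refine ⟨RingEquiv.ofBijective T' ⟨?_, ?_⟩, hT⟩
  · intro a b hab
    apply HomogeneousLocalization.val_injective
    apply Ψ.injective
    rw [← hT, ← hT]
    exact congrArg _ hab
  · intro y
    obtain ⟨y', hy'⟩ := (isFracOfDegree_zero_iff hf (Ψ.symm y.val)).1
      ((hΨ _).2 (by rw [AlgEquiv.apply_symm_apply]; exact (isFracOfDegree_zero_iff hg _).2 ⟨y, rfl⟩))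
    exact ⟨y', hinj (by
      change (T y').val = _
      rw [hT, hy', AlgEquiv.apply_symm_apply])⟩

theorem isoOver_of_algEquiv (hd : 0 < d) (hf : f.IsHomogeneous d)
    (hg : g.IsHomogeneous d) (Ψ : Localization.Away f ≃ₐ[k] Localization.Away g)
    (hΨ : ∀ u, IsFracOfDegree f d 0 u ↔ IsFracOfDegree g d 0 (Ψ u)) :
    IsoOver (PnFStruct k n f) (PnFStruct k n g) := by
  obtain ⟨T, hT⟩ := exists_ringEquiv_homogeneousLocalization hf hg Ψ hΨ
  let e : Spec (CommRingCat.of (HomogeneousLocalization.Away (grading k n) f)) ≅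
      Spec (CommRingCat.of (HomogeneousLocalization.Away (grading k n) g)) :=
    Scheme.Spec.mapIso T.symm.toCommRingCatIso.op
  have hstr : ∀ {f : MvPolynomial (Fin (n + 1)) k} (hf : f.IsHomogeneous d),
      PnFStruct k n f = (Proj.basicOpenIsoSpec (grading k n) f hf hd).hom ≫
        Spec.map (CommRingCat.ofHom ((HomogeneousLocalization.fromZeroRingHom (grading k n)
          (Submonoid.powers f)).comp (algebraMap k (grading k n 0)))) := by
    intro f hf
    have := Proj.awayι_toSpecZero (grading k n) f hf hd
    rw [CommRingCat.ofHom_comp, Spec.map_comp, ← this]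
    simp [Proj.awayι, PnFStruct, projStruct]
  refine ⟨Proj.basicOpenIsoSpec (grading k n) f hf hd ≪≫ e ≪≫
    (Proj.basicOpenIsoSpec (grading k n) g hg hd).symm, ?_⟩
  rw [hstr hf, hstr hg]
  simp only [Iso.trans_hom, Iso.symm_hom, Category.assoc, Iso.inv_hom_id_assoc, e]
  congr 1
  change Spec.map _ ≫ _ = _
  rw [← Spec.map_comp]
  congr 1
  ext c
  have hc : T (HomogeneousLocalization.fromZeroRingHom (grading k n) (Submonoid.powers f)
      (algebraMap k (grading k n 0) c)) = HomogeneousLocalization.fromZeroRingHom (grading k n)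
      (Submonoid.powers g) (algebraMap k (grading k n 0) c) := by
    apply HomogeneousLocalization.val_injective
    rw [hT]
    have hval : ∀ f : MvPolynomial (Fin (n + 1)) k,
        (HomogeneousLocalization.fromZeroRingHom (grading k n) (Submonoid.powers f)
          (algebraMap k (grading k n 0) c)).val = algebraMap k (Localization.Away f) c :=
      fun f => rfl
    rw [hval, hval, AlgEquiv.commutes]
  change (T.symm (HomogeneousLocalization.fromZeroRingHom (grading k n) (Submonoid.powers g)
    (algebraMap k (grading k n 0) c))).val = _
  rw [← hc, RingEquiv.symm_apply_apply]
  rfl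

end ComplementScheme

section Transfer

variable {σ k : Type*} [Field k] [DecidableEq σ] {x z : σ} {j : ℕ}
  {q a f g : MvPolynomial σ k} {F G : MvPolynomial σ k →ₐ[k] MvPolynomial σ k}

theorem fracEval_mul_self (g : MvPolynomial σ k) :
    fracEval x z j g (X z) * algebraMap _ _ g = algebraMap (MvPolynomial σ k) _ (X x) ^ j := by
  rw [fracEval_X_self, mul_assoc, mul_comm (IsLocalization.Away.invSelf g),
    IsLocalization.Away.mul_invSelf, mul_one]

theorem IsTransfer.of_dvd_sub (hj : 1 ≤ j) (hq : q ∈ supported k {i | i ≠ z})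
    (ha : a ∈ supported k {i | i ≠ z}) (hFx : F (X x) = X x) (hFz : F (X z) = X z)
    (hFw : ∀ i, i ≠ z → IsWeightedHomogeneous (auxWeight z) (F (X i)) 1)
    (hF : X z ^ 2 ∣ F q - q * (1 + X z * a))
    (hg : g = X x ^ (j + 1) * X z + (q + X x ^ j * a)) : IsTransfer x z j q g F := by
  refine ⟨hFx, hFz, hFw, ?_⟩
  obtain ⟨b, hb⟩ := hF
  obtain ⟨i, rfl⟩ : ∃ i, j = i + 1 := ⟨j - 1, by omega⟩
  have h1 := congrArg (fracEval x z (i + 1) g) hb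
  simp only [map_sub, map_mul, map_add, map_one, map_pow, fracEval_of_mem_supported hq,
    fracEval_of_mem_supported ha] at h1
  have h2 := fracEval_mul_self (x := x) (z := z) (j := i + 1) g
  have h3 : fracEval x z (i + 1) g (X z) = algebraMap (MvPolynomial σ k) _ (X x) ^ (i + 1) *
    IsLocalization.Away.invSelf g := fracEval_X_self
  have h4 := congrArg (algebraMap _ (Localization.Away g)) hg
  simp only [map_mul, map_add, map_pow] at h4
  generalize fracEval x z (i + 1) g (X z) = ε at *
  generalize fracEval x z (i + 1) g (F q) = u at *
  generalize fracEval x z (i + 1) g b = B at *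
  generalize algebraMap (MvPolynomial σ k) (Localization.Away g) q = Q at *
  generalize algebraMap (MvPolynomial σ k) (Localization.Away g) a = A at *
  generalize algebraMap (MvPolynomial σ k) (Localization.Away g) (X x) = x' at *
  generalize algebraMap (MvPolynomial σ k) (Localization.Away g) (X z) = z' at *
  generalize algebraMap (MvPolynomial σ k) (Localization.Away g) g = g' at *
  generalize (IsLocalization.Away.invSelf g : Localization.Away g) = v at *
  refine ⟨z' + ε * A * z' + x' ^ i * v * A ^ 2 - x' ^ i * v ^ 2 * B, ?_⟩
  have e1 : u = Q * (1 + ε * A) + ε ^ 2 * B := by linear_combination h1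
  have e2 : ε * x' ^ (i + 1) = x' ^ (i + 2) * (x' ^ i * v) := by rw [h3]; ring
  have e3 : ε ^ 2 = x' ^ (i + 2) * (x' ^ i * v ^ 2) := by rw [h3]; ring
  rw [e1]
  linear_combination (1 + ε * A) * h4 + A ^ 2 * e2 - B * e3 - A * h2

theorem IsTransfer.of_dvd_add (hxz : x ≠ z) (hj : 1 ≤ j) (hq : q ∈ supported k {i | i ≠ z})
    (ha : a ∈ supported k {i | i ≠ z}) (hGx : G (X x) = X x) (hGz : G (X z) = X z)
    (hGw : ∀ i, i ≠ z → IsWeightedHomogeneous (auxWeight z) (G (X i)) 1)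
    (hG : X z ^ 2 ∣ G q - q * (1 - X z * a)) (hGa : X z ∣ G a - a)
    (hf : f = X x ^ (j + 1) * X z + q) : IsTransfer x z j (q + X x ^ j * a) f G := by
  refine ⟨hGx, hGz, hGw, ?_⟩
  obtain ⟨b, hb⟩ := hG
  obtain ⟨c, hc⟩ := hGa
  obtain ⟨i, rfl⟩ : ∃ i, j = i + 1 := ⟨j - 1, by omega⟩
  have h1 := congrArg (fracEval x z (i + 1) f) hb
  have h1' := congrArg (fracEval x z (i + 1) f) hc
  simp only [map_sub, map_mul, map_one, map_pow, fracEval_of_mem_supported hq,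
    fracEval_of_mem_supported ha] at h1 h1'
  have h2 := fracEval_mul_self (x := x) (z := z) (j := i + 1) f
  have h3 : fracEval x z (i + 1) f (X z) = algebraMap (MvPolynomial σ k) _ (X x) ^ (i + 1) *
    IsLocalization.Away.invSelf f := fracEval_X_self
  have h4 := congrArg (algebraMap _ (Localization.Away f)) hf
  simp only [map_mul, map_add, map_pow, hGx, fracEval_X_of_ne hxz] at h4 ⊢
  generalize fracEval x z (i + 1) f (X z) = ε at *
  generalize fracEval x z (i + 1) f (G q) = u at *
  generalize fracEval x z (i + 1) f (G a) = u' at *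
  generalize fracEval x z (i + 1) f b = B at *
  generalize fracEval x z (i + 1) f c = E at *
  generalize algebraMap (MvPolynomial σ k) (Localization.Away f) q = Q at *
  generalize algebraMap (MvPolynomial σ k) (Localization.Away f) a = A at *
  generalize algebraMap (MvPolynomial σ k) (Localization.Away f) (X x) = x' at *
  generalize algebraMap (MvPolynomial σ k) (Localization.Away f) (X z) = z' at *
  generalize algebraMap (MvPolynomial σ k) (Localization.Away f) f = g' at *
  generalize (IsLocalization.Away.invSelf f : Localization.Away f) = v at *
  refine ⟨z' - ε * A * z' - x' ^ i * v * E - x' ^ i * v ^ 2 * B, ?_⟩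
  have e1 : u = Q * (1 - ε * A) + ε ^ 2 * B := by linear_combination h1
  have e1' : u' = A + ε * E := by linear_combination h1'
  have e2 : ε * x' ^ (i + 1) = x' ^ (i + 2) * (x' ^ i * v) := by rw [h3]; ring
  have e3 : ε ^ 2 = x' ^ (i + 2) * (x' ^ i * v ^ 2) := by rw [h3]; ring
  rw [e1, e1']
  linear_combination (1 - ε * A) * h4 - E * e2 - B * e3 + A * h2

omit [DecidableEq σ] in
theorem dvd_algHom_sub (p : MvPolynomial σ k) {z : σ} (hF : ∀ i, X z ∣ F (X i) - X i) :
    X z ∣ F p - p := by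
  have : (Ideal.Quotient.mkₐ k (Ideal.span {X z})).comp F = Ideal.Quotient.mkₐ k _ := by
    ext i
    simpa [Ideal.Quotient.mk_eq_mk_iff_sub_mem, Ideal.mem_span_singleton] using hF i
  have := DFunLike.congr_fun this p
  simpa [Ideal.Quotient.mk_eq_mk_iff_sub_mem, Ideal.mem_span_singleton] using this

omit [DecidableEq σ] in
theorem dvd_inverse_sub {z : σ} (hGz : G (X z) = X z)
    (hGF : ∀ p, G (F p) = p) (hG : ∀ i, X z ∣ G (X i) - X i)
    (hF : X z ^ 2 ∣ F q - q * (1 + X z * a)) : X z ^ 2 ∣ G q - q * (1 - X z * a) := by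
  obtain ⟨b, hb⟩ := hF
  have h1 := congrArg G hb
  simp only [map_sub, map_mul, map_add, map_one, map_pow, hGF, hGz] at h1
  obtain ⟨c, hc⟩ := dvd_algHom_sub (q * a) hG
  rw [map_mul] at hc
  exact ⟨- c - G b, by linear_combination - h1 - X z * hc⟩

theorem dvd_map_mul {R T : Type*} [CommRing R] [FunLike T R R] [RingHomClass T R R] {F : T} {z p q a b : R}
    (hp : z ^ 2 ∣ F p - p * (1 + z * a)) (hq : z ^ 2 ∣ F q - q * (1 + z * b)) :
    z ^ 2 ∣ F (p * q) - p * q * (1 + z * (a + b)) := by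
  obtain ⟨u, hu⟩ := hp
  obtain ⟨v, hv⟩ := hq
  rw [map_mul, sub_eq_iff_eq_add.1 hu, sub_eq_iff_eq_add.1 hv]
  exact ⟨u * (z ^ 2 * v + q * (1 + z * b)) + p * (1 + z * a) * v + p * q * a * b, by ring⟩

theorem dvd_map_pow {R T : Type*} [CommRing R] [FunLike T R R] [RingHomClass T R R] {F : T} {z p a : R}
    (hp : z ^ 2 ∣ F p - p * (1 + z * a)) (m : ℕ) :
    z ^ 2 ∣ F (p ^ m) - p ^ m * (1 + z * (m * a)) := by
  induction m with
  | zero => simp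
  | succ m ih =>
    rw [pow_succ p, show ((m + 1 : ℕ) : R) * a = m * a + a by push_cast; ring]
    exact dvd_map_mul ih hp

end Transfer

section Automorphism

variable {σ k : Type*} [Field k] [DecidableEq σ]

theorem exists_shear (y : σ) {h : MvPolynomial σ k} (hh : h ∈ supported k {i | i ≠ y}) :
    ∃ e : MvPolynomial σ k ≃ₐ[k] MvPolynomial σ k, e (X y) = X y + h ∧ e.symm (X y) = X y - h ∧
      (∀ i, i ≠ y → e (X i) = X i) ∧ ∀ i, i ≠ y → e.symm (X i) = X i := by
  let s (h : MvPolynomial σ k) : MvPolynomial σ k →ₐ[k] MvPolynomial σ k :=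
    aeval fun i => if i = y then X y + h else X i
  have hs : ∀ h h', h ∈ supported k {i | i ≠ y} → h + h' = 0 →
      (s h').comp (s h) = AlgHom.id k _ := by
    intro h h' hh hz
    have : s h' h = h := algHom_eq_of_mem_supported (φ := s h') (ψ := AlgHom.id k _)
      (fun i (hi : i ≠ y) => by simp [s, hi]) hh
    ext i : 1
    by_cases hi : i = y
    · subst hi
      simp only [AlgHom.comp_apply, AlgHom.id_apply]
      rw [show s h (X i) = X i + h by simp [s], map_add, this, show s h' (X i) = X i + h' by simp [s]]
      linear_combination hz
    · simp [s, hi]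
  refine ⟨AlgEquiv.ofAlgHom (s h) (s (-h)) (hs _ _ (neg_mem hh) (by ring)) (hs _ _ hh (by ring)),
    ?_, ?_, ?_, ?_⟩
  · simp [s]
  · simp [s, sub_eq_add_neg]
  · intro i hi; simp [s, hi]
  · intro i hi; simp [s, hi]

theorem exists_automorphism {z y w : σ} (hzy : z ≠ y) (hzw : z ≠ w) (hyw : y ≠ w)
    {M α : MvPolynomial σ k} {μ r : ℕ} (κ : MvPolynomial σ k) (hκ : κ = 0 ∨ κ = 1)
    (hM : M ∈ supported k {i | i ≠ z ∧ i ≠ y ∧ i ≠ w}) (hMμ : M.IsHomogeneous μ) (hμr : μ + r = 3)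
    (hα : M * (X y + X w) ^ r - M * X w ^ r = X y * α) :
    ∃ F : MvPolynomial σ k ≃ₐ[k] MvPolynomial σ k,
      (∀ i, i ≠ y → i ≠ w → F (X i) = X i) ∧
      (∀ i, i ≠ z → IsWeightedHomogeneous (auxWeight z) (F (X i)) 1) ∧
      (∀ i, i ≠ z → IsWeightedHomogeneous (auxWeight z) (F.symm (X i)) 1) ∧
      (∀ i, X z ∣ F.symm (X i) - X i) ∧
      X z ^ 2 ∣ F (X y) - X y * (1 + X z * α) ∧
      X z ^ 2 ∣ F (X w) - (X w + X z * (κ * X y ^ 3 - M * (X y + X w) ^ r)) := by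
  have hX : ∀ {s : Set σ} {i : σ}, i ∈ s → (X i : MvPolynomial σ k) ∈ supported k s :=
    fun h => X_mem_supported.2 h
  have hκs : ∀ s, κ ∈ supported k s := by
    rcases hκ with rfl | rfl
    exacts [fun s => zero_mem _, fun s => one_mem _]
  have hMs : ∀ {s : Set σ}, (∀ i, i ≠ z ∧ i ≠ y ∧ i ≠ w → i ∈ s) → M ∈ supported k s :=
    fun h => supported_mono h hM
  obtain ⟨e, ey, ey', eX, eX'⟩ := exists_shear y (h := X z * (M * X w ^ r))
    (mul_mem (hX hzy) (mul_mem (hMs fun i hi => hi.2.1) (pow_mem (hX hyw.symm) _)))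
  obtain ⟨u, uw, uw', uX, uX'⟩ := exists_shear (k := k) w (h := X y) (hX hyw)
  obtain ⟨v, vw, vw', vX, vX'⟩ := exists_shear w (h := κ * X z * X y ^ 3)
    (mul_mem (mul_mem (hκs _) (hX hzw)) (pow_mem (hX hyw) _))
  have fixM : ∀ φ : MvPolynomial σ k →ₐ[k] MvPolynomial σ k,
      (∀ i, i ≠ y → i ≠ w → φ (X i) = X i) → φ M = M := fun φ h =>
    algHom_eq_of_mem_supported (ψ := AlgHom.id k _) (fun i hi => h i hi.2.1 hi.2.2) hM
  have eM : e M = M := fixM e.toAlgHom fun i h _ => eX i h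
  have eM' : e.symm M = M := fixM e.symm.toAlgHom fun i h _ => eX' i h
  have uM : u M = M := fixM u.toAlgHom fun i _ h => uX i h
  have uM' : u.symm M = M := fixM u.symm.toAlgHom fun i _ h => uX' i h
  have vM' : v.symm M = M := fixM v.symm.toAlgHom fun i _ h => vX' i h
  have fixκ : ∀ φ : MvPolynomial σ k ≃ₐ[k] MvPolynomial σ k, φ κ = κ := by
    rcases hκ with rfl | rfl
    exacts [fun φ => map_zero _, fun φ => map_one _]
  let F := (((v.trans u.symm).trans e).trans u).trans e.symm
  have hF : ∀ p, F p = e.symm (u (e (u.symm (v p)))) := fun p => rfl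
  have hG : ∀ p, F.symm p = v.symm (u (e.symm (u.symm (e p)))) := fun p => rfl
  have Fo : ∀ i, i ≠ y → i ≠ w → F (X i) = X i := fun i hy hw => by
    rw [hF, vX i hw, uX' i hw, eX i hy, uX i hw, eX' i hy]
  have Go : ∀ i, i ≠ y → i ≠ w → F.symm (X i) = X i := fun i hy hw => by
    rw [AlgEquiv.symm_apply_eq, Fo i hy hw]
  let c (p : MvPolynomial σ k) := M * p ^ r
  have Fy : F (X y) = X y - X z * c (X w) + X z * c (X y - X z * c (X w) + X w) := by
    simp only [c, hF, vX y hyw, uX' y hyw, ey, map_add, map_mul, map_pow, uX y hyw, uX z hzw, uw, uM,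
      ey', eX' z hzy, eX' w hyw.symm, eM']
    ring
  have Fw : F (X w) = X w - X z * c (X y - X z * c (X w) + X w) +
      κ * X z * (X y - X z * c (X w) + X z * c (X y - X z * c (X w) + X w)) ^ 3 := by
    simp only [c, hF, uX' y hyw, ey, map_add, map_mul, map_pow, uX y hyw, uX z hzw, uw, uM,
      ey', eX' z hzy, eX' w hyw.symm, eM', vw, uw', map_sub, fixκ, uX' z hzw, eX w hyw.symm,
      eX z hzy]
    ring
  have Gy : F.symm (X y) = X y - X z * c (X w - κ * X z * X y ^ 3 + X y) +
      X z * c (X w - κ * X z * X y ^ 3 + X z * c (X w - κ * X z * X y ^ 3 + X y)) := by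
    simp only [c, hG, vX' y hyw, uX' y hyw, ey, map_add, map_mul, map_pow, uX y hyw, uX z hzw, uw, uM,
      ey', eX' z hzy, eX' w hyw.symm, eM', vw', uw', map_sub, uX' z hzw, uM', vX' z hzw, vM']
    ring
  have Gw : F.symm (X w) = X w - κ * X z * X y ^ 3 + X z * c (X w - κ * X z * X y ^ 3 + X y) := by
    simp only [c, hG, vX' y hyw, map_add, map_mul, map_pow, uX y hyw, uX z hzw, uw, uM,
      ey', eX' w hyw.symm, vw', uw', map_sub, eX w hyw.symm, vX' z hzw, vM']
    ring
  have wX : ∀ i, i ≠ z → IsWeightedHomogeneous (auxWeight z) (X i : MvPolynomial σ k) 1 :=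
    fun i hi => by
      have := isWeightedHomogeneous_X k (auxWeight z) i
      rwa [show auxWeight z i = 1 by simp [auxWeight, hi]] at this
  have wz : IsWeightedHomogeneous (auxWeight z) (X z : MvPolynomial σ k) (-2) := by
    have := isWeightedHomogeneous_X k (auxWeight z) z
    rwa [show auxWeight z z = -2 by simp [auxWeight]] at this
  have wM : IsWeightedHomogeneous (auxWeight z) M μ := by
    intro s hs
    rw [← isWeightedHomogeneous_one_int hMμ hs, Finsupp.weight_apply, Finsupp.weight_apply]
    refine Finset.sum_congr rfl fun i hi => ?_
    have : i ≠ z := fun h => by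
      have h1 := mem_supported.1 hM ((mem_vars_iff_mem_support i).2 ⟨s, mem_support_iff.2 hs, hi⟩)
      exact h1.1 h
    simp [auxWeight, this]
  have wc : ∀ p, IsWeightedHomogeneous (auxWeight z) p 1 →
      IsWeightedHomogeneous (auxWeight z) (X z * c p) 1 := fun p hp => by
    have := wz.mul (wM.mul (hp.pow r))
    convert this using 1
    simp only [nsmul_eq_mul, mul_one]; omega
  have wκ : ∀ p, IsWeightedHomogeneous (auxWeight z) p 1 →
      IsWeightedHomogeneous (auxWeight z) (κ * X z * p ^ 3) 1 := fun p hp => by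
    rw [mul_assoc]
    rcases hκ with rfl | rfl
    · rw [zero_mul]; exact isWeightedHomogeneous_zero _ _ _
    · rw [one_mul]; exact wz.mul (hp.pow 3)
  have wadd : ∀ {p q : MvPolynomial σ k}, IsWeightedHomogeneous (auxWeight z) p 1 →
      IsWeightedHomogeneous (auxWeight z) q 1 → IsWeightedHomogeneous (auxWeight z) (p + q) 1 :=
    fun hp hq => hp.add hq
  have wsub : ∀ {p q : MvPolynomial σ k}, IsWeightedHomogeneous (auxWeight z) p 1 →
      IsWeightedHomogeneous (auxWeight z) q 1 → IsWeightedHomogeneous (auxWeight z) (p - q) 1 :=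
    fun hp hq => (weightedHomogeneousSubmodule k (auxWeight z) 1).sub_mem hp hq
  have wy := wX y hzy.symm
  have ww := wX w hzw.symm
  have wY := wsub wy (wc _ ww)
  have wW := wsub ww (wκ _ wy)
  have dc : ∀ p q, X z ∣ p - q → X z ^ 2 ∣ X z * c p - X z * c q := fun p q h => by
    rw [← mul_sub, sq]
    refine mul_dvd_mul_left _ ?_
    rw [← mul_sub]
    exact (h.trans (sub_dvd_pow_sub_pow _ _ _)).mul_left _
  have dc' := dc (X y - X z * c (X w) + X w) (X y + X w) ⟨- c (X w), by ring⟩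
  refine ⟨F, Fo, fun i hi => ?_, fun i hi => ?_, fun i => ?_, ?_, ?_⟩
  · by_cases hy : i = y
    · rw [hy, Fy]; exact wadd wY (wc _ (wadd wY ww))
    by_cases hw : i = w
    · rw [hw, Fw]; exact wadd (wsub ww (wc _ (wadd wY ww))) (wκ _ (wadd wY (wc _ (wadd wY ww))))
    rw [Fo i hy hw]; exact wX i hi
  · by_cases hy : i = y
    · rw [hy, Gy]; exact wadd (wsub wy (wc _ (wadd wW wy))) (wc _ (wadd wW (wc _ (wadd wW wy))))
    by_cases hw : i = w
    · rw [hw, Gw]; exact wadd wW (wc _ (wadd wW wy))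
    rw [Go i hy hw]; exact wX i hi
  · by_cases hy : i = y
    · rw [hy, Gy]; exact ⟨- c (X w - κ * X z * X y ^ 3 + X y) +
        c (X w - κ * X z * X y ^ 3 + X z * c (X w - κ * X z * X y ^ 3 + X y)), by ring⟩
    by_cases hw : i = w
    · rw [hw, Gw]; exact ⟨c (X w - κ * X z * X y ^ 3 + X y) - κ * X y ^ 3, by ring⟩
    rw [Go i hy hw, sub_self]; exact dvd_zero _
  · rw [Fy]
    convert dc' using 1
    linear_combination X z * hα
  · rw [Fw]
    obtain ⟨b, hb⟩ := dc'
    have h3 : X z ∣ (X y - X z * c (X w) + X z * c (X y - X z * c (X w) + X w)) ^ 3 - X y ^ 3 :=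
      Dvd.dvd.trans ⟨- c (X w) + c (X y - X z * c (X w) + X w), by ring⟩
        (sub_dvd_pow_sub_pow _ _ _)
    obtain ⟨b', hb'⟩ := h3
    exact ⟨- b + κ * b', by linear_combination - hb + κ * X z * hb'⟩

end Automorphism

section IsomorphicComplements

variable {k : Type} [Field k] {n : ℕ}

theorem isoOver_complements {x z y w l : Fin (n + 1)} (hxz : x ≠ z) (hxy : x ≠ y) (hxw : x ≠ w)
    (hzy : z ≠ y) (hzw : z ≠ w) (hyw : y ≠ w) {j : ℕ} (hj : 1 ≤ j)
    {M κ α β : MvPolynomial (Fin (n + 1)) k} {μ r : ℕ} (hκ : κ = 0 ∨ κ = 1)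
    (hM : M ∈ supported k {i | i ≠ z ∧ i ≠ y ∧ i ≠ w}) (hMμ : M.IsHomogeneous μ) (hμr : μ + r = 3)
    (hα : M * (X y + X w) ^ r - M * X w ^ r = X y * α) (hαs : α ∈ supported k {i | i ≠ z})
    (hβs : β ∈ supported k {i | i ≠ z})
    (hl : l = y ∧ β = α ∨ l = w ∧ κ * X y ^ 3 - M * (X y + X w) ^ r = X w * β)
    {f g : MvPolynomial (Fin (n + 1)) k} (hf : f = X x ^ (j + 1) * X z + X y ^ (j + 1) * X l)
    (hg : g = X x ^ (j + 1) * X z + (X y ^ (j + 1) * X l +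
      X x ^ j * (((j + 1 : ℕ) : MvPolynomial (Fin (n + 1)) k) * α + β)))
    (hfd : f.IsHomogeneous (j + 2)) (hgd : g.IsHomogeneous (j + 2)) (hf0 : f ≠ 0) (hg0 : g ≠ 0)
    (ha : (((j + 1 : ℕ) : MvPolynomial (Fin (n + 1)) k) * α + β).IsHomogeneous 2) :
    IsoOver (PnFStruct k n f) (PnFStruct k n g) := by
  set a := ((j + 1 : ℕ) : MvPolynomial (Fin (n + 1)) k) * α + β with ha_def
  obtain ⟨F, Fo, Fwt, Gwt, Gz, Fy, Fw⟩ := exists_automorphism hzy hzw hyw κ hκ hM hMμ hμr hα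
  have hlz : l ≠ z := by
    rcases hl with ⟨rfl, -⟩ | ⟨rfl, -⟩
    exacts [hzy.symm, hzw.symm]
  have has : a ∈ supported k {i | i ≠ z} :=
    add_mem (mul_mem (natCast_mem _ _) hαs) hβs
  have hxs : X x ∈ supported k {i | i ≠ z} := X_mem_supported.2 hxz
  have hqs : X y ^ (j + 1) * X l ∈ supported k {i | i ≠ z} :=
    mul_mem (pow_mem (X_mem_supported.2 hzy.symm) _) (X_mem_supported.2 hlz)
  have hq's : X y ^ (j + 1) * X l + X x ^ j * a ∈ supported k {i | i ≠ z} :=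
    add_mem hqs (mul_mem (pow_mem hxs _) has)
  have hqd : (X y ^ (j + 1) * X l : MvPolynomial (Fin (n + 1)) k).IsHomogeneous (j + 2) := by
    have := ((isHomogeneous_X k y).pow (j + 1)).mul (isHomogeneous_X k l)
    convert this using 1; ring
  have hq'd : (X y ^ (j + 1) * X l + X x ^ j * a).IsHomogeneous (j + 2) := by
    have := ((isHomogeneous_X k x).pow j).mul ha
    refine hqd.add ?_
    convert this using 1; ring
  have Gx : ∀ i, i ≠ y → i ≠ w → F.symm (X i) = X i := fun i hy hw => by
    rw [AlgEquiv.symm_apply_eq, Fo i hy hw]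
  have Fl : X z ^ 2 ∣ F (X l) - X l * (1 + X z * β) := by
    rcases hl with ⟨rfl, rfl⟩ | ⟨rfl, h⟩
    · exact Fy
    · rw [h] at Fw
      convert Fw using 1; ring
  have Fq : X z ^ 2 ∣ F (X y ^ (j + 1) * X l) - X y ^ (j + 1) * X l * (1 + X z * a) :=
    dvd_map_mul (dvd_map_pow Fy (j + 1)) Fl
  have Gq : X z ^ 2 ∣ F.symm (X y ^ (j + 1) * X l) - X y ^ (j + 1) * X l * (1 - X z * a) :=
    dvd_inverse_sub (F := F.toAlgHom) (G := F.symm.toAlgHom) (Gx z hzy hzw)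
      (fun p => F.symm_apply_apply p) Gz Fq
  have hF : IsTransfer x z j (X y ^ (j + 1) * X l) g F.toAlgHom :=
    .of_dvd_sub hj hqs has (Fo x hxy hxw) (Fo z hzy hzw) Fwt Fq hg
  have hG : IsTransfer x z j (X y ^ (j + 1) * X l + X x ^ j * a) f F.symm.toAlgHom :=
    .of_dvd_add hxz hj hqs has (Gx x hxy hxw) (Gx z hzy hzw) Gwt Gq
      (dvd_algHom_sub (F := F.symm.toAlgHom) a Gz) hf
  obtain ⟨Ψ, hΨ⟩ := exists_algEquiv_away hF hG (fun i => F.apply_symm_apply (X i))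
    (fun i => F.symm_apply_apply (X i)) hxz hqs hqd hq's hq'd hf hg hfd hgd hf0 hg0
  exact isoOver_of_algEquiv (by omega) hfd hgd Ψ hΨ

end IsomorphicComplements

section Charts

variable {k : Type} [Field k] {n : ℕ}

/-- The homogeneous prime ideal of a point of projective space. -/
def pointIdeal (p : ProjSpace k n) : Ideal (MvPolynomial (Fin (n + 1)) k) :=
  (p : ProjectiveSpectrum (grading k n)).asHomogeneousIdeal.toIdeal

instance (p : ProjSpace k n) : (pointIdeal p).IsPrime :=
  (p : ProjectiveSpectrum (grading k n)).isPrime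

theorem mem_pointIdeal_iff_notMem_basicOpen {p : ProjSpace k n}
    {a : MvPolynomial (Fin (n + 1)) k} :
    a ∈ pointIdeal p ↔ p ∉ Proj.basicOpen (grading k n) a := by
  rw [Proj.mem_basicOpen, not_not]; rfl

variable (k) in
theorem X_mem_grading (i : Fin (n + 1)) : X i ∈ grading k n 1 :=
  (mem_homogeneousSubmodule 1 _).2 (isHomogeneous_X k i)

variable (k) in
/-- The inclusion of the standard affine chart `X i ≠ 0`. -/
def chartι (i : Fin (n + 1)) :
    Spec (CommRingCat.of (HomogeneousLocalization.Away (grading k n) (X i))) ⟶ ProjSpace k n :=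
  Proj.awayι (grading k n) (X i) (X_mem_grading k i) one_pos

instance (i : Fin (n + 1)) : IsOpenImmersion (chartι k i) := by
  unfold chartι; infer_instance

/-- The element `a / X i ^ e` of the coordinate ring of a chart. -/
def chartMk (i : Fin (n + 1)) {a : MvPolynomial (Fin (n + 1)) k} {e : ℕ} (ha : a.IsHomogeneous e) :
    HomogeneousLocalization.Away (grading k n) (X i : MvPolynomial (Fin (n + 1)) k) :=
  HomogeneousLocalization.Away.mk (grading k n) (X_mem_grading k i) e a
    ((mem_homogeneousSubmodule _ a).2 (by simpa using ha))

theorem chartMk_val_mul {i : Fin (n + 1)} {a : MvPolynomial (Fin (n + 1)) k} {e : ℕ}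
    (ha : a.IsHomogeneous e) :
    (chartMk i ha).val * algebraMap (MvPolynomial (Fin (n + 1)) k) (Localization.Away (X i : MvPolynomial (Fin (n + 1)) k)) (X i) ^ e =
      algebraMap (MvPolynomial (Fin (n + 1)) k) (Localization.Away (X i : MvPolynomial (Fin (n + 1)) k)) a := by
  rw [chartMk, HomogeneousLocalization.Away.val_mk, Localization.mk_eq_mk', ← map_pow]
  exact IsLocalization.mk'_spec _ a ⟨X i ^ e, _⟩

theorem chartMk_surjective {i : Fin (n + 1)}
    (y : HomogeneousLocalization.Away (grading k n) (X i : MvPolynomial (Fin (n + 1)) k)) :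
    ∃ (e : ℕ) (a : MvPolynomial (Fin (n + 1)) k) (ha : a.IsHomogeneous e), chartMk i ha = y := by
  obtain ⟨e, a, ha, rfl⟩ := HomogeneousLocalization.Away.mk_surjective (grading k n)
    (X_mem_grading k i) y
  exact ⟨e, a, by simpa using (mem_homogeneousSubmodule _ a).1 ha, rfl⟩

theorem chart_eq_of_val_mul {i : Fin (n + 1)} {e : ℕ}
    {u v : HomogeneousLocalization.Away (grading k n) (X i : MvPolynomial (Fin (n + 1)) k)}
    (h : u.val * algebraMap (MvPolynomial (Fin (n + 1)) k) (Localization.Away (X i : MvPolynomial (Fin (n + 1)) k)) (X i) ^ e =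
      v.val * algebraMap (MvPolynomial (Fin (n + 1)) k) (Localization.Away (X i : MvPolynomial (Fin (n + 1)) k)) (X i) ^ e) : u = v :=
  HomogeneousLocalization.val_injective _
    ((IsLocalization.Away.algebraMap_pow_isUnit (S := Localization.Away (X i))
      (X i : MvPolynomial (Fin (n + 1)) k) e).mul_right_cancel (by simpa using h))

theorem chartMk_mul_X {i : Fin (n + 1)} {a : MvPolynomial (Fin (n + 1)) k} {e : ℕ}
    (ha : a.IsHomogeneous e) : chartMk i (ha.mul (isHomogeneous_X k i)) = chartMk i ha := by
  apply chart_eq_of_val_mul (e := e + 1)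
  rw [chartMk_val_mul, pow_succ, ← mul_assoc, chartMk_val_mul, map_mul]

theorem mem_pointIdeal_chartι_iff {i : Fin (n + 1)}
    (P : Spec (CommRingCat.of (HomogeneousLocalization.Away (grading k n)
      (X i : MvPolynomial (Fin (n + 1)) k)))) {a : MvPolynomial (Fin (n + 1)) k} {e : ℕ}
    (ha : a.IsHomogeneous e) : a ∈ pointIdeal (chartι k i P) ↔ chartMk i ha ∈ P.asIdeal := by
  have key : ∀ {a : MvPolynomial (Fin (n + 1)) k} {e : ℕ} (ha : a.IsHomogeneous e), 0 < e →
      (a ∈ pointIdeal (chartι k i P) ↔ chartMk i ha ∈ P.asIdeal) := by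
    intro a e ha he
    have h := Proj.awayι_preimage_basicOpen (grading k n) (X_mem_grading k i) one_pos
      ((mem_homogeneousSubmodule e a).2 ha) he
    have h' : P ∈ chartι k i ⁻¹ᵁ Proj.basicOpen (grading k n) a ↔
      P ∈ PrimeSpectrum.basicOpen (HomogeneousLocalization.Away.isLocalizationElem
        (X_mem_grading k i) ((mem_homogeneousSubmodule e a).2 ha)) := by rw [← h]; rfl
    rw [mem_pointIdeal_iff_notMem_basicOpen, ← not_iff_not, not_not]
    have : HomogeneousLocalization.Away.isLocalizationElem
        (X_mem_grading k i) ((mem_homogeneousSubmodule e a).2 ha) = chartMk i ha := by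
      simp only [HomogeneousLocalization.Away.isLocalizationElem, pow_one]; rfl
    rw [this] at h'
    exact h'
  have hX : X i ∉ pointIdeal (chartι k i P) := by
    rw [mem_pointIdeal_iff_notMem_basicOpen, not_not,
      ← Proj.opensRange_awayι (grading k n) _ (X_mem_grading k i) one_pos]
    exact ⟨P, rfl⟩
  rw [← chartMk_mul_X, ← key (ha.mul (isHomogeneous_X k i)) (Nat.succ_pos _),
    (inferInstance : (pointIdeal (chartι k i P)).IsPrime).mul_mem_iff_mem_or_mem]
  simp [hX]

theorem aeval_mul_of_isHomogeneous {σ K A : Type*} [Field K] [CommRing A] [Algebra K A]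
    {a : MvPolynomial σ K} {e : ℕ} (ha : a.IsHomogeneous e) (u : A) (v : σ → A) :
    aeval (fun j => v j * u) a = aeval v a * u ^ e := by
  rw [aeval_def, aeval_def, eval₂_eq, eval₂_eq, Finset.sum_mul]
  refine Finset.sum_congr rfl fun s hs => ?_
  simp only [mul_pow, Finset.prod_mul_distrib]
  rw [Finset.prod_pow_eq_pow_sum, mul_assoc, ← ha (mem_support_iff.1 hs)]
  simp [Finsupp.weight_apply, Finsupp.sum]

variable {f : MvPolynomial (Fin (n + 1)) k} {i : Fin (n + 1)}
  {E : Type} [CommRing E] {θ : MvPolynomial (Fin (n + 1)) k →+* E}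

/-- `θ` presents `E` as the coordinate ring of the chart `X i ≠ 0` of the hypersurface `f = 0`. -/
structure IsChart (f : MvPolynomial (Fin (n + 1)) k) (i : Fin (n + 1))
    (θ : MvPolynomial (Fin (n + 1)) k →+* E) : Prop where
  surj : Function.Surjective θ
  map_X : θ (X i) = 1
  map_f : θ f = 0
  ker_le : RingHom.ker θ ≤ Ideal.span {f, X i - 1}
  prime : Prime f
  not_dvd : ¬ f ∣ X i

theorem IsChart.dvd_of_map_eq_zero (h : IsChart f i θ) {d : ℕ} (hf : f.IsHomogeneous d)
    {a : MvPolynomial (Fin (n + 1)) k} {e : ℕ} (ha : a.IsHomogeneous e) (h0 : θ a = 0) :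
    f ∣ a := by
  have hp : (Ideal.span {f}).IsPrime := (Ideal.span_singleton_prime h.prime.ne_zero).2 h.prime
  let K := FractionRing (MvPolynomial (Fin (n + 1)) k ⧸ Ideal.span {f})
  let π : MvPolynomial (Fin (n + 1)) k →ₐ[k] K :=
    (IsScalarTower.toAlgHom k (MvPolynomial (Fin (n + 1)) k ⧸ Ideal.span {f}) K).comp
      (Ideal.Quotient.mkₐ k (Ideal.span {f}))
  have hπ : ∀ p, π p = 0 ↔ f ∣ p := fun p => by
    change algebraMap (MvPolynomial (Fin (n + 1)) k ⧸ Ideal.span {f}) K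
      (Ideal.Quotient.mk (Ideal.span {f}) p) = 0 ↔ _
    rw [IsFractionRing.to_map_eq_zero_iff, Ideal.Quotient.eq_zero_iff_mem,
      Ideal.mem_span_singleton]
  have hi : π (X i) ≠ 0 := by rw [Ne, hπ]; exact h.not_dvd
  let φ : MvPolynomial (Fin (n + 1)) k →ₐ[k] K := aeval fun j => π (X j) * (π (X i))⁻¹
  have hφ : ∀ {a : MvPolynomial (Fin (n + 1)) k} {e : ℕ}, a.IsHomogeneous e →
      φ a = π a * (π (X i))⁻¹ ^ e := fun {a e} ha => by
    rw [aeval_mul_of_isHomogeneous ha]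
    congr 1
    exact (DFunLike.congr_fun (aeval_unique π) a).symm
  have hker : RingHom.ker θ ≤ RingHom.ker (φ : _ →+* K) := by
    refine h.ker_le.trans (Ideal.span_le.2 ?_)
    rintro _ (rfl | rfl)
    · change φ _ = 0
      rw [hφ hf, (hπ _).2 dvd_rfl, zero_mul]
    · change φ _ = 0
      rw [map_sub, hφ (isHomogeneous_X k i), map_one, pow_one, mul_inv_cancel₀ hi, sub_self]
  have : φ a = 0 := hker h0
  rw [hφ ha] at this
  exact (hπ a).1 ((mul_eq_zero.1 this).resolve_right (pow_ne_zero _ (inv_ne_zero hi)))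

/-- The map from the coordinate ring of a chart of projective space. -/
theorem IsChart.exists_ringHom (h : IsChart f i θ) :
    ∃ ρ : HomogeneousLocalization.Away (grading k n) (X i : MvPolynomial (Fin (n + 1)) k) →+* E,
      Function.Surjective ρ ∧
      ∀ {a : MvPolynomial (Fin (n + 1)) k} {e : ℕ} (ha : a.IsHomogeneous e),
        ρ (chartMk i ha) = θ a := by
  let ρ' : Localization.Away (X i : MvPolynomial (Fin (n + 1)) k) →+* E :=
    IsLocalization.Away.lift (g := θ) (X i) (by rw [h.map_X]; exact isUnit_one)
  let ρ := ρ'.comp (algebraMap (HomogeneousLocalization.Away (grading k n)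
    (X i : MvPolynomial (Fin (n + 1)) k)) (Localization.Away (X i)))
  have hρ : ∀ {a : MvPolynomial (Fin (n + 1)) k} {e : ℕ} (ha : a.IsHomogeneous e),
      ρ (chartMk i ha) = θ a := by
    intro a e ha
    have := congrArg ρ' (chartMk_val_mul (i := i) ha)
    change ρ' (chartMk i ha).val = θ a
    simpa [ρ', map_mul, map_pow, IsLocalization.Away.lift_eq, h.map_X] using this
  refine ⟨ρ, fun y => ?_, hρ⟩
  obtain ⟨p, rfl⟩ := h.surj y
  refine ⟨∑ e ∈ Finset.range (p.totalDegree + 1), chartMk i (homogeneousComponent_isHomogeneous e p), ?_⟩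
  rw [map_sum]
  simp only [hρ]
  rw [← map_sum, sum_homogeneousComponent]

theorem IsChart.isDomain (h : IsChart f i θ) {d : ℕ} (hf : f.IsHomogeneous d) : IsDomain E := by
  obtain ⟨ρ, hρs, hρ⟩ := h.exists_ringHom
  have hnt : Nontrivial E := by
    refine ⟨⟨1, 0, fun h1 => h.not_dvd ?_⟩⟩
    rw [← h.map_X] at h1
    exact h.dvd_of_map_eq_zero hf (isHomogeneous_X k i) h1
  have : NoZeroDivisors E := by
    refine ⟨fun {u v} huv => ?_⟩
    obtain ⟨u, rfl⟩ := hρs u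
    obtain ⟨v, rfl⟩ := hρs v
    obtain ⟨e, a, ha, rfl⟩ := chartMk_surjective u
    obtain ⟨e', b, hb, rfl⟩ := chartMk_surjective v
    rw [hρ, hρ, ← map_mul] at huv
    rw [hρ, hρ]
    have aux : ∀ a, f ∣ a → θ a = 0 := by
      rintro _ ⟨c, rfl⟩; rw [map_mul, h.map_f, zero_mul]
    exact (h.prime.dvd_or_dvd (h.dvd_of_map_eq_zero hf (ha.mul hb) huv)).imp (aux _) (aux _)
  exact NoZeroDivisors.to_isDomain E

theorem IsChart.exists_isOpenImmersion (h : IsChart f i θ) {d : ℕ} (hf : f.IsHomogeneous d)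
    {H : Scheme} {ι : H ⟶ ProjSpace k n} (hH : IsHypersurface f H ι) :
    ∃ κ : Spec (CommRingCat.of E) ⟶ H, IsOpenImmersion κ ∧
      (∀ (Q : Spec (CommRingCat.of E)) {a : MvPolynomial (Fin (n + 1)) k} {e : ℕ},
        a.IsHomogeneous e → (a ∈ pointIdeal (ι (κ Q)) ↔ θ a ∈ Q.asIdeal)) ∧
      ∀ p : H, X i ∉ pointIdeal (ι p) → ∃ Q, κ Q = p := by
  have hdom := h.isDomain hf
  obtain ⟨ρ, hρs, hρ⟩ := h.exists_ringHom
  have := hH.isClosedImmersion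
  have := hH.reduced
  obtain ⟨I, e, he⟩ := IsClosedImmersion.Spec_iff.1
    (inferInstance : IsClosedImmersion (Limits.pullback.snd ι (chartι k i)))
  have hred : IsReduced (Limits.pullback ι (chartι k i)) :=
    isReduced_of_isOpenImmersion (Limits.pullback.fst ι (chartι k i))
  have hmem : ∀ P : Spec (CommRingCat.of (HomogeneousLocalization.Away (grading k n)
      (X i : MvPolynomial (Fin (n + 1)) k))), I ≤ P.asIdeal ↔ f ∈ pointIdeal (chartι k i P) := by
    intro P
    have h1 : P ∈ Set.range (Limits.pullback.snd ι (chartι k i)) ↔ I ≤ P.asIdeal := by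
      have h2 := range_comap_of_surjective _ (Ideal.Quotient.mk I)
        Ideal.Quotient.mk_surjective
      rw [Ideal.mk_ker] at h2
      have h3 : I ≤ P.asIdeal ↔ P ∈ Set.range (PrimeSpectrum.comap (Ideal.Quotient.mk I)) := by
        rw [h2]; exact Iff.rfl
      rw [h3]
      constructor
      · rintro ⟨q, rfl⟩
        exact ⟨e.hom q, by rw [he]; rfl⟩
      · rintro ⟨q, hq⟩
        have h4 : ∀ q', Limits.pullback.snd ι (chartι k i) (e.inv q') =
            Spec.map (CommRingCat.ofHom (Ideal.Quotient.mk I)) q' := fun q' => by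
          rw [he, ← Scheme.Hom.comp_apply, e.inv_hom_id_assoc]
        exact ⟨e.inv q, (h4 q).trans hq⟩
    rw [← h1, Scheme.Pullback.range_snd]
    change chartι k i P ∈ Set.range ι.base ↔ _
    rw [hH.range_eq]
    exact Iff.rfl
  have hI : I.IsRadical := by
    have h1 : IsReduced (Spec (CommRingCat.of (HomogeneousLocalization.Away (grading k n)
        (X i : MvPolynomial (Fin (n + 1)) k) ⧸ I))) := isReduced_of_isOpenImmersion e.inv
    exact (Ideal.isRadical_iff_quotient_reduced I).2 ((affine_isReduced_iff _).1 h1)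
  have hIρ : I = RingHom.ker ρ := by
    apply le_antisymm
    · have := RingHom.ker_isPrime ρ
      refine (hmem ⟨RingHom.ker ρ, this⟩).2 ((mem_pointIdeal_chartι_iff ⟨RingHom.ker ρ, this⟩ hf).2 ?_)
      change ρ _ = 0
      rw [hρ, h.map_f]
    · intro u hu
      rw [← hI.radical, Ideal.radical_eq_sInf, Ideal.mem_sInf]
      rintro J ⟨hIJ, hJ⟩
      obtain ⟨l, a, ha, rfl⟩ := chartMk_surjective u
      have hfa : f ∣ a := h.dvd_of_map_eq_zero hf ha (by rw [← hρ ha]; exact hu)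
      have h1 := (hmem ⟨J, hJ⟩).1 hIJ
      exact (mem_pointIdeal_chartι_iff ⟨J, hJ⟩ ha).1 (Ideal.mem_of_dvd _ hfa h1)
  let ρ' : (HomogeneousLocalization.Away (grading k n)
      (X i : MvPolynomial (Fin (n + 1)) k)) ⧸ I →+* E :=
    Ideal.Quotient.lift I ρ fun u hu => by rwa [hIρ] at hu
  have hbij : Function.Bijective ρ' := by
    refine ⟨(injective_iff_map_eq_zero _).2 fun u hu => ?_, fun y => ?_⟩
    · obtain ⟨u, rfl⟩ := Ideal.Quotient.mk_surjective u
      rw [Ideal.Quotient.eq_zero_iff_mem, hIρ]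
      exact hu
    · obtain ⟨u, rfl⟩ := hρs y
      exact ⟨Ideal.Quotient.mk I u, rfl⟩
  have hiso : IsIso (CommRingCat.ofHom ρ') := by
    exact (RingEquiv.ofBijective ρ' hbij).toCommRingCatIso.isIso_hom
  let κ : Spec (CommRingCat.of E) ⟶ H :=
    Spec.map (CommRingCat.ofHom ρ') ≫ e.inv ≫ Limits.pullback.fst ι (chartι k i)
  have hκ : κ ≫ ι = Spec.map (CommRingCat.ofHom ρ) ≫ chartι k i := by
    simp only [κ, Category.assoc, Limits.pullback.condition]
    rw [he, Category.assoc, e.inv_hom_id_assoc, ← Category.assoc, ← Spec.map_comp, ← CommRingCat.ofHom_comp]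
    rfl
  refine ⟨κ, inferInstance, fun Q a l ha => ?_, fun p hp => ?_⟩
  · rw [← Scheme.Hom.comp_apply, hκ, Scheme.Hom.comp_apply, mem_pointIdeal_chartι_iff _ ha]
    change ρ (chartMk i ha) ∈ Q.asIdeal ↔ θ a ∈ Q.asIdeal
    rw [hρ]
  · have hp' : p ∈ Set.range (Limits.pullback.fst ι (chartι k i)) := by
      rw [Scheme.Pullback.range_fst]
      rw [mem_pointIdeal_iff_notMem_basicOpen, not_not,
        ← Proj.opensRange_awayι (grading k n) _ (X_mem_grading k i) one_pos] at hp
      exact hp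
    obtain ⟨q, rfl⟩ := hp'
    refine ⟨inv (Spec.map (CommRingCat.ofHom ρ')) (e.hom q), ?_⟩
    simp only [κ, ← Scheme.Hom.comp_apply]
    simp

end Charts

section HypersurfaceCharts

variable {σ : Type*} {k : Type} [Field k]

/-- An algebra endomorphism fixing the variables modulo an ideal is the identity modulo it. -/
theorem algHom_sub_mem {J : Ideal (MvPolynomial σ k)}
    (φ : MvPolynomial σ k →ₐ[k] MvPolynomial σ k) (h : ∀ i, φ (X i) - X i ∈ J)
    (p : MvPolynomial σ k) : φ p - p ∈ J := by
  have : (Ideal.Quotient.mkₐ k J).comp φ = Ideal.Quotient.mkₐ k J :=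
    MvPolynomial.algHom_ext fun i => by
      simpa [Ideal.Quotient.mk_eq_mk_iff_sub_mem] using h i
  exact (Ideal.Quotient.mk_eq_mk_iff_sub_mem _ _).1 (DFunLike.congr_fun this p)

theorem irreducible_pow_mul_X_add {x z : σ} (hxz : x ≠ z) (j : ℕ) {q : MvPolynomial σ k}
    (hq : q ∈ supported k {i | i ≠ z}) (hxq : ¬ X x ∣ q) :
    Irreducible (X x ^ (j + 1) * X z + q) := by
  classical
  have hvars : ∀ {p : MvPolynomial σ k}, p ∈ supported k {i | i ≠ z} → z ∉ p.vars :=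
    fun hp hz => (mem_supported.1 hp hz) rfl
  refine irreducible_mul_X_add _ _ z (pow_ne_zero _ (X_ne_zero x)) (hvars ?_) (hvars hq) ?_
  · exact pow_mem (X_mem_supported.2 hxz) _
  · exact ((MvPolynomial.X_prime (i := x)).irreducible.isRelPrime_iff_not_dvd.2 hxq).pow_left

theorem aeval_congr_of_mem_supported {A : Type*} [CommRing A] [Algebra k A] {s : Set σ}
    {v v' : σ → A} (h : ∀ i ∈ s, v i = v' i) {p : MvPolynomial σ k} (hp : p ∈ supported k s) :
    aeval v p = aeval v' p :=
  algHom_eq_of_mem_supported (by simpa using h) hp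

variable {n : ℕ}

theorem isChart_mk {f : MvPolynomial (Fin (n + 1)) k} (hf : Prime f) {d : ℕ}
    (hd : f.IsHomogeneous d) (h2 : 2 ≤ d) (i : Fin (n + 1)) :
    IsChart f i (Ideal.Quotient.mk (Ideal.span {f, X i - 1})) where
  surj := Ideal.Quotient.mk_surjective
  map_X := by
    rw [← map_one (Ideal.Quotient.mk (Ideal.span {f, X i - 1})),
      Ideal.Quotient.mk_eq_mk_iff_sub_mem]
    exact Ideal.subset_span (by simp)
  map_f := Ideal.Quotient.eq_zero_iff_mem.2 (Ideal.subset_span (by simp))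
  ker_le := by rw [Ideal.mk_ker]
  prime := hf
  not_dvd h := by
    have := totalDegree_le_of_dvd_of_isDomain h (X_ne_zero i)
    rw [hd.totalDegree hf.ne_zero, totalDegree_X] at this
    omega

/-- The coordinates on the chart `X x ≠ 0` of the hypersurface `X x ^ (j + 1) * X z + q = 0`. -/
def graphMap (x z : Fin (n + 1)) (q : MvPolynomial (Fin (n + 1)) k) :
    MvPolynomial (Fin (n + 1)) k →ₐ[k] MvPolynomial {i : Fin (n + 1) // i ≠ x ∧ i ≠ z} k :=
  aeval fun i => if h : i ≠ x ∧ i ≠ z then X ⟨i, h⟩ else if i = x then 1 else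
    - aeval (fun i => if h : i ≠ x ∧ i ≠ z then X ⟨i, h⟩ else 1) q

theorem isChart_graphMap {x z : Fin (n + 1)} (hxz : x ≠ z) {j : ℕ}
    {f q : MvPolynomial (Fin (n + 1)) k} (hf : f = X x ^ (j + 1) * X z + q) (hfp : Prime f)
    {d : ℕ} (hd : f.IsHomogeneous d) (h2 : 2 ≤ d) (hq : q ∈ supported k {i | i ≠ z}) :
    IsChart f x (graphMap x z q : MvPolynomial (Fin (n + 1)) k →+*
      MvPolynomial {i : Fin (n + 1) // i ≠ x ∧ i ≠ z} k) := by
  have hx : graphMap x z q (X x) = 1 := by simp [graphMap]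
  have hqq : graphMap x z q q =
      aeval (fun i => if h : i ≠ x ∧ i ≠ z then X ⟨i, h⟩ else 1) q :=
    aeval_congr_of_mem_supported (fun i (hi : i ≠ z) => by
      by_cases h : i = x <;> simp [h, hi]) hq
  have hz : graphMap x z q (X z) = - graphMap x z q q := by
    rw [hqq]; simp [graphMap, hxz.symm]
  have ho : ∀ i (h : i ≠ x ∧ i ≠ z), graphMap x z q (X i) = X ⟨i, h⟩ := fun i h => by
    simp [graphMap, h]
  have hf0 : graphMap x z q f = 0 := by
    rw [hf, map_add, map_mul, map_pow, hx, hz]; ring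
  refine ⟨?_, hx, hf0, ?_, hfp, (isChart_mk hfp hd h2 x).not_dvd⟩
  · have : (graphMap x z q).comp (rename Subtype.val) = AlgHom.id k _ :=
      MvPolynomial.algHom_ext fun i => by
        rw [AlgHom.comp_apply, rename_X, ho i.1 i.2]; rfl
    exact fun p => ⟨rename Subtype.val p, DFunLike.congr_fun this p⟩
  · intro p hp
    have hp' : graphMap x z q p = 0 := hp
    let φ := (rename Subtype.val : MvPolynomial {i : Fin (n + 1) // i ≠ x ∧ i ≠ z} k →ₐ[k]
      MvPolynomial (Fin (n + 1)) k).comp (graphMap x z q)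
    have hφ : ∀ p, φ p = rename Subtype.val (graphMap x z q p) := fun p => rfl
    set J : Ideal (MvPolynomial (Fin (n + 1)) k) := Ideal.span {f, X x - 1} with hJ
    have hfJ : f ∈ J := Ideal.subset_span (by simp)
    have hxJ : X x - 1 ∈ J := Ideal.subset_span (by simp)
    have hφx : φ (X x) = 1 := by rw [hφ, hx, map_one]
    have hφo : ∀ i, i ≠ x ∧ i ≠ z → φ (X i) = X i := fun i h => by
      rw [hφ, ho i h, rename_X]
    have hφq : φ q - q ∈ J := by
      let ψ : MvPolynomial (Fin (n + 1)) k →ₐ[k] MvPolynomial (Fin (n + 1)) k :=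
        aeval fun i => if i = x then 1 else X i
      have h1 : φ q = ψ q := algHom_eq_of_mem_supported (fun i (hi : i ≠ z) => by
        by_cases h : i = x
        · subst h; simp [hφx, ψ]
        · simp [hφo i ⟨h, hi⟩, ψ, h]) hq
      rw [h1]
      refine algHom_sub_mem _ (fun i => ?_) q
      by_cases h : i = x
      · subst h; simpa [ψ] using J.neg_mem hxJ
      · simp [ψ, h]
    have key : φ p - p ∈ J := by
      refine algHom_sub_mem _ (fun i => ?_) p
      by_cases h : i = x
      · subst h; rw [hφx]; simpa using J.neg_mem hxJ
      by_cases h' : i = z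
      · subst h'
        have h1 : X x ^ (j + 1) - 1 ∈ J :=
          J.mem_of_dvd (by simpa using sub_dvd_pow_sub_pow (X x : MvPolynomial (Fin (n + 1)) k) 1 (j + 1)) hxJ
        have : φ (X i) - X i = (X x ^ (j + 1) - 1) * X i - f - (φ q - q) := by
          rw [hφ, hφ, hz, map_neg, hf]; ring
        rw [this]
        exact J.sub_mem (J.sub_mem (J.mul_mem_right _ h1) hfJ) hφq
      · simp [hφo i ⟨h, h'⟩]
    rw [hφ, hp', map_zero, zero_sub] at key
    simpa using J.neg_mem key

/-- Specialization to the generic point of the locus `X x = X y = 0`, in the chart `X z = 1`. -/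
def specialize (x y z : σ) : MvPolynomial σ k →ₐ[k] MvPolynomial σ k := by
  classical exact aeval fun i => if i = z then 1 else if i = x ∨ i = y then 0 else X i

theorem sub_specialize_mem (x y z : σ) (p : MvPolynomial σ k) :
    specialize x y z p - p ∈ Ideal.span {X x, X y, X z - 1} := by
  set J : Ideal (MvPolynomial σ k) := Ideal.span {X x, X y, X z - 1} with hJ
  have hx : X x ∈ J := Ideal.subset_span (by simp)
  have hy : X y ∈ J := Ideal.subset_span (by simp)
  have hz : X z - 1 ∈ J := Ideal.subset_span (by simp)
  refine algHom_sub_mem _ (fun i => ?_) p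
  rw [specialize, aeval_X]
  split_ifs with h1 h2
  · subst h1; simpa using J.neg_mem hz
  · rcases h2 with rfl | rfl
    · simpa using hx
    · simpa using hy
  · simp

theorem mem_of_specialize_eq_zero {x y z : σ} (hzx : z ≠ x) (hzy : z ≠ y) {p : MvPolynomial σ k}
    {e : ℕ} (hp : p.IsHomogeneous e) (h : specialize x y z p = 0) : p ∈ Ideal.span {X x, X y} := by
  classical
  let K := FractionRing (MvPolynomial σ k)
  let ι := IsScalarTower.toAlgHom k (MvPolynomial σ k) K
  have hι : Function.Injective ι := IsFractionRing.injective (MvPolynomial σ k) K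
  have hz : ι (X z) ≠ 0 := (map_ne_zero_iff ι hι).2 (X_ne_zero z)
  let φ : MvPolynomial σ k →ₐ[k] K := aeval fun i => ι (X i) * (ι (X z))⁻¹
  let ζ : MvPolynomial σ k →ₐ[k] MvPolynomial σ k := aeval fun i => if i = x ∨ i = y then 0 else X i
  have h1 : φ.comp (specialize x y z) = aeval fun i => ι (ζ (X i)) * (ι (X z))⁻¹ := by
    refine MvPolynomial.algHom_ext fun i => ?_
    by_cases hi : i = z
    · subst hi; simp [specialize, ζ, hzx, hzy, mul_inv_cancel₀ hz]
    · by_cases h2 : i = x ∨ i = y <;> simp [specialize, ζ, φ, hi, h2]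
  have h2 : ι (ζ p) * (ι (X z))⁻¹ ^ e = 0 := by
    have h3 := DFunLike.congr_fun h1 p
    rw [AlgHom.comp_apply, h, map_zero, aeval_mul_of_isHomogeneous hp] at h3
    rw [h3]
    congr 1
    exact DFunLike.congr_fun (aeval_unique (ι.comp ζ)) p
  have h3 : ζ p = 0 := by
    apply hι
    rw [map_zero]
    exact (mul_eq_zero.1 h2).resolve_right (pow_ne_zero _ (inv_ne_zero hz))
  have h4 := algHom_sub_mem (J := Ideal.span {X x, X y}) ζ (fun i => by
    rw [aeval_X]
    split_ifs with h2
    · rcases h2 with rfl | rfl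
      · simpa using Ideal.subset_span (by simp)
      · simpa using Ideal.subset_span (by simp)
    · simp) p
  rw [h3, zero_sub] at h4
  simpa using Ideal.neg_mem_iff _ |>.1 h4

end HypersurfaceCharts

section PowerReduction

open IsLocalRing

/-- The power `j + 1` of the maximal ideal has a reduction by a principal ideal. -/
def HasPowerReduction (j : ℕ) (R : Type*) [CommRing R] [IsLocalRing R] : Prop :=
  ∃ u ∈ maximalIdeal R, maximalIdeal R ^ (j + 1) ≤ Ideal.span {u} * maximalIdeal R ^ j

variable {R S : Type*} [CommRing R] [CommRing S] [IsLocalRing R] [IsLocalRing S]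

theorem HasPowerReduction.of_ringEquiv {j : ℕ} (e : R ≃+* S) (h : HasPowerReduction j R) :
    HasPowerReduction j S := by
  obtain ⟨u, hu, h⟩ := h
  have hm : (maximalIdeal R).map e = maximalIdeal S := by
    ext a
    rw [← Ideal.comap_symm, Ideal.mem_comap,
      mem_maximalIdeal, mem_maximalIdeal, mem_nonunits_iff, mem_nonunits_iff]
    exact not_congr (MulEquiv.isUnit_map e.symm)
  refine ⟨e u, hm ▸ Ideal.mem_map_of_mem e hu, ?_⟩
  have := Ideal.map_mono (f := e) h
  rwa [Ideal.map_pow, Ideal.map_mul, Ideal.map_pow, hm, Ideal.map_span, Set.image_singleton] at this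

theorem hasPowerReduction_of_span_singleton {u : R} (h : maximalIdeal R = Ideal.span {u}) (j : ℕ) :
    HasPowerReduction j R :=
  ⟨u, h ▸ Ideal.mem_span_singleton_self u, by rw [← h, pow_succ']⟩

theorem hasPowerReduction_of_span_pair {x y : R} (h : maximalIdeal R = Ideal.span {x, y}) {j : ℕ}
    (hx : x ^ (j + 1) ∈ Ideal.span {y} * maximalIdeal R ^ j) : HasPowerReduction j R := by
  have hxm : x ∈ maximalIdeal R := h ▸ Ideal.subset_span (by simp)
  have hym : y ∈ maximalIdeal R := h ▸ Ideal.subset_span (by simp)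
  refine ⟨y, hym, ?_⟩
  have key : ∀ i, maximalIdeal R ^ (i + 1) ≤
      Ideal.span {x ^ (i + 1)} ⊔ Ideal.span {y} * maximalIdeal R ^ i := by
    intro i
    induction i with
    | zero => rw [zero_add, pow_one, pow_one, pow_zero, mul_one, h, Ideal.span_insert]
    | succ i ih =>
      rw [pow_succ]
      refine (Ideal.mul_mono_left ih).trans ?_
      rw [Ideal.sup_mul, mul_assoc, ← pow_succ]
      refine sup_le ?_ le_sup_right
      conv_lhs => rw [h, Ideal.span_insert, Ideal.mul_sup, Ideal.span_singleton_mul_span_singleton,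
        ← pow_succ]
      refine sup_le_sup le_rfl ?_
      rw [mul_comm]
      exact Ideal.mul_mono_right
        ((Ideal.span_singleton_le_iff_mem _).2 (Ideal.pow_mem_pow hxm _))
  exact (key j).trans (sup_le ((Ideal.span_singleton_le_iff_mem _).2 hx) le_rfl)

end PowerReduction

section Obstruction

open IsLocalRing

variable {K : Type*} [Field K]

/-- The truncated power series ring `K⟦X⟧ / (X ^ m)`. -/
abbrev TruncSeries (K : Type*) [Field K] (m : ℕ) :=
  PowerSeries K ⧸ Ideal.span {(PowerSeries.X : PowerSeries K) ^ m}

/-- The constants of the truncated power series ring. -/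
def truncC (K : Type*) [Field K] (m : ℕ) : K →+* TruncSeries K m :=
  (Ideal.Quotient.mk _).comp PowerSeries.C

/-- The class of the variable in the truncated power series ring. -/
def truncX (K : Type*) [Field K] (m : ℕ) : TruncSeries K m :=
  Ideal.Quotient.mk _ PowerSeries.X

theorem truncX_pow_eq_zero (m : ℕ) : truncX K m ^ m = 0 := by
  rw [truncX, ← map_pow, Ideal.Quotient.eq_zero_iff_mem]
  exact Ideal.mem_span_singleton_self _

theorem eq_zero_of_truncX_pow_smul {m : ℕ} {β : K}
    (h : (truncC K (m + 1) β * truncX K (m + 1)) ^ m = 0) (hm : m ≠ 0) :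
    β = 0 := by
  rw [truncX, truncC, RingHom.comp_apply, ← map_mul, ← map_pow, Ideal.Quotient.eq_zero_iff_mem, Ideal.mem_span_singleton,
    PowerSeries.X_pow_dvd_iff] at h
  have := h m (Nat.lt_succ_self m)
  rw [mul_pow, ← map_pow, PowerSeries.coeff_C_mul, PowerSeries.coeff_X_pow_self, mul_one] at this
  exact pow_eq_zero_iff hm |>.1 this

/-- The residue map of the truncated power series ring. -/
def truncRes (K : Type*) [Field K] (m : ℕ) : TruncSeries K (m + 1) →+* K :=
  Ideal.Quotient.lift _ PowerSeries.constantCoeff fun a ha => by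
    obtain ⟨b, rfl⟩ := Ideal.mem_span_singleton.1 ha
    simp

theorem mem_span_truncX {m : ℕ} {a : TruncSeries K (m + 1)} (h : truncRes K m a = 0) :
    a ∈ Ideal.span {truncX K (m + 1)} := by
  obtain ⟨a, rfl⟩ := Ideal.Quotient.mk_surjective a
  obtain ⟨b, rfl⟩ := PowerSeries.X_dvd_iff.2 h
  rw [map_mul]
  exact Ideal.mul_mem_right _ _ (Ideal.mem_span_singleton_self _)

theorem isUnit_of_truncRes_ne_zero {m : ℕ} {a : TruncSeries K (m + 1)} (h : truncRes K m a ≠ 0) :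
    IsUnit a := by
  obtain ⟨a, rfl⟩ := Ideal.Quotient.mk_surjective a
  exact (PowerSeries.isUnit_iff_constantCoeff.2 (isUnit_iff_ne_zero.2 h)).map _

theorem not_hasPowerReduction {R : Type*} [CommRing R] [IsLocalRing R] {x y : R} {j : ℕ}
    (hm : maximalIdeal R = Ideal.span {x, y}) (ψ : R →+* K)
    (hσ : ∀ β γ : K, ∃ σ : R →+* TruncSeries K (j + 2), (truncRes K (j + 1)).comp σ = ψ ∧
      σ x = truncC K (j + 2) β * truncX K (j + 2) ∧
      σ y = truncC K (j + 2) γ * truncX K (j + 2)) :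
    ¬ HasPowerReduction j R := by
  rintro ⟨u, hu, h⟩
  have hu' := hu
  rw [hm, Ideal.mem_span_pair] at hu'
  obtain ⟨a, b, rfl⟩ := hu'
  obtain ⟨β, γ, hβγ, hne⟩ : ∃ β γ : K, ψ a * β + ψ b * γ = 0 ∧ ¬ (β = 0 ∧ γ = 0) := by
    by_cases hab : ψ a = 0 ∧ ψ b = 0
    · exact ⟨1, 0, by simp [hab], by simp⟩
    · exact ⟨- ψ b, ψ a, by ring, fun h => hab ⟨h.2, by simpa using h.1⟩⟩
  obtain ⟨σ, hψ, hx, hy⟩ := hσ β γ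
  set τ := truncX K (j + 2)
  have hmap : (maximalIdeal R).map σ ≤ Ideal.span {τ} := by
    rw [hm, Ideal.map_le_iff_le_comap, Ideal.span_le]
    rintro _ (rfl | rfl)
    · exact Ideal.mem_comap.2 (hx ▸ Ideal.mul_mem_left _ _ (Ideal.mem_span_singleton_self τ))
    · exact Ideal.mem_comap.2 (hy ▸ Ideal.mul_mem_left _ _ (Ideal.mem_span_singleton_self τ))
  have hσu : σ (a * x + b * y) ∈ Ideal.span {τ ^ 2} := by
    have h1 : σ a * truncC K (j + 2) β +
        σ b * truncC K (j + 2) γ ∈ Ideal.span {τ} := by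
      apply mem_span_truncX
      have h2 : ∀ c, truncRes K (j + 1) (σ c) = ψ c := fun c => DFunLike.congr_fun hψ c
      have h3 : ∀ c, truncRes K (j + 1) (truncC K (j + 2) c) = c := fun c =>
        PowerSeries.constantCoeff_C c
      rw [map_add, map_mul, map_mul, h2, h2, h3, h3, hβγ]
    have h4 : σ (a * x + b * y) = (σ a * truncC K (j + 2) β +
        σ b * truncC K (j + 2) γ) * τ := by
      rw [map_add, map_mul, map_mul, hx, hy]; ring
    rw [h4, pow_two, ← Ideal.span_singleton_mul_span_singleton]
    exact Ideal.mul_mem_mul h1 (Ideal.mem_span_singleton_self τ)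
  have hzero : ∀ c ∈ maximalIdeal R, σ c ^ (j + 1) = 0 := by
    intro c hc
    have h1 := Ideal.mem_map_of_mem σ (h (Ideal.pow_mem_pow hc (j + 1)))
    rw [Ideal.map_mul, Ideal.map_pow, Ideal.map_span, Set.image_singleton] at h1
    have h2 := Ideal.mul_mono ((Ideal.span_singleton_le_iff_mem _).2 hσu)
      (Ideal.pow_right_mono hmap j) h1
    rw [Ideal.span_singleton_pow, Ideal.span_singleton_mul_span_singleton, ← pow_add, add_comm 2 j,
      truncX_pow_eq_zero, Ideal.span_singleton_eq_bot.2 rfl] at h2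
    rw [← map_pow]
    exact h2
  have hxm : x ∈ maximalIdeal R := hm ▸ Ideal.subset_span (by simp)
  have hym : y ∈ maximalIdeal R := hm ▸ Ideal.subset_span (by simp)
  exact hne ⟨eq_zero_of_truncX_pow_smul (hx ▸ hzero x hxm) (Nat.succ_ne_zero j),
    eq_zero_of_truncX_pow_smul (hy ▸ hzero y hym) (Nat.succ_ne_zero j)⟩

end Obstruction

section SpecialPoints

open IsLocalRing

variable {k : Type} [Field k] {σ : Type}

theorem mem_of_mul_add_mul_eq_zero {R : Type*} [CommRing R] {s t y c : R} {J : Ideal R}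
    (hs : IsUnit s) (hc : c ∈ J) (h : t * s + y * c = 0) : t ∈ Ideal.span {y} * J := by
  rw [← (Ideal.span {y} * J).mul_unit_mem_iff_mem hs, eq_neg_of_add_eq_zero_left h, neg_mem_iff]
  exact Ideal.mul_mem_mul (Ideal.mem_span_singleton_self y) hc

/-- The coordinate ring of the chart `X z = 1` of the hypersurface `f = 0`. -/
abbrev ChartRing (f : MvPolynomial σ k) (z : σ) : Type :=
  MvPolynomial σ k ⧸ Ideal.span {f, X z - 1}

theorem specialize_X (x y z : σ) (hxz : x ≠ z) (hyz : y ≠ z) :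
    specialize x y z (X x : MvPolynomial σ k) = 0 ∧ specialize x y z (X y : MvPolynomial σ k) = 0 ∧
    specialize x y z (X z : MvPolynomial σ k) = 1 := by
  simp [specialize, hxz, hyz]

theorem specialize_X_of_ne {x y z i : σ} (hx : i ≠ x) (hy : i ≠ y) (hz : i ≠ z) :
    specialize x y z (X i : MvPolynomial σ k) = X i := by
  simp [specialize, hx, hy, hz]

/-- The specialization map on a coordinate ring. -/
def specializeHom {f : MvPolynomial σ k} {x y z : σ} (h : specialize x y z f = 0) :
    ChartRing f z →+* MvPolynomial σ k :=
  Ideal.Quotient.lift _ (specialize (k := k) x y z : MvPolynomial σ k →+* MvPolynomial σ k) fun a ha => by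
    have : Ideal.span {f, X z - 1} ≤
        RingHom.ker (specialize (k := k) x y z : MvPolynomial σ k →+* MvPolynomial σ k) := by
      rw [Ideal.span_le]
      rintro _ (rfl | rfl)
      · exact h
      · change specialize x y z (X z - 1) = 0
        simp [specialize]
    exact this ha

/-- The generic point of the locus `X x = X y = 0`. -/
def specialIdeal {f : MvPolynomial σ k} {x y z : σ} (h : specialize x y z f = 0) :
    Ideal (ChartRing f z) := RingHom.ker (specializeHom h)

variable {f : MvPolynomial σ k} {x y z : σ} (h : specialize x y z f = 0)

instance : (specialIdeal h).IsPrime := RingHom.ker_isPrime _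

theorem mk_mem_specialIdeal_iff {p : MvPolynomial σ k} :
    Ideal.Quotient.mk _ p ∈ specialIdeal h ↔ specialize x y z p = 0 := Iff.rfl

theorem mk_X_eq_one (f : MvPolynomial σ k) (z : σ) :
    (Ideal.Quotient.mk (Ideal.span {f, X z - 1}) (X z)) = 1 := by
  rw [← map_one (Ideal.Quotient.mk (Ideal.span {f, X z - 1})),
    Ideal.Quotient.mk_eq_mk_iff_sub_mem]
  exact Ideal.subset_span (by simp)

theorem mk_self_eq_zero (f : MvPolynomial σ k) (z : σ) :
    (Ideal.Quotient.mk (Ideal.span {f, X z - 1}) f) = 0 :=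
  Ideal.Quotient.eq_zero_iff_mem.2 (Ideal.subset_span (by simp))

theorem specialIdeal_eq_span (hxz : x ≠ z) (hyz : y ≠ z) :
    specialIdeal h = Ideal.span {Ideal.Quotient.mk _ (X x), Ideal.Quotient.mk _ (X y)} := by
  obtain ⟨hx, hy, -⟩ := specialize_X (k := k) x y z hxz hyz
  apply le_antisymm
  · intro p hp
    obtain ⟨p, rfl⟩ := Ideal.Quotient.mk_surjective p
    have h1 := sub_specialize_mem x y z p
    rw [(mk_mem_specialIdeal_iff h).1 hp, zero_sub, neg_mem_iff] at h1
    have h2 := Ideal.mem_map_of_mem (Ideal.Quotient.mk (Ideal.span {f, X z - 1})) h1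
    refine Ideal.span_le.2 ?_ (by rwa [Ideal.map_span] at h2)
    rintro _ ⟨_, (rfl | rfl | rfl), rfl⟩
    · exact Ideal.subset_span (by simp)
    · exact Ideal.subset_span (by simp)
    · rw [map_sub, mk_X_eq_one, map_one, sub_self]
      exact Ideal.zero_mem _
  · rw [Ideal.span_le]
    rintro _ (rfl | rfl)
    · exact hx
    · exact hy

theorem maximalIdeal_specialIdeal (hxz : x ≠ z) (hyz : y ≠ z) :
    maximalIdeal (Localization.AtPrime (specialIdeal h)) =
      Ideal.span {algebraMap (ChartRing f z) _ (Ideal.Quotient.mk _ (X x)),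
        algebraMap (ChartRing f z) _ (Ideal.Quotient.mk _ (X y))} := by
  rw [← Localization.AtPrime.map_eq_maximalIdeal]
  conv_lhs => arg 2; rw [specialIdeal_eq_span h hxz hyz]
  rw [Ideal.map_span, Set.image_pair]

theorem isUnit_of_specialize_ne_zero {p : MvPolynomial σ k} (hp : specialize x y z p ≠ 0) :
    IsUnit (algebraMap (ChartRing f z) (Localization.AtPrime (specialIdeal h))
      (Ideal.Quotient.mk _ p)) :=
  IsLocalization.map_units _ (⟨Ideal.Quotient.mk _ p, hp⟩ : (specialIdeal h).primeCompl)

theorem hasPowerReduction_specialIdeal (hxz : x ≠ z) (hyz : y ≠ z) {l : σ} {j : ℕ}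
    {a : MvPolynomial σ k} (ha : specialize x y z a ≠ 0)
    (hf : f = X x ^ (j + 2) * X z + (X y ^ (j + 2) * X l + X x ^ (j + 1) * a)) :
    HasPowerReduction j (Localization.AtPrime (specialIdeal h)) := by
  have hm := maximalIdeal_specialIdeal h hxz hyz
  obtain ⟨hx, hy, hz⟩ := specialize_X (k := k) x y z hxz hyz
  have hu := isUnit_of_specialize_ne_zero h (p := X x + a) (by rwa [map_add, hx, zero_add])
  have hrel := congrArg (algebraMap (ChartRing f z) (Localization.AtPrime (specialIdeal h)))
    (mk_self_eq_zero f z)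
  set θ := (algebraMap (ChartRing f z) (Localization.AtPrime (specialIdeal h))).comp
    (Ideal.Quotient.mk (Ideal.span {f, X z - 1})) with hθ
  have hθ' : ∀ p, algebraMap (ChartRing f z) (Localization.AtPrime (specialIdeal h))
    (Ideal.Quotient.mk (Ideal.span {f, X z - 1}) p) = θ p := fun _ => rfl
  have hθz : θ (X z) = 1 := by rw [← hθ', mk_X_eq_one, map_one]
  simp only [hθ'] at hm hu hrel
  have hym : θ (X y) ∈ maximalIdeal (Localization.AtPrime (specialIdeal h)) :=
    hm ▸ Ideal.subset_span (by simp)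
  have hrel' : θ f = θ (X x) ^ (j + 1) * θ (X x + a) + θ (X y) * (θ (X y) ^ j * (θ (X y) * θ (X l))) := by
    refine (congrArg θ hf).trans ?_
    simp only [map_add, map_mul, map_pow, hθz]
    ring
  rw [map_zero, hrel'] at hrel
  exact hasPowerReduction_of_span_pair hm (mem_of_mul_add_mul_eq_zero hu
    (Ideal.mul_mem_right _ _ (Ideal.pow_mem_pow hym j)) hrel)

theorem hasPowerReduction_specialIdeal_of_graph {w : σ} (h : specialize x w z f = 0)
    (hxz : x ≠ z) (hwz : w ≠ z) (hyx : y ≠ x) (hyw : y ≠ w) (hyz : y ≠ z) {j : ℕ}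
    {a : MvPolynomial σ k}
    (hf : f = X x ^ (j + 2) * X z + (X y ^ (j + 2) * X w + X x ^ (j + 1) * a)) (m : ℕ) :
    HasPowerReduction m (Localization.AtPrime (specialIdeal h)) := by
  have hm := maximalIdeal_specialIdeal h hxz hwz
  have hu := isUnit_of_specialize_ne_zero h (p := X y)
    (by rw [specialize_X_of_ne hyx hyw hyz]; exact X_ne_zero y)
  have hrel := congrArg (algebraMap (ChartRing f z) (Localization.AtPrime (specialIdeal h)))
    (mk_self_eq_zero f z)
  set θ := (algebraMap (ChartRing f z) (Localization.AtPrime (specialIdeal h))).comp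
    (Ideal.Quotient.mk (Ideal.span {f, X z - 1})) with hθ
  have hθ' : ∀ p, algebraMap (ChartRing f z) (Localization.AtPrime (specialIdeal h))
    (Ideal.Quotient.mk (Ideal.span {f, X z - 1}) p) = θ p := fun _ => rfl
  simp only [hθ'] at hm hu hrel
  have hrel' : θ f = θ (X w) * θ (X y) ^ (j + 2) +
      θ (X x) * (θ (X x) ^ j * (θ (X x) * θ (X z) + θ a)) := by
    refine (congrArg θ hf).trans ?_
    simp only [map_add, map_mul, map_pow]
    ring
  rw [map_zero, hrel'] at hrel
  have hw : θ (X w) ∈ Ideal.span {θ (X x)} := by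
    simpa using mem_of_mul_add_mul_eq_zero (R := Localization.AtPrime (specialIdeal h)) (J := ⊤)
      (hu.pow (j + 2)) trivial hrel
  refine hasPowerReduction_of_span_singleton (u := θ (X x)) ?_ m
  rw [hm]
  refine le_antisymm (Ideal.span_le.2 ?_) (Ideal.span_mono (by simp))
  rintro _ (rfl | rfl)
  · exact Ideal.mem_span_singleton_self _
  · exact hw

theorem not_hasPowerReduction_specialIdeal (hxz : x ≠ z) (hyz : y ≠ z) (hxy : x ≠ y) {l : σ} {j : ℕ}
    (hf : f = X x ^ (j + 2) * X z + X y ^ (j + 2) * X l) :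
    ¬ HasPowerReduction j (Localization.AtPrime (specialIdeal h)) := by
  classical
  let K := FractionRing (MvPolynomial σ k)
  let ι : MvPolynomial σ k →+* K := algebraMap (MvPolynomial σ k) K
  have hι : Function.Injective ι := IsFractionRing.injective (MvPolynomial σ k) K
  have hunit : ∀ s : (specialIdeal h).primeCompl, ι (specializeHom h s) ≠ 0 := fun s h0 =>
    s.2 ((map_eq_zero_iff ι hι).1 h0)
  let ψ : Localization.AtPrime (specialIdeal h) →+* K :=
    IsLocalization.lift (M := (specialIdeal h).primeCompl) (g := ι.comp (specializeHom h))
      fun s => isUnit_iff_ne_zero.2 (hunit s)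
  refine not_hasPowerReduction (maximalIdeal_specialIdeal h hxz hyz) ψ fun β γ => ?_
  let σ₀ : MvPolynomial σ k →+* TruncSeries K (j + 2) :=
    eval₂Hom ((truncC K (j + 2)).comp (ι.comp C)) fun i =>
      if i = z then 1 else if i = x then truncC K (j + 2) β * truncX K (j + 2) else
        if i = y then truncC K (j + 2) γ * truncX K (j + 2) else truncC K (j + 2) (ι (X i))
  have h0x : σ₀ (X x) = truncC K (j + 2) β * truncX K (j + 2) := by simp [σ₀, hxz]
  have h0y : σ₀ (X y) = truncC K (j + 2) γ * truncX K (j + 2) := by simp [σ₀, hyz, hxy.symm]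
  have h0z : σ₀ (X z) = 1 := by simp [σ₀]
  have hresC : ∀ c, truncRes K (j + 1) (truncC K (j + 2) c) = c := fun c =>
    PowerSeries.constantCoeff_C c
  have hresX : truncRes K (j + 1) (truncX K (j + 2)) = 0 := PowerSeries.constantCoeff_X
  have hres : (truncRes K (j + 1)).comp σ₀ = ι.comp (specialize (k := k) x y z : MvPolynomial σ k →+* MvPolynomial σ k) := by
    refine MvPolynomial.ringHom_ext (fun c => ?_) fun i => ?_
    · simp [σ₀, hresC, specialize]
    · by_cases h1 : i = z
      · subst h1; simp [σ₀, specialize]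
      by_cases h2 : i = x
      · subst h2; simp [σ₀, specialize, h1, hresX]
      by_cases h3 : i = y
      · subst h3; simp [σ₀, specialize, h1, h2, hresX]
      · simp [σ₀, specialize, h1, h2, h3, hresC]
  let σ₁ : ChartRing f z →+* TruncSeries K (j + 2) :=
    Ideal.Quotient.lift _ σ₀ fun a ha => by
      have : Ideal.span {f, X z - 1} ≤ RingHom.ker σ₀ := by
        rw [Ideal.span_le]
        rintro _ (rfl | rfl)
        · change σ₀ _ = 0
          rw [hf, map_add, map_mul, map_mul, map_pow, map_pow, h0x, h0y, mul_pow, mul_pow,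
            truncX_pow_eq_zero]
          ring
        · change σ₀ _ = 0
          rw [map_sub, h0z, map_one, sub_self]
      exact this ha
  have hres₁ : ∀ e, truncRes K (j + 1) (σ₁ e) = ι (specializeHom h e) := fun e => by
    obtain ⟨p, rfl⟩ := Ideal.Quotient.mk_surjective e
    exact DFunLike.congr_fun hres p
  let σ₂ : Localization.AtPrime (specialIdeal h) →+* TruncSeries K (j + 2) :=
    IsLocalization.lift (M := (specialIdeal h).primeCompl) (g := σ₁) fun s =>
      isUnit_of_truncRes_ne_zero (by rw [hres₁]; exact hunit s)
  refine ⟨σ₂, IsLocalization.ringHom_ext (specialIdeal h).primeCompl (RingHom.ext fun e => ?_),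
    ?_, ?_⟩
  · simp only [RingHom.comp_apply, σ₂, ψ, IsLocalization.lift_eq, hres₁]
  · simp only [σ₂, IsLocalization.lift_eq]; exact h0x
  · simp only [σ₂, IsLocalization.lift_eq]; exact h0y

end SpecialPoints

section Points

open Topology

/-- A point that is never the end of a chain of two strict specializations. -/
def IsShallow {T : Type*} [TopologicalSpace T] (p : T) : Prop :=
  ∀ q₁ q₂ : T, q₁ ⤳ q₂ → q₂ ⤳ p → q₁ ≠ q₂ → q₂ = p

theorem IsShallow.of_iso {X Y : Scheme} (e : X ≅ Y) {p : X} (h : IsShallow p) :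
    IsShallow (e.hom p) := by
  have h1 : ∀ q, e.hom (e.inv q) = q := fun q => by rw [← Scheme.Hom.comp_apply]; simp
  have h2 : ∀ q, e.inv (e.hom q) = q := fun q => by rw [← Scheme.Hom.comp_apply]; simp
  intro q₁ q₂ h12 h2p hne
  have := h (e.inv q₁) (e.inv q₂) (h12.map e.inv.continuous)
    (h2 p ▸ h2p.map e.inv.continuous) (fun h => hne (by rw [← h1 q₁, h, h1]))
  rw [← this, h1]

theorem hasPowerReduction_stalk_iff_of_iso {X Y : Scheme} (e : X ≅ Y) {p : X} {j : ℕ} :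
    HasPowerReduction j (Y.presheaf.stalk (e.hom p)) → HasPowerReduction j (X.presheaf.stalk p) :=
  HasPowerReduction.of_ringEquiv (asIso (e.hom.stalkMap p)).commRingCatIsoToRingEquiv

theorem hasPowerReduction_stalk_iff {E : Type} [CommRing E] {X : Scheme}
    (κ : Spec (CommRingCat.of E) ⟶ X) [IsOpenImmersion κ] (P : Ideal E) [hP : P.IsPrime] {j : ℕ} :
    HasPowerReduction j (X.presheaf.stalk (κ (⟨P, hP⟩ : PrimeSpectrum E))) ↔
      HasPowerReduction j (Localization.AtPrime P) := by
  let Q : Spec (CommRingCat.of E) := (⟨P, hP⟩ : PrimeSpectrum E)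
  let e : X.presheaf.stalk (κ Q) ≃+* Localization.AtPrime P :=
    (asIso (κ.stalkMap Q)).commRingCatIsoToRingEquiv.trans
      (Spec.stalkIso (CommRingCat.of E) Q).commRingCatIsoToRingEquiv
  exact ⟨HasPowerReduction.of_ringEquiv e, HasPowerReduction.of_ringEquiv e.symm⟩

theorem Spec.specializes_iff {E : Type} [CommRing E] {P Q : Spec (CommRingCat.of E)} :
    P ⤳ Q ↔ P.asIdeal ≤ Q.asIdeal :=
  (PrimeSpectrum.le_iff_specializes P Q).symm

theorem ProjSpace.specializes {k : Type} [Field k] {n : ℕ} {p q : ProjSpace k n}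
    (h : ∀ (a : MvPolynomial (Fin (n + 1)) k) (e : ℕ), a.IsHomogeneous e →
      a ∈ pointIdeal p → a ∈ pointIdeal q) : p ⤳ q := by
  have hle : pointIdeal p ≤ pointIdeal q := fun a ha => by
    classical
    rw [← DirectSum.sum_support_decompose (grading k n) a]
    refine sum_mem fun e _ => h _ e ?_ ?_
    · exact (mem_homogeneousSubmodule _ _).1 (SetLike.coe_mem (DirectSum.decompose (grading k n) a e))
    · exact (ProjectiveSpectrum.asHomogeneousIdeal (𝒜 := grading k n) p).isHomogeneous e ha
  rw [specializes_iff_mem_closure]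
  exact (ProjectiveSpectrum.le_iff_mem_closure (grading k n) p q).1 hle

theorem IsShallow.of_ideal {E : Type} [CommRing E] [IsNoetherianRing E] {X : Scheme}
    (κ : Spec (CommRingCat.of E) ⟶ X) [IsOpenImmersion κ] {Q : Spec (CommRingCat.of E)}
    (y : E) (hy : Q.asIdeal ∈ (Ideal.span {y}).minimalPrimes) : IsShallow (κ Q) := by
  have hemb := κ.isOpenEmbedding
  intro q₁ q₂ h12 h2 hne
  obtain ⟨Q₂, rfl⟩ : q₂ ∈ Set.range κ := h2.mem_open hemb.isOpen_range ⟨Q, rfl⟩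
  obtain ⟨Q₁, rfl⟩ : q₁ ∈ Set.range κ := h12.mem_open hemb.isOpen_range ⟨Q₂, rfl⟩
  rw [hemb.isInducing.specializes_iff, Spec.specializes_iff] at h12 h2
  by_contra hne'
  have hlt1 : Q₁.asIdeal < Q₂.asIdeal := lt_of_le_of_ne h12 fun h => hne (by
    rw [show Q₁ = Q₂ from PrimeSpectrum.ext h])
  have hlt2 : Q₂.asIdeal < Q.asIdeal := lt_of_le_of_ne h2 fun h => hne' (by
    rw [show Q₂ = Q from PrimeSpectrum.ext h])
  have h1 : Q.asIdeal.height ≤ 1 :=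
    Ideal.height_le_one_of_isPrincipal_of_mem_minimalPrimes (Ideal.span {y}) Q.asIdeal hy
  have := Q.2
  have := Q₁.2
  have := Q₂.2
  have h3 := Ideal.height_add_one_le_of_lt_of_isPrime hlt1
  have h4 := Ideal.height_add_one_le_of_lt_of_isPrime hlt2
  have h5 : (1 : ℕ∞) + 1 ≤ 1 := ((add_le_add (le_add_self.trans h3) le_rfl).trans h4).trans h1
  exact absurd h5 (by decide)

end Points

section Comparison

variable {k : Type} [Field k] {n : ℕ} {x y z l : Fin (n + 1)} {j : ℕ}

theorem not_X_dvd (hxy : x ≠ y) (hxl : x ≠ l) (a : MvPolynomial (Fin (n + 1)) k) (m r : ℕ) :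
    ¬ X x ∣ X y ^ m * X l + X x ^ (r + 1) * a := by
  rw [dvd_add_left (Dvd.dvd.mul_right (dvd_pow_self _ (Nat.succ_ne_zero r)) a)]
  intro h
  rcases (X_prime (i := x)).dvd_or_dvd h with h | h
  · exact hxy (X_dvd_X.1 ((X_prime (i := x)).dvd_of_dvd_pow h))
  · exact hxl (X_dvd_X.1 h)

theorem exists_isShallow_not_hasPowerReduction (hxz : x ≠ z) (hyz : y ≠ z) (hxy : x ≠ y)
    {f : MvPolynomial (Fin (n + 1)) k} (hf : f = X x ^ (j + 2) * X z + X y ^ (j + 2) * X l)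
    (hfp : Prime f) {d : ℕ} (hfd : f.IsHomogeneous d) (hd : 2 ≤ d)
    {H : Scheme} {ι : H ⟶ ProjSpace k n} (hH : IsHypersurface f H ι) :
    ∃ p : H, IsShallow p ∧ ¬ HasPowerReduction j (H.presheaf.stalk p) := by
  obtain ⟨hx, hy, hz⟩ := specialize_X (k := k) x y z hxz hyz
  have h : specialize x y z f = 0 := by
    rw [hf, map_add, map_mul, map_mul, map_pow, map_pow, hx, hy]; ring
  obtain ⟨κ, hκ, -, -⟩ := (isChart_mk hfp hfd hd z).exists_isOpenImmersion hfd hH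
  refine ⟨κ (⟨specialIdeal h, inferInstance⟩ : PrimeSpectrum (ChartRing f z)),
    IsShallow.of_ideal κ (Ideal.Quotient.mk _ (X y)) ⟨⟨inferInstance, ?_⟩, ?_⟩, ?_⟩
  · change _ ≤ specialIdeal h
    rw [specialIdeal_eq_span h hxz hyz]
    exact Ideal.span_mono (by simp)
  · rintro J ⟨hJ, hyJ⟩ -
    change specialIdeal h ≤ J
    rw [Ideal.span_singleton_le_iff_mem] at hyJ
    rw [specialIdeal_eq_span h hxz hyz, Ideal.span_le]
    rintro _ (rfl | rfl)
    · refine hJ.mem_of_pow_mem (j + 2) ?_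
      have h1 := congrArg (Ideal.Quotient.mk (Ideal.span {f, X z - 1})) hf
      rw [mk_self_eq_zero, map_add, map_mul, map_mul, map_pow, map_pow, mk_X_eq_one, mul_one] at h1
      rw [eq_neg_of_add_eq_zero_left h1.symm, neg_mem_iff]
      exact J.mul_mem_right _ (J.pow_mem_of_mem hyJ _ (Nat.succ_pos _))
    · exact hyJ
  · rw [hasPowerReduction_stalk_iff]
    exact not_hasPowerReduction_specialIdeal h hxz hyz hxy hf

theorem hasPowerReduction_of_mem_pointIdeal (hxz : x ≠ z) (hyz : y ≠ z)
    {f : MvPolynomial (Fin (n + 1)) k} (hfp : Prime f) {d : ℕ} (hfd : f.IsHomogeneous d)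
    (hd : 2 ≤ d) (h : specialize x y z f = 0)
    (hred : HasPowerReduction j (Localization.AtPrime (specialIdeal h)))
    {H : Scheme} {ι : H ⟶ ProjSpace k n} (hH : IsHypersurface f H ι) {p : H} (hp : IsShallow p)
    (hxp : X x ∈ pointIdeal (ι p)) (hyp : X y ∈ pointIdeal (ι p)) :
    HasPowerReduction j (H.presheaf.stalk p) := by
  have hchart := isChart_mk hfp hfd hd z
  have := hchart.isDomain hfd
  obtain ⟨κ, hκ, hmem, -⟩ := hchart.exists_isOpenImmersion hfd hH
  have hι := hH.isClosedImmersion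
  let Q : Spec (CommRingCat.of (ChartRing f z)) :=
    (⟨specialIdeal h, inferInstance⟩ : PrimeSpectrum (ChartRing f z))
  let Q₀ : Spec (CommRingCat.of (ChartRing f z)) :=
    (⟨⊥, Ideal.isPrime_bot⟩ : PrimeSpectrum (ChartRing f z))
  have h1 : κ Q₀ ⤳ κ Q := Specializes.map (Spec.specializes_iff.2 bot_le) κ.continuous
  have h2 : κ Q ⤳ p := by
    rw [← ι.isClosedEmbedding.isInducing.specializes_iff]
    refine ProjSpace.specializes fun a e ha haQ => ?_
    refine Ideal.span_le.2 ?_ (mem_of_specialize_eq_zero hxz.symm hyz.symm ha ((hmem Q ha).1 haQ))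
    rintro _ (rfl | rfl)
    · exact hxp
    · exact hyp
  have h3 : κ Q₀ ≠ κ Q := fun h0 => by
    have h4 : Q₀ = Q := κ.isOpenEmbedding.injective h0
    have h5 : (Ideal.Quotient.mk (Ideal.span {f, X z - 1}) (X x)) ∈ Q₀.asIdeal := by
      rw [h4]; exact (specialize_X (k := k) x y z hxz hyz).1
    exact (isChart_mk hfp hfd hd x).not_dvd
      (hchart.dvd_of_map_eq_zero hfd (isHomogeneous_X k x) h5)
  rw [← hp _ _ h1 h2 h3]
  exact (hasPowerReduction_stalk_iff κ (specialIdeal h)).2 hred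

theorem hasPowerReduction_of_isShallow {w : Fin (n + 1)} (hxz : x ≠ z) (hyz : y ≠ z) (hxy : x ≠ y)
    (hxw : x ≠ w) (hyw : y ≠ w) (hwz : w ≠ z) (hl : l = y ∨ l = w)
    {f a : MvPolynomial (Fin (n + 1)) k} (has : a ∈ supported k {i | i ≠ z})
    (ha : specialize x y z a ≠ 0)
    (hf : f = X x ^ (j + 2) * X z + (X y ^ (j + 2) * X l + X x ^ (j + 1) * a))
    (hfp : Prime f) {d : ℕ} (hfd : f.IsHomogeneous d) (hd : 2 ≤ d)
    {H : Scheme} {ι : H ⟶ ProjSpace k n} (hH : IsHypersurface f H ι) {p : H} (hp : IsShallow p) :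
    HasPowerReduction j (H.presheaf.stalk p) := by
  by_cases hxp : X x ∈ pointIdeal (ι p)
  · have hfι : f ∈ pointIdeal (ι p) := by
      have : ι p ∈ zeroLocusSet k n f := hH.range_eq ▸ ⟨p, rfl⟩
      exact this
    have h1 : X y ^ (j + 2) * X l ∈ pointIdeal (ι p) := by
      have : X y ^ (j + 2) * X l =
          f - X x * (X x ^ (j + 1) * X z + X x ^ j * a) := by rw [hf]; ring
      rw [this]
      exact sub_mem hfι (Ideal.mul_mem_right _ _ hxp)
    have h2 : X y ∈ pointIdeal (ι p) ∨ l = w ∧ X w ∈ pointIdeal (ι p) := by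
      have hP : (pointIdeal (ι p)).IsPrime := inferInstance
      rcases hP.mem_or_mem h1 with h | h
      · exact Or.inl (hP.mem_of_pow_mem _ h)
      · rcases hl with rfl | rfl
        · exact Or.inl h
        · exact Or.inr ⟨rfl, h⟩
    rcases h2 with hyp | ⟨rfl, hwp⟩
    · obtain ⟨hx, hy, hz⟩ := specialize_X (k := k) x y z hxz hyz
      have h : specialize x y z f = 0 := by
        rw [hf]; simp only [map_add, map_mul, map_pow, hx, hy]; ring
      exact hasPowerReduction_of_mem_pointIdeal hxz hyz hfp hfd hd h
        (hasPowerReduction_specialIdeal h hxz hyz ha hf) hH hp hxp hyp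
    · obtain ⟨hx, hw, hz⟩ := specialize_X (k := k) x l z hxz hwz
      have h : specialize x l z f = 0 := by
        rw [hf]; simp only [map_add, map_mul, map_pow, hx, hw]; ring
      exact hasPowerReduction_of_mem_pointIdeal hxz hwz hfp hfd hd h
        (hasPowerReduction_specialIdeal_of_graph h hxz hwz hxy.symm hyw hyz hf j) hH hp hxp hwp
  · have hq : X y ^ (j + 2) * X l + X x ^ (j + 1) * a ∈ supported k {i | i ≠ z} := by
      have hlz : l ≠ z := by rcases hl with rfl | rfl <;> assumption
      exact add_mem (mul_mem (pow_mem (X_mem_supported.2 hyz) _) (X_mem_supported.2 hlz))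
        (mul_mem (pow_mem (X_mem_supported.2 hxz) _) has)
    obtain ⟨κ, hκ, -, hsurj⟩ :=
      (isChart_graphMap hxz hf hfp hfd hd hq).exists_isOpenImmersion hfd hH
    obtain ⟨Q, rfl⟩ := hsurj p hxp
    have hQ : Q.asIdeal.IsPrime := Q.2
    refine (hasPowerReduction_stalk_iff κ Q.asIdeal).2 ?_
    obtain ⟨u, hu⟩ : ∃ u, Q.asIdeal = Ideal.span {u} := by
      by_cases hb : Q.asIdeal = ⊥
      · exact ⟨0, by rw [hb]; simp⟩
      · obtain ⟨u, huQ, hup⟩ := hQ.exists_mem_prime_of_ne_bot hb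
        have hu : (Ideal.span {u}).IsPrime := (Ideal.span_singleton_prime hup.ne_zero).2 hup
        let E := MvPolynomial {i : Fin (n + 1) // i ≠ x ∧ i ≠ z} k
        let Q₁ : Spec (CommRingCat.of E) := (⟨Ideal.span {u}, hu⟩ : PrimeSpectrum E)
        let Q₀ : Spec (CommRingCat.of E) := (⟨⊥, Ideal.isPrime_bot⟩ : PrimeSpectrum E)
        have h1 : κ Q₁ = κ Q := by
          refine hp (κ Q₀) (κ Q₁) (Specializes.map (Spec.specializes_iff.2 bot_le) κ.continuous)
            (Specializes.map (Spec.specializes_iff.2 ?_) κ.continuous) fun h0 => ?_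
          · exact (Ideal.span_singleton_le_iff_mem _).2 huQ
          · have h4 : Q₀ = Q₁ := κ.isOpenEmbedding.injective h0
            have h5 : u ∈ Q₀.asIdeal := by rw [h4]; exact Ideal.mem_span_singleton_self u
            exact hup.ne_zero h5
        exact ⟨u, congrArg PrimeSpectrum.asIdeal (κ.isOpenEmbedding.injective h1).symm⟩
    refine hasPowerReduction_of_span_singleton (u := algebraMap _ _ u) ?_ j
    rw [← Localization.AtPrime.map_eq_maximalIdeal]
    conv_lhs => arg 2; rw [hu]
    rw [Ideal.map_span, Set.image_singleton]

end Comparison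

section Main

variable {k : Type} [Field k] {n : ℕ}

theorem exists_isoOver_complements_not_isoOver {x z y w l : Fin (n + 1)} (hxz : x ≠ z) (hxy : x ≠ y)
    (hxw : x ≠ w) (hzy : z ≠ y) (hzw : z ≠ w) (hyw : y ≠ w) {j : ℕ}
    {M κ α β : MvPolynomial (Fin (n + 1)) k} {μ r : ℕ} (hκ : κ = 0 ∨ κ = 1)
    (hM : M ∈ supported k {i | i ≠ z ∧ i ≠ y ∧ i ≠ w}) (hMμ : M.IsHomogeneous μ) (hμr : μ + r = 3)
    (hα : M * (X y + X w) ^ r - M * X w ^ r = X y * α) (hαs : α ∈ supported k {i | i ≠ z})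
    (hβs : β ∈ supported k {i | i ≠ z})
    (hl : l = y ∧ β = α ∨ l = w ∧ κ * X y ^ 3 - M * (X y + X w) ^ r = X w * β)
    (hαd : α.IsHomogeneous 2) (hβd : β.IsHomogeneous 2)
    (ha : specialize x y z (((j + 2 : ℕ) : MvPolynomial (Fin (n + 1)) k) * α + β) ≠ 0) :
    ∃ f g : MvPolynomial (Fin (n + 1)) k,
      Irreducible f ∧ f.IsHomogeneous (j + 3) ∧ Irreducible g ∧ g.IsHomogeneous (j + 3) ∧
      IsoOver (PnFStruct k n f) (PnFStruct k n g) ∧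
      ∀ (H H' : Scheme) (ι : H ⟶ ProjSpace k n) (ι' : H' ⟶ ProjSpace k n),
        IsHypersurface f H ι → IsHypersurface g H' ι' →
          ¬ IsoOver (ι ≫ projStruct k n) (ι' ≫ projStruct k n) := by
  have hlyw : l = y ∨ l = w := hl.imp And.left And.left
  have hlz : l ≠ z := by rcases hlyw with rfl | rfl <;> exact Ne.symm ‹_›
  have hxl : x ≠ l := by rcases hlyw with rfl | rfl <;> assumption
  set a := ((j + 2 : ℕ) : MvPolynomial (Fin (n + 1)) k) * α + β with ha_def
  have has : a ∈ supported k {i | i ≠ z} := add_mem (mul_mem (natCast_mem _ _) hαs) hβs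
  have had : a.IsHomogeneous 2 := by
    rw [ha_def, ← nsmul_eq_mul]
    exact ((homogeneousSubmodule (Fin (n + 1)) k 2).nsmul_mem hαd _).add hβd
  have hqs : X y ^ (j + 2) * X l ∈ supported k {i | i ≠ z} :=
    mul_mem (pow_mem (X_mem_supported.2 hzy.symm) _) (X_mem_supported.2 hlz)
  have hq's : X y ^ (j + 2) * X l + X x ^ (j + 1) * a ∈ supported k {i | i ≠ z} :=
    add_mem hqs (mul_mem (pow_mem (X_mem_supported.2 hxz) _) has)
  have hf : Irreducible (X x ^ (j + 2) * X z + X y ^ (j + 2) * X l : MvPolynomial (Fin (n + 1)) k) :=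
    irreducible_pow_mul_X_add hxz (j + 1) hqs (by simpa using not_X_dvd hxy hxl 0 (j + 2) j)
  have hg : Irreducible (X x ^ (j + 2) * X z + (X y ^ (j + 2) * X l + X x ^ (j + 1) * a)) :=
    irreducible_pow_mul_X_add hxz (j + 1) hq's (not_X_dvd hxy hxl a (j + 2) j)
  have hmon (s t : Fin (n + 1)) :
      (X s ^ (j + 2) * X t : MvPolynomial (Fin (n + 1)) k).IsHomogeneous (j + 3) := by
    simpa using ((isHomogeneous_X k s).pow (j + 2)).mul (isHomogeneous_X k t)
  have hfd := (hmon x z).add (hmon y l)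
  have hgd := (hmon x z).add ((hmon y l).add
    (by simpa using ((isHomogeneous_X k x).pow (j + 1)).mul had : (X x ^ (j + 1) * a).IsHomogeneous _))
  refine ⟨_, _, hf, hfd, hg, hgd, isoOver_complements hxz hxy hxw hzy hzw hyw (Nat.le_add_left 1 j)
    hκ hM hMμ hμr hα hαs hβs hl rfl rfl hfd hgd hf.ne_zero hg.ne_zero had, ?_⟩
  rintro H H' ι ι' hH hH' ⟨e, -⟩
  obtain ⟨p, hp, hp'⟩ := exists_isShallow_not_hasPowerReduction hxz hzy.symm hxy rfl hf.prime hfd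
    (by omega) hH
  exact hp' (hasPowerReduction_stalk_iff_of_iso e (hasPowerReduction_of_isShallow hxz hzy.symm hxy hxw
    hyw hzw.symm hlyw has ha rfl hg.prime hgd (by omega) hH' (hp.of_iso e)))

theorem C_mul_X_sq_ne_zero {c : k} (hc : c ≠ 0) (w : Fin (n + 1)) :
    C c * (X w ^ 2 : MvPolynomial (Fin (n + 1)) k) ≠ 0 :=
  mul_ne_zero (C_ne_zero.2 hc) (pow_ne_zero _ (X_ne_zero w))

theorem isHomogeneous_quadratic (a b c : k) (y w : Fin (n + 1)) :
    (C a * X w ^ 2 + C b * (X w * X y) + C c * X y ^ 2 :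
      MvPolynomial (Fin (n + 1)) k).IsHomogeneous 2 := by
  have hq (c : k) {p : MvPolynomial (Fin (n + 1)) k} (hp : p.IsHomogeneous 2) :
      (C c * p).IsHomogeneous 2 := by simpa using (isHomogeneous_C _ c).mul hp
  exact ((hq a ((isHomogeneous_X k w).pow 2)).add
    (hq b ((isHomogeneous_X k w).mul (isHomogeneous_X k y)))).add (hq c ((isHomogeneous_X k y).pow 2))

theorem quadratic_mem_supported {y z w : Fin (n + 1)} (hyz : y ≠ z) (hwz : w ≠ z) (a b c : k) :
    C a * X w ^ 2 + C b * (X w * X y) + C c * X y ^ 2 ∈ supported k {i | i ≠ z} := by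
  have hy : (X y : MvPolynomial (Fin (n + 1)) k) ∈ supported k {i | i ≠ z} :=
    X_mem_supported.2 hyz
  have hw : (X w : MvPolynomial (Fin (n + 1)) k) ∈ supported k {i | i ≠ z} :=
    X_mem_supported.2 hwz
  have hC (c : k) : C c ∈ supported k {i : Fin (n + 1) | i ≠ z} := Subalgebra.algebraMap_mem _ c
  exact add_mem (add_mem (mul_mem (hC a) (pow_mem hw 2)) (mul_mem (hC b) (mul_mem hw hy)))
    (mul_mem (hC c) (pow_mem hy 2))

end Main

/-- **Theorem A.** Let `k` be a field and `d, n ≥ 3` integers such that `d` is not a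
multiple of `char k` and `(d, n) ≠ (3, 3)`.  There are two non-isomorphic irreducible
hypersurfaces `H, H' ⊆ ℙⁿ_k` of degree `d` that have isomorphic complements. -/
theorem stmt0 (k : Type) [Field k] (d n : ℕ) (hd : 3 ≤ d) (hn : 3 ≤ n)
    (hchar : ¬ (ringChar k ∣ d)) (hdn : ¬ (d = 3 ∧ n = 3)) :
    ∃ f g : MvPolynomial (Fin (n + 1)) k,
      Irreducible f ∧ f.IsHomogeneous d ∧ Irreducible g ∧ g.IsHomogeneous d ∧
      IsoOver (PnFStruct k n f) (PnFStruct k n g) ∧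
      ∀ (H H' : Scheme) (ι : H ⟶ ProjSpace k n) (ι' : H' ⟶ ProjSpace k n),
        IsHypersurface f H ι → IsHypersurface g H' ι' →
          ¬ IsoOver (ι ≫ projStruct k n) (ι' ≫ projStruct k n) := by
  obtain ⟨j, rfl⟩ := Nat.exists_eq_add_of_le' hd
  have hdk : ((j + 3 : ℕ) : k) ≠ 0 := fun h => hchar (ringChar.dvd h)
  obtain ⟨x, z, y, w, hxz, hxy, hxw, hzy, hzw, hyw, ht⟩ : ∃ x z y w : Fin (n + 1),
      x ≠ z ∧ x ≠ y ∧ x ≠ w ∧ z ≠ y ∧ z ≠ w ∧ y ≠ w ∧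
        (n ≠ 3 → ∃ t, t ≠ x ∧ t ≠ z ∧ t ≠ y ∧ t ≠ w) := by
    refine ⟨⟨0, by omega⟩, ⟨1, by omega⟩, ⟨2, by omega⟩, ⟨3, by omega⟩, ?_⟩
    simp only [ne_eq, Fin.mk.injEq]
    refine ⟨by omega, by omega, by omega, by omega, by omega, by omega, fun h => ?_⟩
    exact ⟨⟨4, by omega⟩, by simp⟩
  obtain ⟨-, hsy, -⟩ := specialize_X (k := k) x y z hxz hzy.symm
  have hsw := specialize_X_of_ne (k := k) hxw.symm hyw.symm hzw.symm
  by_cases hn3 : n = 3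
  · have hα : (1 : MvPolynomial (Fin (n + 1)) k) * (X y + X w) ^ 3 - 1 * X w ^ 3 =
        X y * (C 3 * X w ^ 2 + C 3 * (X w * X y) + C 1 * X y ^ 2) := by
      simp only [map_ofNat, map_one]; ring
    by_cases h3 : (3 : k) = 0
    · refine exists_isoOver_complements_not_isoOver (l := w) (M := 1) (κ := 1)
        (β := C (-1) * X w ^ 2 + C (-3) * (X w * X y) + C (-3) * X y ^ 2) hxz hxy hxw hzy hzw hyw
        (Or.inr rfl) (one_mem _) (isHomogeneous_one _ _) (zero_add 3) hα
        (quadratic_mem_supported hzy.symm hzw.symm _ _ _)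
        (quadratic_mem_supported hzy.symm hzw.symm _ _ _) (Or.inr ⟨rfl, ?_⟩)
        (isHomogeneous_quadratic _ _ _ _ _) (isHomogeneous_quadratic _ _ _ _ _) ?_
      · simp only [map_ofNat, map_one, map_neg]; ring
      · convert C_mul_X_sq_ne_zero (neg_ne_zero.2 (one_ne_zero (α := k))) w using 1
        simp [hsy, hsw, h3]
    · refine exists_isoOver_complements_not_isoOver (l := y) (M := 1) (κ := 0) hxz hxy hxw hzy hzw hyw
        (Or.inl rfl) (one_mem _) (isHomogeneous_one _ _) (zero_add 3) hα
        (quadratic_mem_supported hzy.symm hzw.symm _ _ _)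
        (quadratic_mem_supported hzy.symm hzw.symm _ _ _) (Or.inl ⟨rfl, rfl⟩)
        (isHomogeneous_quadratic _ _ _ _ _) (isHomogeneous_quadratic _ _ _ _ _) ?_
      convert C_mul_X_sq_ne_zero (mul_ne_zero hdk h3) w using 1
      simp [hsy, hsw, map_ofNat (specialize x y z) 2, map_ofNat (specialize x y z) 3, map_ofNat C 3]
      ring
  · obtain ⟨t, htx, htz, hty, htw⟩ := ht hn3
    refine exists_isoOver_complements_not_isoOver (l := y) (M := X t ^ 2) (κ := 0) (r := 1)
      (α := X t ^ 2) (β := X t ^ 2) hxz hxy hxw hzy hzw hyw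
      (Or.inl rfl) (pow_mem (by exact X_mem_supported.2 ⟨htz, hty, htw⟩) 2) ((isHomogeneous_X k t).pow 2) rfl
      (by ring) (pow_mem (X_mem_supported.2 htz) 2) (pow_mem (X_mem_supported.2 htz) 2)
      (Or.inl ⟨rfl, rfl⟩) ((isHomogeneous_X k t).pow 2) ((isHomogeneous_X k t).pow 2) ?_
    convert C_mul_X_sq_ne_zero hdk t using 1
    simp [specialize_X_of_ne (k := k) htx hty htz, map_ofNat (specialize x y z) 2, map_ofNat C 3]
    ring

end
end

section
/- Let n ≥ 2 and let k be an algebraically closed field. If H, H' ⊆ P^n_k are irreducible quadric hypersurfaces (zero loci of irreducible homogeneous polynomials of degree 2) such that P^n_k \ H and P^n_k \ H' are isomorphic as varieties, then there exists an automorphism of P^n_k sending H onto H'. -/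
/-!
Common set-up: projective `n`-space over a field `k` as the scheme
`Proj k[x_0, …, x_n]`, complements of hypersurfaces as open subschemes,
hypersurfaces as reduced closed subschemes, and isomorphisms of varieties
over `k` as scheme isomorphisms commuting with the structure morphisms
to `Spec k`.
-/

open AlgebraicGeometry CategoryTheory MvPolynomial

attribute [local instance] MvPolynomial.gradedAlgebra

noncomputable section

theorem map_projStruct {k : Type} [Field k] {n : ℕ}
    (e : grading k n →+*ᵍ grading k n) (he : ∀ c, e (C c) = C c)
    (hirr : HomogeneousIdeal.irrelevant (grading k n) ≤
      (HomogeneousIdeal.irrelevant (grading k n)).map e) :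
    Proj.map e hirr ≫ projStruct k n = projStruct k n := by
  have key : ∀ (i : ℕ) (hi : 0 < i) (s : MvPolynomial (Fin (n + 1)) k) (hs : s ∈ grading k n i),
      Proj.awayι (grading k n) (e s) (e.2 hs) hi ≫ Proj.map e hirr ≫ projStruct k n =
      Proj.awayι (grading k n) (e s) (e.2 hs) hi ≫ projStruct k n := by
    intro i hi s hs
    have h1 := Proj.awayι_comp_map e hirr hi s hs
    rw [reassoc_of% h1, Proj.awayι_toSpecZero_assoc, Proj.awayι_toSpecZero_assoc,
      ← Spec.map_comp, ← Spec.map_comp, ← Spec.map_comp, ← CommRingCat.ofHom_comp,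
      ← CommRingCat.ofHom_comp, ← CommRingCat.ofHom_comp]
    congr 2
    refine RingHom.ext fun c ↦ HomogeneousLocalization.val_injective _ ?_
    change Localization.mk (e (C c)) ⟨e 1, _⟩ = Localization.mk (C c) 1
    simp only [he, map_one]
    rfl
  exact (Proj.mapAffineOpenCover e hirr).openCover.hom_ext _ _ fun s ↦ key _ s.1.2 _ s.2.2

theorem exists_away_equiv_of_isoOver {k : Type} [Field k] {n : ℕ}
    {f g : MvPolynomial (Fin (n + 1)) k} {d d' : ℕ} (hf : f ∈ grading k n d)
    (hg : g ∈ grading k n d') (hd : 0 < d) (hd' : 0 < d')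
    (hiso : IsoOver (PnFStruct k n f) (PnFStruct k n g)) :
    ∃ φ : HomogeneousLocalization.Away (grading k n) f ≃+*
        HomogeneousLocalization.Away (grading k n) g,
      ∀ c : k, φ (HomogeneousLocalization.fromZeroRingHom _ _ (algebraMap k (grading k n 0) c)) =
        HomogeneousLocalization.fromZeroRingHom _ _ (algebraMap k (grading k n 0) c) := by
  obtain ⟨e, he⟩ := hiso
  let E : Spec (.of (HomogeneousLocalization.Away (grading k n) g)) ≅
      Spec (.of (HomogeneousLocalization.Away (grading k n) f)) :=
    (Proj.basicOpenIsoSpec (grading k n) g hg hd').symm ≪≫ e.symm ≪≫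
      Proj.basicOpenIsoSpec (grading k n) f hf hd
  have hE : E.hom ≫ Spec.map (CommRingCat.ofHom
      ((HomogeneousLocalization.fromZeroRingHom (grading k n) (.powers f)).comp
        (algebraMap k (grading k n 0)))) = Spec.map (CommRingCat.ofHom
      ((HomogeneousLocalization.fromZeroRingHom (grading k n) (.powers g)).comp
        (algebraMap k (grading k n 0)))) := by
    rw [CommRingCat.ofHom_comp, CommRingCat.ofHom_comp, Spec.map_comp, Spec.map_comp,
      ← Proj.awayι_toSpecZero _ f hf hd, ← Proj.awayι_toSpecZero _ g hg hd',
      ← Proj.basicOpenIsoSpec_inv_ι, ← Proj.basicOpenIsoSpec_inv_ι]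
    simp only [E, Iso.trans_hom, Iso.symm_hom, Category.assoc, Iso.hom_inv_id_assoc]
    congr 1
    rw [Iso.inv_comp_eq]
    exact he.symm
  let ψ := (Scheme.Spec.preimageIso E).unop
  have hψ : Spec.map ψ.hom = E.hom := by
    have := Scheme.Spec.map_preimage E.hom
    exact this
  refine ⟨ψ.commRingCatIsoToRingEquiv, fun c ↦ ?_⟩
  rw [← hψ, ← Spec.map_comp] at hE
  have := congr($(Spec.map_injective hE).hom c)
  exact this

theorem irrelevant_le_map_of_comp_eq_id {k : Type} [Field k] {n : ℕ}
    {E E' : grading k n →+*ᵍ grading k n} (h : E.comp E' = .id _) :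
    HomogeneousIdeal.irrelevant (grading k n) ≤
      (HomogeneousIdeal.irrelevant (grading k n)).map E := by
  rw [HomogeneousIdeal.irrelevant_le]
  intro i hi x hx
  have : E (E' x) = x := congr($h x)
  rw [← this]
  exact Ideal.mem_map_of_mem E (HomogeneousIdeal.mem_irrelevant_of_mem _ hi (E'.2 hx))

theorem exists_proj_automorphism {k : Type} [Field k] {n : ℕ}
    {f g : MvPolynomial (Fin (n + 1)) k}
    (e : MvPolynomial (Fin (n + 1)) k ≃ₐ[k] MvPolynomial (Fin (n + 1)) k)
    (he : ∀ i x, x ∈ grading k n i → e x ∈ grading k n i)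
    (he' : ∀ i x, x ∈ grading k n i → e.symm x ∈ grading k n i) (hfg : e g = f) :
    ∃ φ : ProjSpace k n ≅ ProjSpace k n,
      φ.hom ≫ projStruct k n = projStruct k n ∧
      φ.hom.base '' zeroLocusSet k n f = zeroLocusSet k n g := by
  let E : grading k n →+*ᵍ grading k n := ⟨e.toRingEquiv.toRingHom, he _ _⟩
  let E' : grading k n →+*ᵍ grading k n := ⟨e.symm.toRingEquiv.toRingHom, he' _ _⟩
  have h1 : E.comp E' = .id _ := GradedRingHom.ext fun x ↦ e.apply_symm_apply x
  have h2 : E'.comp E = .id _ := GradedRingHom.ext fun x ↦ e.symm_apply_apply x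
  have hE := irrelevant_le_map_of_comp_eq_id h1
  have hE' := irrelevant_le_map_of_comp_eq_id h2
  have key : ∀ (A : grading k n →+*ᵍ grading k n) (hA : HomogeneousIdeal.irrelevant (grading k n) ≤
      (HomogeneousIdeal.irrelevant (grading k n)).map A), A = .id _ →
      Proj.map A hA = 𝟙 _ := by
    rintro A hA rfl
    exact Proj.map_id
  refine ⟨⟨Proj.map E hE, Proj.map E' hE', ?_, ?_⟩, map_projStruct E (fun c ↦ e.commutes c) hE, ?_⟩
  · rw [← Proj.map_comp, key _ _ h1]
  · rw [← Proj.map_comp, key _ _ h2]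
  · ext y
    constructor
    · rintro ⟨x, hx, rfl⟩
      have hx' : f ∈ (x : ProjectiveSpectrum (grading k n)).asHomogeneousIdeal := hx
      change e g ∈ (x : ProjectiveSpectrum (grading k n)).asHomogeneousIdeal
      rwa [hfg]
    · intro hy
      refine ⟨(Proj.map E' hE').base y, ?_, ?_⟩
      · have hy' : g ∈ (y : ProjectiveSpectrum (grading k n)).asHomogeneousIdeal := hy
        change e.symm f ∈ (y : ProjectiveSpectrum (grading k n)).asHomogeneousIdeal
        rwa [← hfg, e.symm_apply_apply]
      · have := (Proj.map_comp E E' hE hE').symm.trans (key _ _ h2)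
        exact congr($(this).base y)

theorem exists_rank_one_factorization {S ι : Type*} [CommRing S] [IsDomain S]
    [UniqueFactorizationMonoid S] [Fintype ι] (P : ι → ι → S)
    (hP : ∀ i j k l, P i j * P k l = P i k * P j l) (i₀ : ι) (h₀ : P i₀ i₀ ≠ 0) :
    ∃ (h : S) (t : ι → S), ∀ i j, P i j = h * (t i * t j) := by
  classical
  obtain ⟨_⟩ : Nonempty (NormalizedGCDMonoid S) := inferInstance
  obtain ⟨t, ht, ht1⟩ := Finset.extract_gcd (P i₀) (s := Finset.univ) ⟨i₀, Finset.mem_univ _⟩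
  set d := Finset.univ.gcd (P i₀)
  have key : ∀ j l, P i₀ i₀ * P j l = d ^ 2 * t j * t l := fun j l ↦ by
    rw [← hP i₀ j i₀ l, ht j (Finset.mem_univ _), ht l (Finset.mem_univ _)]
    ring
  have hdvd : ∀ j, P i₀ i₀ ∣ d ^ 2 * t j := fun j ↦ by
    have : P i₀ i₀ ∣ Finset.univ.gcd fun l ↦ d ^ 2 * t j * t l :=
      Finset.dvd_gcd fun l _ ↦ ⟨_, (key j l).symm⟩
    rwa [(Finset.gcd_mul_left' _ t _).dvd_iff_dvd_right, ht1, mul_one] at this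
  have hdvd' : P i₀ i₀ ∣ d ^ 2 := by
    have : P i₀ i₀ ∣ Finset.univ.gcd fun l ↦ d ^ 2 * t l := Finset.dvd_gcd fun l _ ↦ hdvd l
    rwa [(Finset.gcd_mul_left' _ t _).dvd_iff_dvd_right, ht1, mul_one] at this
  obtain ⟨h, hh⟩ := hdvd'
  refine ⟨h, t, fun j l ↦ mul_left_cancel₀ h₀ ?_⟩
  rw [key, hh]
  ring

theorem eval₂_mul_of_isHomogeneous {R S σ : Type*} [CommSemiring R] [CommSemiring S] (η : R →+* S)
    {p : MvPolynomial σ R} {d : ℕ} (hp : p.IsHomogeneous d) (r : S) (v : σ → S) :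
    eval₂ η (fun i ↦ r * v i) p = r ^ d * eval₂ η v p := by
  rw [eval₂_eq, eval₂_eq, Finset.mul_sum]
  refine Finset.sum_congr rfl fun m hm ↦ ?_
  have : ∑ i ∈ m.support, m i = d := by
    have := hp (mem_support_iff.1 hm)
    simpa [Finsupp.weight_apply, Finsupp.sum] using this
  simp_rw [mul_pow, Finset.prod_mul_distrib, Finset.prod_pow_eq_pow_sum, this]
  ring

section AwayToFrac

variable {k : Type} [Field k] {n : ℕ}

/-- The embedding of the homogeneous localization of `k[x_0, …, x_n]` away from `f` into the
fraction field. -/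
def awayToFrac {f : MvPolynomial (Fin (n + 1)) k} (hf0 : f ≠ 0) :
    HomogeneousLocalization.Away (grading k n) f →+*
      FractionRing (MvPolynomial (Fin (n + 1)) k) :=
  (IsLocalization.lift (M := Submonoid.powers f) (S := Localization.Away f)
    (g := algebraMap (MvPolynomial (Fin (n + 1)) k) (FractionRing (MvPolynomial (Fin (n + 1)) k)))
    (by
      rintro ⟨_, i, rfl⟩
      simpa using fun h ↦ absurd h hf0)).comp (algebraMap _ _)

theorem awayToFrac_mk {f : MvPolynomial (Fin (n + 1)) k} (hf0 : f ≠ 0) {m : ℕ}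
    (hf : f ∈ grading k n m) (d : ℕ) (p : MvPolynomial (Fin (n + 1)) k)
    (hp : p ∈ grading k n (d • m)) :
    awayToFrac hf0 (.mk _ hf d p hp) = algebraMap _ _ p / algebraMap _ _ f ^ d := by
  rw [awayToFrac, RingHom.comp_apply, HomogeneousLocalization.algebraMap_apply,
    HomogeneousLocalization.Away.val_mk, Localization.mk_eq_mk', IsLocalization.lift_mk'_spec,
    ← map_pow, mul_div_cancel₀]
  simpa using fun h ↦ absurd h hf0

theorem awayToFrac_algebraMap {f : MvPolynomial (Fin (n + 1)) k} (hf0 : f ≠ 0) (c : k) :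
    awayToFrac hf0 (HomogeneousLocalization.fromZeroRingHom _ _
      (algebraMap k (grading k n 0) c)) = algebraMap _ _ (C c : MvPolynomial (Fin (n + 1)) k) := by
  rw [awayToFrac, RingHom.comp_apply, HomogeneousLocalization.algebraMap_apply]
  change IsLocalization.lift _ (Localization.mk (C c) 1) = _
  rw [Localization.mk_one_eq_algebraMap, IsLocalization.lift_eq]

theorem awayToFrac_injective {f : MvPolynomial (Fin (n + 1)) k} (hf0 : f ≠ 0) :
    Function.Injective (awayToFrac hf0) := by
  rw [awayToFrac, RingHom.coe_comp]
  refine Function.Injective.comp (g := IsLocalization.lift (M := Submonoid.powers f)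
    (S := Localization.Away f) _) ?_ (HomogeneousLocalization.val_injective _)
  rw [IsLocalization.lift_injective_iff]
  intro x y
  rw [(IsFractionRing.injective (MvPolynomial (Fin (n + 1)) k)
      (FractionRing (MvPolynomial (Fin (n + 1)) k))).eq_iff,
    (IsLocalization.injective (Localization.Away f)
      (powers_le_nonZeroDivisors_of_noZeroDivisors hf0)).eq_iff]

theorem exists_mk_eq {f : MvPolynomial (Fin (n + 1)) k} {m : ℕ}
    (hf : f ∈ grading k n m) {ι : Type*} [Finite ι]
    (z : ι → HomogeneousLocalization.Away (grading k n) f) :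
    ∃ (N : ℕ) (P : ι → MvPolynomial (Fin (n + 1)) k) (hP : ∀ i, P i ∈ grading k n (N • m)),
      ∀ i, z i = .mk _ hf N (P i) (hP i) := by
  obtain ⟨N, hN⟩ := (Filter.eventually_all.2 fun i ↦
    HomogeneousLocalization.Away.eventually_smul_mem hf (z i)).exists
  choose P hP hPz using hN
  refine ⟨N, P, hP, fun i ↦ HomogeneousLocalization.val_injective _ ?_⟩
  rw [HomogeneousLocalization.Away.val_mk, Localization.mk_eq_mk', IsLocalization.eq_mk'_iff_mul_eq,
    hPz, Algebra.smul_def, mul_comm]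

end AwayToFrac

section PolynomialLift

variable {k : Type} [Field k] {n : ℕ}

theorem awayToFrac_pow_mul_mk {f : MvPolynomial (Fin (n + 1)) k} (hf0 : f ≠ 0)
    (hf : f ∈ grading k n 2) (i : Fin (n + 1))
    (a : Fin (n + 1) → HomogeneousLocalization.Away (grading k n) f)
    (ha : ∀ j, awayToFrac hf0 (a j) =
      algebraMap (MvPolynomial (Fin (n + 1)) k) _ (X i * X j) / algebraMap _ _ f)
    (d : ℕ) (p : MvPolynomial (Fin (n + 1)) k) (hp : p ∈ grading k n (d • 2)) :
    a i ^ d * .mk _ hf d p hp =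
      eval₂ ((HomogeneousLocalization.fromZeroRingHom _ _).comp (algebraMap k (grading k n 0)))
        a p := by
  refine awayToFrac_injective hf0 ?_
  have hη : (awayToFrac hf0).comp ((HomogeneousLocalization.fromZeroRingHom _ _).comp
      (algebraMap k (grading k n 0))) = (algebraMap (MvPolynomial (Fin (n + 1)) k) _).comp C :=
    RingHom.ext fun c ↦ awayToFrac_algebraMap hf0 c
  have hf0' : algebraMap _ (FractionRing (MvPolynomial (Fin (n + 1)) k)) f ≠ 0 := by
    simpa using hf0
  have hv : (fun j ↦ awayToFrac hf0 (a j)) = fun j : Fin (n + 1) ↦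
      (algebraMap (MvPolynomial (Fin (n + 1)) k) (FractionRing (MvPolynomial (Fin (n + 1)) k)) (X i) /
          algebraMap _ _ f) *
        algebraMap (MvPolynomial (Fin (n + 1)) k) _ (X j) := by
    ext j
    rw [ha, map_mul, mul_div_right_comm]
  have hX : eval₂ ((algebraMap (MvPolynomial (Fin (n + 1)) k)
      (FractionRing (MvPolynomial (Fin (n + 1)) k))).comp C)
      (fun j ↦ algebraMap (MvPolynomial (Fin (n + 1)) k) (FractionRing (MvPolynomial (Fin (n + 1)) k)) (X j)) p =
      algebraMap _ _ p := by
    conv_rhs => rw [← eval₂_eta p, hom_eval₂]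
  rw [hom_eval₂, hη, hv, eval₂_mul_of_isHomogeneous _ hp, hX, map_mul, map_pow, ha,
    awayToFrac_mk, map_mul, smul_eq_mul, mul_comm d 2, pow_mul]
  simp only [div_pow, mul_pow, ← pow_mul]
  field_simp
  ring

theorem exists_polynomial_lift [IsAlgClosed k] {f g : MvPolynomial (Fin (n + 1)) k}
    (hf0 : f ≠ 0) (hf : f ∈ grading k n 2) (hg : Irreducible g) (hgd : g ∈ grading k n 2)
    (φ : HomogeneousLocalization.Away (grading k n) f →+*
      HomogeneousLocalization.Away (grading k n) g) (hφ : Function.Injective φ)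
    (hφk : ∀ c : k, φ (HomogeneousLocalization.fromZeroRingHom _ _
      (algebraMap k (grading k n 0) c)) =
        HomogeneousLocalization.fromZeroRingHom _ _ (algebraMap k (grading k n 0) c)) :
    ∃ (s : Fin (n + 1) → MvPolynomial (Fin (n + 1)) k) (M : ℕ), aeval s f = g ^ M ∧
      ∀ (d : ℕ) (p : MvPolynomial (Fin (n + 1)) k) (hp : p ∈ grading k n (d • 2)),
        awayToFrac hg.ne_zero (φ (.mk _ hf d p hp)) =
          algebraMap _ _ (aeval s p) / algebraMap _ _ g ^ (M * d) := by
  set L := FractionRing (MvPolynomial (Fin (n + 1)) k)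
  set ι := algebraMap (MvPolynomial (Fin (n + 1)) k) L with hι
  have hιi : Function.Injective ι := IsFractionRing.injective _ _
  have hg0 : ι g ≠ 0 := by simpa [hι] using hg.ne_zero
  have hfι : ι f ≠ 0 := by simpa [hι] using hf0
  let a : Fin (n + 1) → Fin (n + 1) → HomogeneousLocalization.Away (grading k n) f := fun i j ↦
    .mk _ hf 1 (X i * X j) ((isHomogeneous_X k i).mul (isHomogeneous_X k j))
  have ha : ∀ i j, awayToFrac hf0 (a i j) = ι (X i * X j) / ι f := fun i j ↦ by
    exact (awayToFrac_mk ..).trans (by rw [pow_one])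
  obtain ⟨N, P', hP', hPa'⟩ := exists_mk_eq hgd fun x : Fin (n + 1) × Fin (n + 1) ↦ φ (a x.1 x.2)
  let P : Fin (n + 1) → Fin (n + 1) → MvPolynomial (Fin (n + 1)) k := fun i j ↦ P' (i, j)
  have hPa : ∀ i j, awayToFrac hg.ne_zero (φ (a i j)) = ι (P i j) / ι g ^ N := fun i j ↦ by
    rw [hPa' (i, j), awayToFrac_mk]
  have hPrel : ∀ i j k l, P i j * P k l = P i k * P j l := fun i j k l ↦ by
    have h1 : a i j * a k l = a i k * a j l := awayToFrac_injective hf0 (by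
      simp only [map_mul, ha]
      field_simp)
    have h2 := congr(awayToFrac hg.ne_zero (φ $h1))
    simp only [map_mul, hPa] at h2
    field_simp at h2
    exact hιi (by simpa only [map_mul] using h2)
  have ha0 : awayToFrac hg.ne_zero (φ (a 0 0)) ≠ 0 := by
    rw [map_ne_zero_iff _ (awayToFrac_injective _), map_ne_zero_iff _ hφ,
      ← map_ne_zero_iff _ (awayToFrac_injective hf0), ha]
    refine div_ne_zero ?_ hfι
    rw [map_ne_zero_iff _ hιi]
    exact mul_ne_zero (X_ne_zero _) (X_ne_zero _)
  have hP0 : P 0 0 ≠ 0 := by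
    rintro h
    rw [hPa, h, map_zero, zero_div] at ha0
    exact ha0 rfl
  obtain ⟨h, t, hht⟩ := exists_rank_one_factorization P hPrel 0 hP0
  have hh0 : ι h ≠ 0 := (map_ne_zero_iff _ hιi).2 (left_ne_zero_of_mul (hht 0 0 ▸ hP0))
  have ht0 : ι (t 0) ≠ 0 := (map_ne_zero_iff _ hιi).2
    (left_ne_zero_of_mul (right_ne_zero_of_mul (hht 0 0 ▸ hP0)))
  have hη : ((awayToFrac hg.ne_zero).comp φ).comp ((HomogeneousLocalization.fromZeroRingHom _ _).comp
      (algebraMap k (grading k n 0))) = ι.comp C := RingHom.ext fun c ↦ by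
    have := awayToFrac_algebraMap hg.ne_zero c
    rw [← hφk] at this
    exact this
  have key : ∀ (d : ℕ) (p : MvPolynomial (Fin (n + 1)) k) (hp : p ∈ grading k n (d • 2)),
      awayToFrac hg.ne_zero (φ (.mk _ hf d p hp)) = (ι h / ι g ^ N) ^ d * ι (aeval t p) := by
    intro d p hp
    have h1 := congr(awayToFrac hg.ne_zero (φ
      $(awayToFrac_pow_mul_mk hf0 hf 0 (a 0) (ha 0) d p hp)))
    have hv : (fun j ↦ ((awayToFrac hg.ne_zero).comp φ) (a 0 j)) =
        fun j ↦ (ι h * ι (t 0) / ι g ^ N) * ι (t j) := by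
      ext j
      rw [RingHom.comp_apply, hPa, hht]
      simp only [map_mul]
      ring
    have ht : eval₂ (ι.comp C) (fun j ↦ ι (t j)) p = ι (aeval t p) := by
      rw [aeval_def, hom_eval₂]
      rfl
    rw [← RingHom.comp_apply, ← RingHom.comp_apply, hom_eval₂, hη, hv,
      eval₂_mul_of_isHomogeneous _ hp, ht, map_mul, map_pow, RingHom.comp_apply, RingHom.comp_apply,
      hPa, hht, smul_eq_mul, mul_comm d 2, pow_mul] at h1
    refine mul_left_cancel₀ (pow_ne_zero d (hPa 0 0 ▸ ha0)) ?_
    rw [hht, h1, ← mul_assoc, ← mul_pow]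
    congr 2
    simp only [map_mul]
    ring
  have hhf : h * aeval t f = g ^ N := by
    have h1 := key 1 f (by simpa using hf)
    have h2 : HomogeneousLocalization.Away.mk (grading k n) hf 1 f (by simpa using hf) = 1 :=
      awayToFrac_injective hf0 (by rw [awayToFrac_mk, map_one, pow_one, div_self hfι])
    rw [h2, map_one, map_one, pow_one] at h1
    rw [div_mul_eq_mul_div, eq_div_iff (pow_ne_zero N hg0), one_mul] at h1
    exact hιi (by simpa only [map_mul, map_pow] using h1.symm)
  obtain ⟨e, heN, hu⟩ := (dvd_prime_pow hg.prime N).1 ⟨_, hhf.symm⟩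
  obtain ⟨u, hu⟩ := hu.symm
  obtain ⟨c, hc, hcu⟩ := MvPolynomial.isUnit_iff_eq_C_of_isReduced.1 u.isUnit
  obtain ⟨r, rfl⟩ := IsAlgClosed.exists_pow_nat_eq c two_pos
  rw [hcu] at hu
  have hsp : ∀ (d : ℕ) (p : MvPolynomial (Fin (n + 1)) k) (hp : p ∈ grading k n (d • 2)),
      aeval (fun i ↦ C r * t i) p = (C (r ^ 2)) ^ d * aeval t p := fun d p hp ↦ by
    rw [aeval_def, eval₂_mul_of_isHomogeneous _ hp, ← aeval_def, smul_eq_mul, mul_comm d 2,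
      pow_mul, C_pow]
  refine ⟨fun i ↦ C r * t i, N - e, ?_, fun d p hp ↦ ?_⟩
  · refine mul_left_cancel₀ (pow_ne_zero e hg.ne_zero) ?_
    rw [← pow_add, Nat.add_sub_cancel' heN, ← hhf, ← hu, hsp 1 f (by simpa using hf)]
    ring
  · rw [key, hsp d p hp, ← hu]
    obtain ⟨M, rfl⟩ := Nat.exists_eq_add_of_le heN
    simp only [map_mul, map_pow, Nat.add_sub_cancel_left]
    rw [pow_add, mul_div_mul_left _ _ (pow_ne_zero e hg0), div_pow, pow_mul]
    ring

end PolynomialLift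

section IsRetractOf

variable {R : Type*} [CommRing R] {σ τ υ : Type*}

/-- The affine scheme `{f = 1}` is a retract of the affine scheme `{g = 1}`, in terms of
polynomial maps. -/
def IsRetractOf (f : MvPolynomial σ R) (g : MvPolynomial τ R) : Prop :=
  ∃ (s : σ → MvPolynomial τ R) (s' : τ → MvPolynomial σ R),
    f - 1 ∣ aeval s' g - 1 ∧ ∀ i, f - 1 ∣ aeval s' (s i) - X i

theorem dvd_aeval_sub_aeval {S : Type*} [CommRing S] [Algebra R S] {r : S} {u v : σ → S}
    (h : ∀ i, r ∣ u i - v i) (p : MvPolynomial σ R) : r ∣ aeval u p - aeval v p := by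
  simp_rw [← Ideal.mem_span_singleton, ← Ideal.Quotient.mk_eq_mk_iff_sub_mem] at h ⊢
  have key : ∀ w : σ → S, Ideal.Quotient.mk (Ideal.span {r}) (aeval w p) =
      eval₂ ((Ideal.Quotient.mk (Ideal.span {r})).comp (algebraMap R S))
        (fun i ↦ Ideal.Quotient.mk (Ideal.span {r}) (w i)) p := fun w ↦ by
    rw [aeval_def, hom_eval₂]
  rw [key, key]
  simp_rw [h]

theorem IsRetractOf.trans {f : MvPolynomial σ R} {g : MvPolynomial τ R} {h : MvPolynomial υ R}
    (hfg : IsRetractOf f g) (hgh : IsRetractOf g h) : IsRetractOf f h := by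
  obtain ⟨s, s', hs', hs⟩ := hfg
  obtain ⟨t, t', ht', ht⟩ := hgh
  have hcomp : ∀ p : MvPolynomial υ R, aeval (fun j ↦ aeval s' (t' j)) p = aeval s' (aeval t' p) :=
    fun p ↦ (comp_aeval_apply ..).symm
  have hdvd : ∀ p, g - 1 ∣ p → f - 1 ∣ aeval s' p := fun p hp ↦
    (by simpa using hs' : f - 1 ∣ aeval s' (g - 1)).trans (map_dvd _ hp)
  refine ⟨fun i ↦ aeval t (s i), fun j ↦ aeval s' (t' j), ?_, fun i ↦ ?_⟩
  · rw [hcomp]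
    simpa using hdvd _ ht'
  · have h1 : g - 1 ∣ aeval t' (aeval t (s i)) - s i := by
      have := dvd_aeval_sub_aeval ht (s i)
      rwa [aeval_X_left_apply, ← comp_aeval_apply] at this
    rw [hcomp]
    simpa using dvd_add (hdvd _ h1) (hs i)

theorem isRetractOf_of_aeval_eq {f : MvPolynomial σ R} {g : MvPolynomial τ R}
    {s : σ → MvPolynomial τ R} {s' : τ → MvPolynomial σ R} (hg : aeval s' g = f)
    (hs : ∀ i, aeval s' (s i) = X i) : IsRetractOf f g :=
  ⟨s, s', by rw [hg], fun i ↦ by rw [hs, sub_self]; exact dvd_zero _⟩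

end IsRetractOf

theorem not_mul_sq_eq_sq {S : Type*} [CommRing S] [IsDomain S] [WfDvdMonoid S] {f a c : S}
    (hf : Prime f) (hc : c ≠ 0) : f * a ^ 2 ≠ c ^ 2 := by
  intro h
  have ha : a ≠ 0 := by
    rintro rfl
    exact pow_ne_zero 2 hc (by rw [← h]; ring)
  have h1 := congr(emultiplicity f $h)
  rw [emultiplicity_mul hf, emultiplicity_pow hf, emultiplicity_pow hf,
    (FiniteMultiplicity.of_prime_left hf hf.ne_zero).emultiplicity_self,
    (FiniteMultiplicity.of_prime_left hf ha).emultiplicity_eq_multiplicity,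
    (FiniteMultiplicity.of_prime_left hf hc).emultiplicity_eq_multiplicity] at h1
  norm_cast at h1
  omega

theorem isRetractOf_of_away_equiv {k : Type} [Field k] [IsAlgClosed k] {n : ℕ}
    {f g : MvPolynomial (Fin (n + 1)) k}
    (hf : Irreducible f) (hfd : f ∈ grading k n 2) (hg : Irreducible g) (hgd : g ∈ grading k n 2)
    (φ : HomogeneousLocalization.Away (grading k n) f ≃+*
      HomogeneousLocalization.Away (grading k n) g)
    (hφ : ∀ c : k, φ (HomogeneousLocalization.fromZeroRingHom _ _
      (algebraMap k (grading k n 0) c)) =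
        HomogeneousLocalization.fromZeroRingHom _ _ (algebraMap k (grading k n 0) c)) :
    IsRetractOf f g := by
  obtain ⟨s, M, hs, hsφ⟩ := exists_polynomial_lift hf.ne_zero hfd hg hgd φ.toRingHom φ.injective hφ
  obtain ⟨s', M', hs', hsφ'⟩ := exists_polynomial_lift hg.ne_zero hgd hf hfd φ.symm.toRingHom
    φ.symm.injective fun c ↦ by
      rw [RingEquiv.toRingHom_eq_coe, RingEquiv.coe_toRingHom, RingEquiv.symm_apply_eq, hφ]
  have hf0 := hf.ne_zero
  have hg0 := hg.ne_zero
  have hι : Function.Injective (algebraMap (MvPolynomial (Fin (n + 1)) k)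
    (FractionRing (MvPolynomial (Fin (n + 1)) k))) := IsFractionRing.injective _ _
  have hιf := (map_ne_zero_iff _ hι).2 hf0
  have hιg := (map_ne_zero_iff _ hι).2 hg0
  have key : ∀ i j, X i * X j * f ^ (M' * M) = aeval s' (s i) * aeval s' (s j) * f := by
    intro i j
    have hX : X i * X j ∈ grading k n (1 • 2) := (isHomogeneous_X k i).mul (isHomogeneous_X k j)
    obtain ⟨N, P, hP, hPφ⟩ := exists_mk_eq hgd fun _ : Unit ↦
      φ (.mk _ hfd 1 (X i * X j) hX)
    have h1 : P () * g ^ M = s i * s j * g ^ N := by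
      have := hsφ 1 _ hX
      rw [RingEquiv.toRingHom_eq_coe, RingEquiv.coe_toRingHom, hPφ (), awayToFrac_mk, mul_one,
        div_eq_div_iff (pow_ne_zero _ hιg) (pow_ne_zero _ hιg)] at this
      exact hι (by simpa using this)
    have h2 : X i * X j * f ^ (M' * N) = aeval s' (P ()) * f := by
      have := hsφ' N (P ()) (hP ())
      rw [← hPφ (), RingEquiv.toRingHom_eq_coe, RingEquiv.coe_toRingHom, RingEquiv.symm_apply_apply,
        awayToFrac_mk, div_eq_div_iff (pow_ne_zero _ hιf) (pow_ne_zero _ hιf)] at this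
      exact hι (by simpa using this)
    have h3 := congr(aeval s' $h1)
    simp only [map_mul, map_pow, hs', ← pow_mul] at h3
    refine mul_right_cancel₀ (pow_ne_zero (M' * N) hf0) ?_
    linear_combination f ^ (M' * M) * h2 + f * h3
  have hodd : ¬ Even (M' * M) := by
    rintro ⟨b, hb⟩
    refine not_mul_sq_eq_sq (a := aeval s' (s 0)) (c := X 0 * f ^ b) hf.prime
      (mul_ne_zero (X_ne_zero _) (pow_ne_zero _ hf0)) ?_
    have := key 0 0
    rw [hb] at this
    linear_combination -this
  obtain ⟨b, hb⟩ := Nat.not_even_iff_odd.1 hodd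
  have key' : ∀ i j, aeval s' (s i) * aeval s' (s j) = (X i * f ^ b) * (X j * f ^ b) := by
    intro i j
    refine mul_right_cancel₀ hf0 ?_
    rw [← key, hb]
    ring
  have hdvd : ∀ m, f - 1 ∣ f ^ m - 1 := fun m ↦ by simpa using sub_dvd_pow_sub_pow f 1 m
  have hX0 : (X 0 * f ^ b : MvPolynomial (Fin (n + 1)) k) ≠ 0 :=
    mul_ne_zero (X_ne_zero _) (pow_ne_zero _ hf0)
  rcases mul_self_eq_mul_self_iff.1 (key' 0 0) with h0 | h0
  · refine ⟨s, s', hs' ▸ hdvd _, fun i ↦ ?_⟩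
    have : aeval s' (s i) = X i * f ^ b := mul_left_cancel₀ hX0 (by rw [← key', h0])
    rw [this, ← mul_sub_one]
    exact (hdvd b).mul_left _
  · refine ⟨-s, s', hs' ▸ hdvd _, fun i ↦ ?_⟩
    have : aeval s' (s i) = -(X i * f ^ b) := mul_left_cancel₀ hX0 (by
      rw [mul_neg, ← key', h0, neg_mul, neg_neg])
    rw [Pi.neg_apply, map_neg, this, neg_neg, ← mul_sub_one]
    exact (hdvd b).mul_left _

section NormalForm

/-- The variables of the normal form with `m` hyperbolic planes, `d` squares and `s` variables that
do not occur. -/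
abbrev NormalFormIdx (m d s : ℕ) := (Fin m ⊕ Fin m) ⊕ (Fin d ⊕ Fin s)

/-- The quadratic form `∑ aᵢ bᵢ + ∑ zⱼ²`. -/
def normalForm (R : Type*) [CommRing R] (m d s : ℕ) : MvPolynomial (NormalFormIdx m d s) R :=
  ∑ i, X (.inl (.inl i)) * X (.inl (.inr i)) + ∑ j, X (.inr (.inl j)) ^ 2

theorem aeval_normalForm {R S : Type*} [CommRing R] [CommRing S] [Algebra R S] {m d s : ℕ}
    (x : NormalFormIdx m d s → S) : aeval x (normalForm R m d s) =
      ∑ i, x (.inl (.inl i)) * x (.inl (.inr i)) + ∑ j, x (.inr (.inl j)) ^ 2 := by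
  simp [normalForm]

theorem map_normalForm {R S : Type*} [CommRing R] [CommRing S] (η : R →+* S) (m d s : ℕ) :
    map η (normalForm R m d s) = normalForm S m d s := by
  simp [normalForm]

/-- Adding one hyperbolic plane to the variables of a normal form. -/
def NormalFormIdx.consEquiv (k : Type*) [Field k] (m d s : ℕ) :
    (k × k × (NormalFormIdx m d s → k)) ≃ₗ[k] (NormalFormIdx (m + 1) d s → k) where
  toFun x := Sum.elim (Sum.elim (Fin.cons x.1 fun i ↦ x.2.2 (.inl (.inl i)))
    (Fin.cons x.2.1 fun i ↦ x.2.2 (.inl (.inr i)))) fun i ↦ x.2.2 (.inr i)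
  invFun x := (x (.inl (.inl 0)), x (.inl (.inr 0)),
    Sum.elim (Sum.elim (fun i ↦ x (.inl (.inl i.succ))) fun i ↦ x (.inl (.inr i.succ)))
      fun i ↦ x (.inr i))
  map_add' x y := by
    ext ((i | i) | i)
    · induction i using Fin.cases <;> simp
    · induction i using Fin.cases <;> simp
    · simp
  map_smul' c x := by
    ext ((i | i) | i)
    · induction i using Fin.cases <;> simp
    · induction i using Fin.cases <;> simp
    · simp
  left_inv x := by
    refine Prod.ext (by simp) (Prod.ext (by simp) ?_)
    ext ((i | i) | i) <;> simp
  right_inv x := by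
    ext ((i | i) | i)
    · induction i using Fin.cases <;> simp
    · induction i using Fin.cases <;> simp
    · simp

variable {k V : Type*} [Field k] [AddCommGroup V] [Module k V]

/-- A quadratic form splits off a hyperbolic plane. -/
theorem exists_equiv_of_hyperbolic (Q : QuadraticForm k V) {u w : V}
    (hu : Q u = 0) (hw : Q w = 0) (huw : QuadraticMap.polar Q u w = 1) :
    ∃ (W : Submodule k V) (_ : w ∉ W) (L : V ≃ₗ[k] k × k × W),
      ∀ x, Q x = (L x).1 * (L x).2.1 + Q (L x).2.2 := by
  let B := Q.polarBilin
  have hB : ∀ x y, B x y = QuadraticMap.polar Q x y := fun _ _ ↦ rfl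
  have huu : B u u = 0 := by rw [hB, QuadraticMap.polar_self, hu, smul_zero]
  have hww : B w w = 0 := by rw [hB, QuadraticMap.polar_self, hw, smul_zero]
  have hwu : B w u = 1 := by rw [hB, QuadraticMap.polar_comm, huw]
  have huw' : B u w = 1 := huw
  let W : Submodule k V := LinearMap.ker (B u) ⊓ LinearMap.ker (B w)
  have hW : ∀ x, x - B w x • u - B u x • w ∈ W := fun x ↦ by
    simp [W, huu, hww, hwu, huw']
  let L : V →ₗ[k] k × k × W := (B w).prod ((B u).prod
    (LinearMap.codRestrict W (LinearMap.id - (B w).smulRight u - (B u).smulRight w) fun x ↦ by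
      simpa using hW x))
  let L' : k × k × W →ₗ[k] V := (LinearMap.toSpanSingleton k V u).coprod
    ((LinearMap.toSpanSingleton k V w).coprod W.subtype)
  have hLL' : L ∘ₗ L' = LinearMap.id := by
    ext x
    · simp [L, L', hwu]
    · simp [L, L', huu]
    · simp [L, L', huu, hwu]
    · simp [L, L', hww]
    · simp [L, L', huw']
    · simp [L, L', huw', hww]
    · have := x.2.2
      simpa [L, L', W] using this
    · have := x.2.1
      simpa [L, L', W] using this
    · obtain ⟨x, hx1, hx2⟩ := x
      rw [SetLike.mem_coe, LinearMap.mem_ker] at hx1 hx2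
      simp [L, L', hx1, hx2]
  have hL'L : L' ∘ₗ L = LinearMap.id := by
    ext x
    simp [L, L']
  refine ⟨W, fun h ↦ one_ne_zero (huw'.symm.trans h.1), .ofLinearMap L L' hLL' hL'L, fun x ↦ ?_⟩
  have hx : x = L' (L x) := congr($hL'L x).symm
  obtain ⟨⟨a, b, y⟩, hy⟩ : ∃ y, y = L x := ⟨_, rfl⟩
  rw [LinearEquiv.coe_ofLinearMap]
  conv_lhs => rw [hx]
  rw [← hy]
  have hy1 : QuadraticMap.polar Q u y = 0 := y.2.1
  have hy2 : QuadraticMap.polar Q w y = 0 := y.2.2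
  simp only [L', LinearMap.coprod_apply, LinearMap.toSpanSingleton_apply, Submodule.subtype_apply]
  rw [QuadraticMap.map_add Q, QuadraticMap.map_add Q, QuadraticMap.map_smul, QuadraticMap.map_smul,
    QuadraticMap.polar_add_right, QuadraticMap.polar_smul_left, QuadraticMap.polar_smul_right,
    QuadraticMap.polar_smul_left, QuadraticMap.polar_smul_left, hu, hw, hy1, hy2, huw]
  simp only [smul_eq_mul]
  ring

theorem exists_isCompl_of_no_hyperbolic [IsAlgClosed k] (Q : QuadraticForm k V)
    (hQ : ∀ u, Q u = 0 → ∀ w, QuadraticMap.polar Q u w = 0) {v : V} (hv : Q v = 1) :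
    ∃ (Z : Submodule k V) (L : V ≃ₗ[k] k × Z), ∀ x, Q x = (L x).1 ^ 2 := by
  let Z : Submodule k V :=
    { carrier := {x | Q x = 0}
      add_mem' := fun {x y} hx hy ↦ by
        have hx' : Q x = 0 := hx
        have hy' : Q y = 0 := hy
        change Q (x + y) = 0
        rw [QuadraticMap.map_add Q, hx', hy', hQ x hx']
        simp
      zero_mem' := Q.map_zero
      smul_mem' := fun c x hx ↦ by
        have hx' : Q x = 0 := hx
        change Q (c • x) = 0
        rw [QuadraticMap.map_smul, hx', smul_zero] }
  let L' : k × Z →ₗ[k] V := (LinearMap.toSpanSingleton k V v).coprod Z.subtype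
  have hQL' : ∀ y, Q (L' y) = y.1 ^ 2 := fun ⟨c, z⟩ ↦ by
    have hz : Q z = 0 := z.2
    simp only [L', LinearMap.coprod_apply, LinearMap.toSpanSingleton_apply, Submodule.subtype_apply]
    rw [QuadraticMap.map_add Q, QuadraticMap.map_smul, hv, hz, QuadraticMap.polar_comm, hQ _ hz]
    simp [sq]
  have hinj : Function.Injective L' := by
    rw [← LinearMap.ker_eq_bot, LinearMap.ker_eq_bot']
    intro y hy
    have h1 := hQL' y
    rw [hy, QuadraticMap.map_zero, eq_comm, sq_eq_zero_iff] at h1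
    refine Prod.ext h1 (Subtype.ext ?_)
    simpa [L', h1] using hy
  have hsurj : Function.Surjective L' := by
    intro x
    obtain ⟨t, ht⟩ := IsAlgClosed.exists_root (Polynomial.C 1 * Polynomial.X ^ 2 +
      Polynomial.C (QuadraticMap.polar Q x v) * Polynomial.X + Polynomial.C (Q x)) (by
        rw [Polynomial.degree_quadratic one_ne_zero]
        decide)
    have hz : Q (x + t • v) = 0 := by
      rw [QuadraticMap.map_add Q, QuadraticMap.map_smul, QuadraticMap.polar_smul_right, hv]
      simp only [Polynomial.IsRoot.def, Polynomial.eval_add, Polynomial.eval_mul,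
        Polynomial.eval_C, Polynomial.eval_pow, Polynomial.eval_X] at ht
      simp only [smul_eq_mul]
      linear_combination ht
    refine ⟨(-t, ⟨x + t • v, hz⟩), ?_⟩
    simp [L']
  refine ⟨Z, (LinearEquiv.ofBijective L' ⟨hinj, hsurj⟩).symm, fun x ↦ ?_⟩
  rw [← hQL']
  exact congr(Q $((LinearEquiv.ofBijective L' ⟨hinj, hsurj⟩).apply_symm_apply x)).symm

theorem exists_normalForm_equiv [IsAlgClosed k] [FiniteDimensional k V] (Q : QuadraticForm k V) :
    ∃ m d s, d ≤ 1 ∧ ∃ L : V ≃ₗ[k] (NormalFormIdx m d s → k),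
      ∀ x, Q x = aeval (L x) (normalForm k m d s) := by
  induction h : Module.finrank k V using Nat.strong_induction_on generalizing V with
  | _ N ih =>
  subst h
  by_cases hA : ∃ u w, Q u = 0 ∧ QuadraticMap.polar Q u w ≠ 0
  · obtain ⟨u, w, hu, huw⟩ := hA
    obtain ⟨w, hw, huw⟩ : ∃ w, Q w = 0 ∧ QuadraticMap.polar Q u w = 1 := by
      refine ⟨(QuadraticMap.polar Q u w)⁻¹ • w - ((QuadraticMap.polar Q u w)⁻¹ ^ 2 * Q w) • u,
        ?_, ?_⟩
      · rw [sub_eq_add_neg, ← neg_smul, QuadraticMap.map_add Q, QuadraticMap.map_smul,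
          QuadraticMap.map_smul, QuadraticMap.polar_smul_left, QuadraticMap.polar_smul_right, hu,
          QuadraticMap.polar_comm]
        simp only [smul_eq_mul]
        field_simp
        ring
      · rw [QuadraticMap.polar_sub_right, QuadraticMap.polar_smul_right,
          QuadraticMap.polar_smul_right, QuadraticMap.polar_self, hu]
        simp [huw]
    obtain ⟨W, hwW, L, hL⟩ := exists_equiv_of_hyperbolic Q hu hw huw
    have hlt : Module.finrank k W < Module.finrank k V :=
      Submodule.finrank_lt fun h ↦ hwW (h ▸ Submodule.mem_top)
    obtain ⟨m, d, s, hd, L', hL'⟩ := ih _ hlt (Q.comp W.subtype) rfl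
    refine ⟨m + 1, d, s, hd, L ≪≫ₗ ((LinearEquiv.refl k k).prodCongr
      ((LinearEquiv.refl k k).prodCongr L')) ≪≫ₗ NormalFormIdx.consEquiv k m d s, fun x ↦ ?_⟩
    have := hL' (L x).2.2
    rw [QuadraticMap.comp_apply, Submodule.subtype_apply] at this
    rw [hL, this, aeval_normalForm, aeval_normalForm, Fin.sum_univ_succ]
    simp [NormalFormIdx.consEquiv, add_assoc]
  · push Not at hA
    by_cases hQ : ∃ v, Q v ≠ 0
    · obtain ⟨v, hv⟩ := hQ
      obtain ⟨c, hc⟩ := IsAlgClosed.exists_pow_nat_eq (Q v)⁻¹ two_pos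
      obtain ⟨Z, L, hL⟩ := exists_isCompl_of_no_hyperbolic Q (fun u hu w ↦ hA u w hu) (v := c • v)
        (by rw [QuadraticMap.map_smul, ← sq, hc, smul_eq_mul, inv_mul_cancel₀ hv])
      refine ⟨0, 1, Module.finrank k Z, le_rfl, L ≪≫ₗ
        ((LinearEquiv.funUnique (Fin 1) k k).symm.prodCongr
          (Module.finBasis k Z).equivFun) ≪≫ₗ
        (LinearEquiv.sumArrowLequivProdArrow _ _ k k).symm ≪≫ₗ
        LinearEquiv.funCongrLeft k k (Equiv.emptySum _ _), fun x ↦ ?_⟩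
      rw [hL, aeval_normalForm]
      simp
    · push Not at hQ
      refine ⟨0, 0, Module.finrank k V, zero_le_one, (Module.finBasis k V).equivFun ≪≫ₗ
        LinearEquiv.funCongrLeft k k ((Equiv.emptySum _ _).trans (Equiv.emptySum _ _)),
        fun x ↦ ?_⟩
      rw [hQ, aeval_normalForm]
      simp

end NormalForm

section IsLinearlyEquivalent

variable {R : Type*} [CommRing R] {σ τ υ : Type*}

/-- Two polynomials agree up to an invertible linear change of variables. -/
def IsLinearlyEquivalent (f : MvPolynomial σ R) (g : MvPolynomial τ R) : Prop :=
  ∃ e : MvPolynomial σ R ≃ₐ[R] MvPolynomial τ R, (∀ i, (e (X i)).IsHomogeneous 1) ∧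
    (∀ j, (e.symm (X j)).IsHomogeneous 1) ∧ e f = g

theorem isHomogeneous_algHom {e : MvPolynomial σ R →ₐ[R] MvPolynomial τ R}
    (he : ∀ i, (e (X i)).IsHomogeneous 1) {p : MvPolynomial σ R} {d : ℕ} (hp : p.IsHomogeneous d) :
    (e p).IsHomogeneous d := by
  rw [aeval_unique e]
  exact one_mul d ▸ hp.aeval (fun i ↦ e (X i)) he

theorem IsLinearlyEquivalent.symm {f : MvPolynomial σ R} {g : MvPolynomial τ R}
    (h : IsLinearlyEquivalent f g) : IsLinearlyEquivalent g f := by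
  obtain ⟨e, h1, h2, rfl⟩ := h
  exact ⟨e.symm, h2, h1, e.symm_apply_apply f⟩

theorem IsLinearlyEquivalent.trans {f : MvPolynomial σ R} {g : MvPolynomial τ R}
    {h : MvPolynomial υ R} (hfg : IsLinearlyEquivalent f g) (hgh : IsLinearlyEquivalent g h) :
    IsLinearlyEquivalent f h := by
  obtain ⟨e, h1, h2, rfl⟩ := hfg
  obtain ⟨e', h1', h2', rfl⟩ := hgh
  exact ⟨e.trans e', fun i ↦ isHomogeneous_algHom (e := e'.toAlgHom) h1' (h1 i),
    fun i ↦ isHomogeneous_algHom (e := e.symm.toAlgHom) h2 (h2' i), rfl⟩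

theorem IsLinearlyEquivalent.isRetractOf {f : MvPolynomial σ R} {g : MvPolynomial τ R}
    (h : IsLinearlyEquivalent f g) : IsRetractOf f g := by
  obtain ⟨e, -, -, rfl⟩ := h
  have he : ∀ p, aeval (fun j ↦ e.symm (X j)) p = e.symm p := fun p ↦
    congr($(aeval_unique e.symm.toAlgHom) p).symm
  exact isRetractOf_of_aeval_eq (s := fun i ↦ e (X i)) (s' := fun j ↦ e.symm (X j))
    (by rw [he, e.symm_apply_apply]) fun i ↦ by rw [he, e.symm_apply_apply]

theorem eval_aeval (u : σ → MvPolynomial τ R) (y : τ → R) (p : MvPolynomial σ R) :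
    eval y (aeval u p) = eval (fun i ↦ eval y (u i)) p := by
  have h : (eval y).comp (algebraMap R (MvPolynomial τ R)) = RingHom.id R :=
    RingHom.ext fun c ↦ eval_C c
  rw [aeval_def, eval_eval₂, h, eval₂_id]

theorem isLinearlyEquivalent_of_eval {k : Type*} [Field k] [Infinite k] [Fintype σ] [Fintype τ]
    {f : MvPolynomial σ k} {g : MvPolynomial τ k} (L : (σ → k) ≃ₗ[k] (τ → k))
    (hL : ∀ x, eval x f = eval (L x) g) : IsLinearlyEquivalent f g := by
  classical
  let u : σ → MvPolynomial τ k := fun i ↦ ∑ j, C (L.symm (fun j' ↦ if j = j' then 1 else 0) i) * X j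
  let v : τ → MvPolynomial σ k := fun j ↦ ∑ i, C (L (fun i' ↦ if i = i' then 1 else 0) j) * X i
  have hu : ∀ y, (fun i ↦ eval y (u i)) = L.symm y := fun y ↦ by
    have := LinearMap.pi_apply_eq_sum_univ L.symm.toLinearMap y
    ext i
    simp only [u, map_sum, map_mul, eval_C, eval_X]
    simpa [mul_comm] using congr($this.symm i)
  have hv : ∀ x, (fun j ↦ eval x (v j)) = L x := fun x ↦ by
    have := LinearMap.pi_apply_eq_sum_univ L.toLinearMap x
    ext i
    simp only [v, map_sum, map_mul, eval_C, eval_X]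
    simpa [mul_comm] using congr($this.symm i)
  have heu : ∀ y p, eval y (aeval u p) = eval (L.symm y) p := fun y p ↦ by
    rw [← hu]
    exact eval_aeval ..
  have hev : ∀ x p, eval x (aeval v p) = eval (L x) p := fun x p ↦ by
    rw [← hv]
    exact eval_aeval ..
  refine ⟨.ofAlgHom (aeval u) (aeval v) ?_ ?_, fun i ↦ ?_, fun j ↦ ?_, ?_⟩
  · refine AlgHom.ext fun p ↦ MvPolynomial.funext fun y ↦ ?_
    rw [AlgHom.comp_apply, heu, hev, LinearEquiv.apply_symm_apply, AlgHom.id_apply]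
  · refine AlgHom.ext fun p ↦ MvPolynomial.funext fun y ↦ ?_
    rw [AlgHom.comp_apply, hev, heu, LinearEquiv.symm_apply_apply, AlgHom.id_apply]
  · simpa [u] using IsHomogeneous.sum _ _ _ fun j _ ↦ isHomogeneous_C_mul_X _ _
  · simpa [v] using IsHomogeneous.sum _ _ _ fun j _ ↦ isHomogeneous_C_mul_X _ _
  · refine MvPolynomial.funext fun y ↦ ?_
    rw [AlgEquiv.ofAlgHom_apply, heu, hL, LinearEquiv.apply_symm_apply]

theorem exists_linearMap_eq_eval {k : Type*} [Field k] {f : MvPolynomial σ k}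
    (hf : f.IsHomogeneous 1) : ∃ l : (σ → k) →ₗ[k] k, ∀ x, l x = eval x f := by
  rw [← mem_homogeneousSubmodule, homogeneousSubmodule_one_eq_span_X] at hf
  induction hf using Submodule.span_induction with
  | mem x hx =>
    obtain ⟨i, rfl⟩ := hx
    exact ⟨LinearMap.proj i, by simp⟩
  | zero => exact ⟨0, by simp⟩
  | add x y _ _ hx hy =>
    obtain ⟨l, hl⟩ := hx
    obtain ⟨l', hl'⟩ := hy
    exact ⟨l + l', by simp [hl, hl']⟩
  | smul c x _ hx =>
    obtain ⟨l, hl⟩ := hx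
    exact ⟨c • l, by simp [hl]⟩

theorem exists_quadraticForm_eq_eval {k : Type*} [Field k] {f : MvPolynomial σ k}
    (hf : f.IsHomogeneous 2) : ∃ Q : QuadraticForm k (σ → k), ∀ x, Q x = eval x f := by
  rw [← mem_homogeneousSubmodule, ← homogeneousSubmodule_one_pow, sq] at hf
  induction hf using Submodule.mul_induction_on' with
  | mem_mul_mem a ha b hb =>
    obtain ⟨l, hl⟩ := exists_linearMap_eq_eval ha
    obtain ⟨l', hl'⟩ := exists_linearMap_eq_eval hb
    exact ⟨QuadraticMap.linMulLin l l', by simp [hl, hl']⟩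
  | add x _ y _ hx hy =>
    obtain ⟨l, hl⟩ := hx
    obtain ⟨l', hl'⟩ := hy
    exact ⟨l + l', by simp [hl, hl']⟩

theorem exists_isLinearlyEquivalent_normalForm {k : Type*} [Field k] [IsAlgClosed k] [Fintype σ]
    {f : MvPolynomial σ k} (hf : f.IsHomogeneous 2) :
    ∃ m d s, d ≤ 1 ∧ m + m + (d + s) = Fintype.card σ ∧
      IsLinearlyEquivalent f (normalForm k m d s) := by
  obtain ⟨Q, hQ⟩ := exists_quadraticForm_eq_eval hf
  obtain ⟨m, d, s, hd, L, hL⟩ := exists_normalForm_equiv Q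
  have := IsAlgClosed.instInfinite (K := k)
  refine ⟨m, d, s, hd, by simpa using L.finrank_eq.symm, isLinearlyEquivalent_of_eval L fun x ↦ ?_⟩
  rw [← hQ, hL, aeval_eq_eval]

end IsLinearlyEquivalent

section Specialization

theorem Int.isJacobsonRing : IsJacobsonRing ℤ := by
  rw [isJacobsonRing_iff_prime_eq]
  intro P hP
  by_cases h : P = ⊥
  · subst h
    refine le_antisymm (fun x hx ↦ ?_) Ideal.le_jacobson
    have := Ideal.mem_jacobson_bot.1 hx x
    rw [Int.isUnit_iff] at this
    rw [Ideal.mem_bot]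
    rcases this with h | h
    · exact mul_self_eq_zero.1 (by linarith)
    · nlinarith [mul_self_nonneg x]
  · have := hP.isMaximal h
    exact Ideal.jacobson_eq_self_of_isMaximal

/-- A field that is finitely generated as a ring is finite. -/
theorem Field.finite_of_finiteType_int (F : Type*) [Field F] [Algebra.FiniteType ℤ F] :
    Finite F := by
  have := Int.isJacobsonRing
  have := finite_of_finite_type_of_isJacobsonRing ℤ F
  have hinj : ¬ Function.Injective (algebraMap ℤ F) := fun h ↦
    Int.not_isField (isField_of_isIntegral_of_isField h (Field.toIsField F))
  rw [injective_iff_map_eq_zero] at hinj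
  push Not at hinj
  obtain ⟨a, ha, ha0⟩ := hinj
  refine Module.finite_of_fg_torsion F fun {x} ↦ ⟨⟨a, mem_nonZeroDivisors_of_ne_zero ha0⟩, ?_⟩
  rw [Submonoid.mk_smul, Algebra.smul_def, ha, zero_mul]

variable {σ τ : Type*}

theorem map_aeval_eq {R S : Type*} [CommRing R] [CommRing S] (η : R →+* S)
    (u : σ → MvPolynomial τ R) (p : MvPolynomial σ R) :
    map η (aeval u p) = aeval (fun i ↦ map η (u i)) (map η p) :=
  map_bind₁ ..

theorem map_map_intCast {R S : Type*} [CommRing R] [CommRing S] (η : R →+* S)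
    (p : MvPolynomial σ ℤ) :
    map η (map (Int.castRingHom R) p) = map (Int.castRingHom S) p := by
  rw [map_map, RingHom.ext_int (η.comp (Int.castRingHom R)) (Int.castRingHom S)]

theorem exists_map_val_eq {A : Type*} [CommRing A] {R : Subalgebra ℤ A} {p : MvPolynomial σ A}
    (hp : (p.coeffs : Set A) ⊆ R) : ∃ q : MvPolynomial σ R, map R.val.toRingHom q = p :=
  mem_range_map_iff_coeffs_subset.2 (hp.trans fun x hx ↦ ⟨⟨x, hx⟩, rfl⟩)

theorem IsRetractOf.map {R S : Type*} [CommRing R] [CommRing S] (η : R →+* S)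
    {f : MvPolynomial σ R} {g : MvPolynomial τ R} (h : IsRetractOf f g) :
    IsRetractOf (map η f) (map η g) := by
  obtain ⟨s, s', h1, h2⟩ := h
  refine ⟨fun i ↦ MvPolynomial.map η (s i), fun i ↦ MvPolynomial.map η (s' i), ?_, fun i ↦ ?_⟩
  · simpa only [map_sub, map_one, map_aeval_eq] using map_dvd (MvPolynomial.map η) h1
  · simpa only [map_sub, map_one, map_aeval_eq, map_X] using map_dvd (MvPolynomial.map η) (h2 i)

variable [Finite σ] [Finite τ]

theorem IsRetractOf.exists_finset {A : Type*} [CommRing A] {f : MvPolynomial σ ℤ}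
    {g : MvPolynomial τ ℤ}
    (h : IsRetractOf (MvPolynomial.map (Int.castRingHom A) f)
      (MvPolynomial.map (Int.castRingHom A) g)) :
    ∃ C : Finset A, ∀ R : Subalgebra ℤ A, (C : Set A) ⊆ R →
      IsRetractOf (MvPolynomial.map (Int.castRingHom R) f)
        (MvPolynomial.map (Int.castRingHom R) g) := by
  classical
  obtain ⟨s, s', ⟨c, hc⟩, h2⟩ := h
  choose e he using h2
  have := Fintype.ofFinite σ
  have := Fintype.ofFinite τ
  refine ⟨c.coeffs ∪ Finset.univ.biUnion (fun i ↦ (s i).coeffs ∪ (e i).coeffs) ∪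
    Finset.univ.biUnion fun i ↦ (s' i).coeffs, fun R hR ↦ ?_⟩
  simp only [Finset.coe_union, Finset.coe_biUnion, Finset.mem_coe, Finset.mem_univ, Set.iUnion_true,
    Set.union_subset_iff, Set.iUnion_subset_iff] at hR
  obtain ⟨⟨hcR, hseR⟩, hs'R⟩ := hR
  have hinj : Function.Injective R.val.toRingHom := Subtype.val_injective
  obtain ⟨c, rfl⟩ := exists_map_val_eq hcR
  choose s hs using fun i ↦ exists_map_val_eq (hseR i).1
  choose e he' using fun i ↦ exists_map_val_eq (hseR i).2
  choose s' hs' using fun i ↦ exists_map_val_eq (hs'R i)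
  obtain rfl := funext hs
  obtain rfl := funext hs'
  obtain rfl := funext he'
  refine ⟨s, s', ⟨c, map_injective _ hinj ?_⟩, fun i ↦ ⟨e i, map_injective _ hinj ?_⟩⟩
  · simpa only [map_sub, map_one, map_mul, map_aeval_eq, map_map_intCast] using hc
  · simpa only [map_sub, map_one, map_mul, map_aeval_eq, map_map_intCast, map_X] using he i

theorem exists_finite_field_isRetractOf {A : Type} [CommRing A] [Nontrivial A]
    {f : MvPolynomial σ ℤ} {g : MvPolynomial τ ℤ}
    (hfg : IsRetractOf (map (Int.castRingHom A) f) (map (Int.castRingHom A) g))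
    (hgf : IsRetractOf (map (Int.castRingHom A) g) (map (Int.castRingHom A) f)) :
    ∃ (F : Type) (_ : Field F), Finite F ∧
      IsRetractOf (map (Int.castRingHom F) f) (map (Int.castRingHom F) g) ∧
      IsRetractOf (map (Int.castRingHom F) g) (map (Int.castRingHom F) f) := by
  classical
  obtain ⟨C, hC⟩ := hfg.exists_finset
  obtain ⟨C', hC'⟩ := hgf.exists_finset
  let R : Subalgebra ℤ A := Algebra.adjoin ℤ (C ∪ C' : Finset A)
  have hRC : ((C ∪ C' : Finset A) : Set A) ⊆ R := Algebra.subset_adjoin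
  rw [Finset.coe_union, Set.union_subset_iff] at hRC
  have : Algebra.FiniteType ℤ R :=
    (Subalgebra.fg_iff_finiteType _).1 (Subalgebra.fg_adjoin_finset _)
  obtain ⟨M, hM⟩ := Ideal.exists_maximal R
  let : Field (R ⧸ M) := Ideal.Quotient.field M
  have : @Algebra.FiniteType ℤ (R ⧸ M) _ _ (Ring.toIntAlgebra _) :=
    .of_surjective (Ideal.Quotient.mk M).toIntAlgHom Ideal.Quotient.mk_surjective
  refine ⟨R ⧸ M, inferInstance, Field.finite_of_finiteType_int _, ?_, ?_⟩
  · simpa only [map_map_intCast] using (hC R hRC.1).map (Ideal.Quotient.mk M)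
  · simpa only [map_map_intCast] using (hC' R hRC.2).map (Ideal.Quotient.mk M)

end Specialization

section Counting

/-- The number of `S`-points of the affine scheme `{f = 1}`. -/
def pointCount {R σ : Type*} [CommRing R] (f : MvPolynomial σ R) (S : Type*) [CommRing S]
    [Algebra R S] : ℕ :=
  Nat.card {x : σ → S // aeval x f = 1}

theorem IsRetractOf.pointCount_le {R σ τ : Type*} [CommRing R] [Finite τ] {f : MvPolynomial σ R}
    {g : MvPolynomial τ R} (h : IsRetractOf f g) (S : Type*) [CommRing S] [Algebra R S] [Finite S] :
    pointCount f S ≤ pointCount g S := by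
  obtain ⟨s, s', h1, h2⟩ := h
  have key : ∀ x : σ → S, aeval x f = 1 → ∀ p, f - 1 ∣ p → aeval x p = 0 := fun x hx p hp ↦ by
    have := map_dvd (aeval x) hp
    rwa [map_sub, map_one, hx, sub_self, zero_dvd_iff] at this
  refine Nat.card_le_card_of_injective
    (fun x ↦ ⟨fun j ↦ aeval x.1 (s' j), ?_⟩) fun x y hxy ↦ Subtype.ext (funext fun i ↦ ?_)
  · have := key x.1 x.2 _ h1
    rwa [map_sub, map_one, sub_eq_zero, comp_aeval_apply] at this
  · have hx := key x.1 x.2 _ (h2 i)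
    have hy := key y.1 y.2 _ (h2 i)
    rw [map_sub, aeval_X, sub_eq_zero, comp_aeval_apply] at hx hy
    rw [← hx, ← hy]
    exact congr(aeval $(congr(Subtype.val $hxy)) (s i))

theorem IsRetractOf.pointCount_eq {R σ τ : Type*} [CommRing R] [Finite σ] [Finite τ]
    {f : MvPolynomial σ R} {g : MvPolynomial τ R} (hfg : IsRetractOf f g) (hgf : IsRetractOf g f)
    (S : Type*) [CommRing S] [Algebra R S] [Finite S] : pointCount f S = pointCount g S :=
  (hfg.pointCount_le S).antisymm (hgf.pointCount_le S)

theorem sum_sumArrow {α β S M : Type*} [Fintype α] [Fintype β] [DecidableEq α] [DecidableEq β]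
    [Fintype S] [AddCommMonoid M] (φ : (α ⊕ β → S) → M) :
    ∑ x, φ x = ∑ a, ∑ b, φ (Sum.elim a b) := by
  rw [← (Equiv.sumArrowEquivProdArrow α β S).symm.sum_comp, Fintype.sum_prod_type]
  rfl

theorem sum_normalFormIdx {S M : Type*} [Fintype S] [AddCommMonoid M] {m d s : ℕ}
    (φ : (NormalFormIdx m d s → S) → M) :
    ∑ x, φ x = ∑ t, ∑ z, ∑ a, ∑ b, φ (Sum.elim (Sum.elim a b) (Sum.elim z t)) := by
  rw [sum_sumArrow, Finset.sum_comm, sum_sumArrow, Finset.sum_comm]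
  simp_rw [sum_sumArrow (α := Fin m)]

variable {F : Type*} [Field F]

/-- The differential of a normal form in characteristic two, as a function of the tangent vector. -/
def normalFormDeriv {m d s : ℕ} (x : NormalFormIdx m d s → F) :
    (NormalFormIdx m d s → F) →ₗ[F] F :=
  ∑ i, (x (.inl (.inl i)) • LinearMap.proj (.inl (.inr i)) +
    x (.inl (.inr i)) • LinearMap.proj (.inl (.inl i)))

theorem normalFormDeriv_eq_zero {m d s : ℕ} {x : NormalFormIdx m d s → F} :
    normalFormDeriv x = 0 ↔ ∀ i, x (.inl i) = 0 := by
  classical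
  refine ⟨fun h ↦ ?_, fun h ↦ by simp [normalFormDeriv, h]⟩
  rintro (i | i)
  · simpa [normalFormDeriv, Pi.single_apply] using congr($h (Pi.single (.inl (.inr i)) 1))
  · simpa [normalFormDeriv, Pi.single_apply] using congr($h (Pi.single (.inl (.inl i)) 1))

theorem aeval_dualNumber_normalForm_eq_one (h2 : (2 : F) = 0) {m d s : ℕ}
    (x : NormalFormIdx m d s → DualNumber F) : aeval x (normalForm F m d s) = 1 ↔
      aeval (fun i ↦ (x i).fst) (normalForm F m d s) = 1 ∧
        normalFormDeriv (fun i ↦ (x i).fst) (fun i ↦ (x i).snd) = 0 := by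
  have h : ∀ a : F, a + a = 0 := fun a ↦ by rw [← two_mul, h2, zero_mul]
  rw [TrivSqZeroExt.ext_iff, aeval_normalForm, aeval_normalForm]
  simp [TrivSqZeroExt.fst_sum, TrivSqZeroExt.snd_sum, sq, h, normalFormDeriv,
    mul_comm]

instance [Finite F] : Finite (DualNumber F) := inferInstanceAs (Finite (F × F))

variable [Fintype F] [DecidableEq F]

theorem card_mul_sum_linearMap {V : Type*} [AddCommGroup V] [Module F V] [Fintype V]
    (l : V →ₗ[F] F) [Decidable (l = 0)] (c : F) :
    (Fintype.card F : ℤ) * ∑ x, (if l x = c then 1 else 0) = Fintype.card V +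
      if l = 0 then (if c = 0 then (Fintype.card F : ℤ) * Fintype.card V else 0) - Fintype.card V
      else 0 := by
  split_ifs with h hc
  · simp [h, hc]
  · simp [h, Ne.symm hc]
  · have hl := LinearMap.surjective h
    have key : ∀ c', ∑ x, (if l x = c' then 1 else 0 : ℤ) = ∑ x, (if l x = c then 1 else 0) := by
      intro c'
      obtain ⟨y, hy⟩ := hl (c' - c)
      rw [← Equiv.sum_comp (Equiv.addRight y)]
      simp [hy, ← add_sub_assoc, add_sub_right_comm, sub_eq_zero]
    have : ∑ c', ∑ x, (if l x = c' then 1 else 0 : ℤ) = Fintype.card V := by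
      rw [Finset.sum_comm]
      simp
    simp_rw [key] at this
    simpa using this

theorem card_mul_sum_dotProduct (m : ℕ) (c : F) :
    (Fintype.card F : ℤ) * ∑ a : Fin m → F, ∑ b : Fin m → F, (if ∑ i, a i * b i = c then 1 else 0) =
      Fintype.card F ^ (2 * m) - Fintype.card F ^ m +
        if c = 0 then (Fintype.card F : ℤ) ^ (m + 1) else 0 := by
  have key : ∀ a : Fin m → F, (Fintype.card F : ℤ) *
      ∑ b : Fin m → F, (if ∑ i, a i * b i = c then 1 else 0) = Fintype.card F ^ m +
        if a = 0 then (if c = 0 then (Fintype.card F : ℤ) ^ (m + 1) else 0) - Fintype.card F ^ m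
        else 0 := by
    classical
    intro a
    have h0 : dotProductBilin F F a = 0 ↔ a = 0 := by
      refine ⟨fun h ↦ funext fun i ↦ ?_, fun h ↦ by simp [h]⟩
      simpa using congr($h (Pi.single i 1))
    have := card_mul_sum_linearMap (dotProductBilin F F a) c
    simp only [h0] at this
    simpa [dotProduct, pow_succ'] using this
  rw [Finset.mul_sum, Finset.sum_congr rfl fun a _ ↦ key a, Finset.sum_add_distrib]
  simp
  ring

variable (F) in
/-- The number of points of a sphere. -/
def sphereCount (d : ℕ) : ℤ :=
  ∑ z : Fin d → F, if ∑ j, z j ^ 2 = 1 then 1 else 0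

theorem pointCount_eq_sum {σ : Type*} [Fintype σ] [DecidableEq σ] (f : MvPolynomial σ F) :
    (pointCount f F : ℤ) = ∑ x : σ → F, if aeval x f = 1 then 1 else 0 := by
  rw [pointCount, Nat.card_eq_fintype_card, Fintype.card_subtype, Finset.natCast_card_filter]

theorem card_mul_pointCount_normalForm (m d s : ℕ) :
    (Fintype.card F : ℤ) * pointCount (normalForm F m d s) F =
      Fintype.card F ^ (m + m + (d + s)) - Fintype.card F ^ (m + (d + s)) +
        sphereCount F d * Fintype.card F ^ (m + (1 + s)) := by
  have h : (Fintype.card F : ℤ) * pointCount (normalForm F m d s) F =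
      (Fintype.card F : ℤ) ^ s * ∑ z : Fin d → F, (Fintype.card F : ℤ) *
        ∑ a : Fin m → F, ∑ b : Fin m → F,
          (if ∑ i, a i * b i = 1 - ∑ j, z j ^ 2 then 1 else 0) := by
    rw [pointCount_eq_sum, ← Finset.mul_sum, sum_normalFormIdx]
    simp only [aeval_normalForm, Sum.elim_inl, Sum.elim_inr, ← eq_sub_iff_add_eq]
    rw [Finset.sum_const, Finset.card_univ, Fintype.card_fun, Fintype.card_fin, nsmul_eq_mul,
      Nat.cast_pow]
    ring
  rw [h]
  simp_rw [card_mul_sum_dotProduct]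
  have h' : (∑ z : Fin d → F, if 1 - ∑ j, z j ^ 2 = 0 then (Fintype.card F : ℤ) ^ (m + 1) else 0) =
      sphereCount F d * Fintype.card F ^ (m + 1) := by
    simp_rw [sphereCount, Finset.sum_mul, ite_mul, one_mul, zero_mul, sub_eq_zero,
      eq_comm (a := (1 : F))]
  rw [Finset.sum_add_distrib, h', Finset.sum_const, Finset.card_univ, Fintype.card_fun,
    Fintype.card_fin, nsmul_eq_mul, Nat.cast_pow]
  ring

theorem pointCount_dualNumber_normalForm (h2 : (2 : F) = 0) (m d s : ℕ) :
    (pointCount (normalForm F m d s) (DualNumber F) : ℤ) =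
      ∑ x : NormalFormIdx m d s → F, if aeval x (normalForm F m d s) = 1 then
        ∑ y, if normalFormDeriv x y = 0 then 1 else 0 else 0 := by
  let e : (NormalFormIdx m d s → DualNumber F) ≃
      (NormalFormIdx m d s → F) × (NormalFormIdx m d s → F) :=
    { toFun x := (fun i ↦ (x i).fst, fun i ↦ (x i).snd)
      invFun y i := (y.1 i, y.2 i)
      left_inv _ := rfl
      right_inv _ := rfl }
  rw [pointCount, Nat.card_congr (e.subtypeEquiv (q := fun y ↦ aeval y.1 (normalForm F m d s) = 1 ∧
    normalFormDeriv y.1 y.2 = 0) fun x ↦ by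
      rw [aeval_dualNumber_normalForm_eq_one h2]
      rfl),
    Nat.card_eq_fintype_card, Fintype.card_subtype, Finset.natCast_card_filter,
    Fintype.sum_prod_type]
  refine Finset.sum_congr rfl fun x _ ↦ ?_
  split_ifs with h <;> simp only [h, true_and, false_and, if_false, Finset.sum_const_zero]

theorem card_mul_pointCount_dualNumber_normalForm (h2 : (2 : F) = 0) (m d s : ℕ) :
    (Fintype.card F : ℤ) * pointCount (normalForm F m d s) (DualNumber F) =
      Fintype.card F ^ (m + m + (d + s)) * (pointCount (normalForm F m d s) F +
        (Fintype.card F - 1) * (sphereCount F d * Fintype.card F ^ s)) := by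
  classical
  have hS : sphereCount F d * Fintype.card F ^ s = ∑ x : NormalFormIdx m d s → F,
      if aeval x (normalForm F m d s) = 1 ∧ normalFormDeriv x = 0 then 1 else 0 := by
    simp_rw [sum_normalFormIdx, normalFormDeriv_eq_zero, aeval_normalForm, Sum.forall]
    simp only [Sum.elim_inl, Sum.elim_inr, ← funext_iff]
    have key : ∀ (a b : Fin m → F) (z : Fin d → F),
        (if ∑ i, a i * b i + ∑ j, z j ^ 2 = 1 ∧ (a = fun _ ↦ 0) ∧ b = fun _ ↦ 0 then 1 else 0 : ℤ) =
          if b = 0 then if a = 0 then if ∑ j, z j ^ 2 = 1 then 1 else 0 else 0 else 0 := by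
      intro a b z
      by_cases ha : a = 0 <;> by_cases hb : b = 0 <;> simp_all [Pi.zero_def]
    simp_rw [key]
    simp [sphereCount, mul_comm]
  rw [pointCount_dualNumber_normalForm h2, hS, pointCount_eq_sum, Finset.mul_sum, mul_add,
    Finset.mul_sum, Finset.mul_sum, Finset.mul_sum, ← Finset.sum_add_distrib]
  refine Finset.sum_congr rfl fun x _ ↦ ?_
  rw [mul_ite, card_mul_sum_linearMap]
  by_cases hx : aeval x (normalForm F m d s) = 1 <;> by_cases hl : normalFormDeriv x = 0
  · simp [hx, hl]
    ring
  · simp [hx, hl]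
  · simp only [hx, if_false, false_and, mul_zero, add_zero]
  · simp only [hx, if_false, false_and, mul_zero, add_zero]

theorem sphereCount_zero : sphereCount F 0 = 0 := by
  simp [sphereCount]

theorem sphereCount_one : sphereCount F 1 = Fintype.card {z : F // z ^ 2 = 1} := by
  rw [Fintype.card_subtype, Finset.natCast_card_filter, sphereCount,
    ← (Equiv.funUnique (Fin 1) F).symm.sum_comp]
  simp

theorem one_le_sphereCount_one : 1 ≤ sphereCount F 1 := by
  rw [sphereCount_one, Nat.one_le_cast]
  exact Fintype.card_pos_iff.2 ⟨⟨1, one_pow 2⟩⟩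

theorem two_eq_zero_of_sphereCount_one (h : sphereCount F 1 = 1) : (2 : F) = 0 := by
  rw [sphereCount_one, Nat.cast_eq_one, Fintype.card_eq_one_iff] at h
  obtain ⟨z, hz⟩ := h
  have : (1 : F) = -1 := congr(Subtype.val $((hz ⟨1, one_pow 2⟩).trans (hz ⟨-1, by simp⟩).symm))
  rw [← one_add_one_eq_two]
  exact eq_neg_iff_add_eq_zero.1 this

variable {m d s m' d' s' : ℕ}

theorem normalForm_indices_eq (hd : d ≤ 1) (hd' : d' ≤ 1)
    (hn : m + m + (d + s) = m' + m' + (d' + s'))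
    (h : pointCount (normalForm F m d s) F = pointCount (normalForm F m' d' s') F)
    (hε : pointCount (normalForm F m d s) (DualNumber F) =
      pointCount (normalForm F m' d' s') (DualNumber F)) :
    m = m' ∧ d = d' ∧ s = s' := by
  have hq : (1 : ℤ) < Fintype.card F := by exact_mod_cast Fintype.one_lt_card
  have he := one_le_sphereCount_one (F := F)
  have h1 := card_mul_pointCount_normalForm (F := F) m d s
  rw [h, card_mul_pointCount_normalForm, hn] at h1
  have hp : ∀ i : ℕ, (0 : ℤ) < Fintype.card F ^ i := fun i ↦ pow_pos (by lia) i
  have hinj : ∀ {i j : ℕ}, (Fintype.card F : ℤ) ^ i = Fintype.card F ^ j → i = j := fun hij ↦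
    (pow_right_inj₀ (by lia) hq.ne').1 hij
  obtain rfl | rfl : d = 0 ∨ d = 1 := by lia
  all_goals obtain rfl | rfl : d' = 0 ∨ d' = 1 := by lia
  · rw [sphereCount_zero] at h1
    have := @hinj (m + (0 + s)) (m' + (0 + s')) (by linarith)
    lia
  · rw [sphereCount_zero] at h1
    nlinarith [hp (m + (0 + s)), hp (m' + (1 + s'))]
  · rw [sphereCount_zero] at h1
    nlinarith [hp (m' + (0 + s')), hp (m + (1 + s))]
  · obtain he | he := he.eq_or_lt
    · have h2 := two_eq_zero_of_sphereCount_one he.symm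
      have h3 := card_mul_pointCount_dualNumber_normalForm h2 m 1 s
      rw [hε, card_mul_pointCount_dualNumber_normalForm h2, hn, h, ← he, one_mul, one_mul,
        mul_right_inj' (hp _).ne', add_right_inj, mul_right_inj' (by lia)] at h3
      have := hinj h3
      lia
    · have h2 : (sphereCount F 1 - 1) * (Fintype.card F : ℤ) ^ (m + (1 + s)) =
          (sphereCount F 1 - 1) * (Fintype.card F : ℤ) ^ (m' + (1 + s')) := by
        linear_combination -h1
      rw [mul_right_inj' (by lia)] at h2
      have := hinj h2
      lia

end Counting

theorem isLinearlyEquivalent_of_isRetractOf {k : Type} [Field k] [IsAlgClosed k] {n : ℕ}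
    {f g : MvPolynomial (Fin (n + 1)) k} (hf : f.IsHomogeneous 2) (hg : g.IsHomogeneous 2)
    (hfg : IsRetractOf f g) (hgf : IsRetractOf g f) : IsLinearlyEquivalent f g := by
  classical
  obtain ⟨m, d, s, hd, hn, h⟩ := exists_isLinearlyEquivalent_normalForm hf
  obtain ⟨m', d', s', hd', hn', h'⟩ := exists_isLinearlyEquivalent_normalForm hg
  have h1 := h.symm.isRetractOf.trans (hfg.trans h'.isRetractOf)
  have h2 := h'.symm.isRetractOf.trans (hgf.trans h.isRetractOf)
  rw [← map_normalForm (Int.castRingHom k) m, ← map_normalForm (Int.castRingHom k) m'] at h1 h2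
  obtain ⟨F, _, _, h3, h4⟩ := exists_finite_field_isRetractOf h1 h2
  simp only [map_normalForm] at h3 h4
  have := Fintype.ofFinite F
  obtain ⟨rfl, rfl, rfl⟩ := normalForm_indices_eq hd hd' (hn.trans hn'.symm)
    (h3.pointCount_eq h4 F) (h3.pointCount_eq h4 (DualNumber F))
  exact h.trans h'.symm

/-- **Theorem B.** Let `n ≥ 2` and let `k` be an algebraically closed field.  If the
complements of two irreducible quadric hypersurfaces `H = V(f)`, `H' = V(g)` in `ℙⁿ_k`
are isomorphic, then there is an automorphism of `ℙⁿ_k` sending `H` onto `H'`. -/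
theorem stmt1 (k : Type) [Field k] [IsAlgClosed k] (n : ℕ) (hn : 2 ≤ n)
    (f g : MvPolynomial (Fin (n + 1)) k)
    (hf : Irreducible f) (hfd : f.IsHomogeneous 2)
    (hg : Irreducible g) (hgd : g.IsHomogeneous 2)
    (hiso : IsoOver (PnFStruct k n f) (PnFStruct k n g)) :
    ∃ φ : ProjSpace k n ≅ ProjSpace k n,
      φ.hom ≫ projStruct k n = projStruct k n ∧
      φ.hom.base '' zeroLocusSet k n f = zeroLocusSet k n g := by
  obtain ⟨φ, hφ⟩ := exists_away_equiv_of_isoOver hfd hgd two_pos two_pos hiso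
  obtain ⟨e, he, he', hfg⟩ := (isLinearlyEquivalent_of_isRetractOf hfd hgd
    (isRetractOf_of_away_equiv hf hfd hg hgd φ hφ)
    (isRetractOf_of_away_equiv hg hgd hf hfd φ.symm fun c ↦
      φ.symm_apply_eq.2 (hφ c).symm)).symm
  exact exists_proj_automorphism e
    (fun i x hx ↦ isHomogeneous_algHom (e := e.toAlgHom) he hx)
    (fun i x hx ↦ isHomogeneous_algHom (e := e.symm.toAlgHom) he' hx) hfg

end
end
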